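/- Let n ≥ 2 and let f and g be meromorphic mappings of ℂ into ℙⁿ(ℂ) given by reduced representations. Let H₁,…,H_{2n+2} be 2n+2 hyperplanes of ℙⁿ(ℂ) in general position such that f⁻¹(H_i) ∩ f⁻¹(H_j) = ∅ for all 1 ≤ i < j ≤ 2n+2. Assume that f and g share H₁,…,H_{2n+1} ignoring multiplicity and share H_{2n+2} with multiplicity truncated by n+1. Then the map f×g : ℂ → ℙⁿ(ℂ)×ℙⁿ(ℂ) is algebraically degenerate. (One-variable case m = 1 of the paper's Main Theorem.) -/

import Mathlib

open MeasureTheory Filter Topology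

noncomputable section

/-- `f` is a reduced representation of a meromorphic map `ℂ → ℙⁿ(ℂ)`:
the components are entire functions with no common zero
(hence not all identically zero). -/
def ReducedRepr (n : ℕ) (f : Fin (n + 1) → ℂ → ℂ) : Prop :=
  (∀ i, Differentiable ℂ (f i)) ∧ ∀ z : ℂ, ∃ i, f i z ≠ 0

/-- The entire function `(f, H) = a₀f₀ + ⋯ + aₙfₙ` attached to the hyperplane
with coefficient vector `a`. -/
def lform {n : ℕ} (a : Fin (n + 1) → ℂ) (f : Fin (n + 1) → ℂ → ℂ) (z : ℂ) : ℂ :=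
  ∑ i, a i * f i z

/-- The vanishing order of the entire function `F` at `z`
(the least `k` such that the `k`-th derivative does not vanish at `z`). -/
def vord (F : ℂ → ℂ) (z : ℂ) : ℕ :=
  sInf {k : ℕ | iteratedDeriv k F z ≠ 0}

/-- The hyperplanes with coefficient vectors `H 0, …, H (q-1)` are in general
position: any `n + 1` of the coefficient vectors are linearly independent. -/
def GenPos (n q : ℕ) (H : Fin q → Fin (n + 1) → ℂ) : Prop :=
  ∀ s : Finset (Fin q), s.card = n + 1 → LinearIndependent ℂ (fun i : s => H i.1)

/-- `f` and `g` share the hyperplane with coefficient vector `a` with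
multiplicity truncated by `d`: the truncated zero divisors of `(f,H)` and
`(g,H)` agree and `f(z) = g(z)` (as points of `ℙⁿ(ℂ)`) on `f⁻¹(H)`. -/
def SharesTrunc {n : ℕ} (f g : Fin (n + 1) → ℂ → ℂ) (a : Fin (n + 1) → ℂ) (d : ℕ) : Prop :=
  (∃ z, lform a f z ≠ 0) ∧ (∃ z, lform a g z ≠ 0) ∧
  (∀ z, min (vord (lform a f) z) d = min (vord (lform a g) z) d) ∧
  ∀ z, lform a f z = 0 → ∃ c : ℂ, c ≠ 0 ∧ ∀ i, g i z = c * f i z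

/-- The map `f × g : ℂ → ℙⁿ(ℂ) × ℙⁿ(ℂ)` is algebraically degenerate: a nonzero
polynomial `Q(v, w)`, homogeneous in `v` and in `w` separately, annihilates
`(f₀, …, fₙ, g₀, …, gₙ)`. -/
def AlgDeg {n : ℕ} (f g : Fin (n + 1) → ℂ → ℂ) : Prop :=
  ∃ Q : MvPolynomial (Fin (n + 1) ⊕ Fin (n + 1)) ℂ, Q ≠ 0 ∧
    (∃ d₁ : ℕ, MvPolynomial.IsWeightedHomogeneous (Sum.elim (fun _ => 1) (fun _ => 0)) Q d₁) ∧
    (∃ d₂ : ℕ, MvPolynomial.IsWeightedHomogeneous (Sum.elim (fun _ => 0) (fun _ => 1)) Q d₂) ∧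
    ∀ z : ℂ, MvPolynomial.eval (Sum.elim (fun i => f i z) (fun i => g i z)) Q = 0

/-! ### Factoring zeros of entire functions -/

theorem exists_eq_pow_mul_of_entire {A : ℂ → ℂ} (hA : Differentiable ℂ A) (h0 : A ≠ 0) (z₀ : ℂ) :
    ∃ (m : ℕ) (h : ℂ → ℂ), Differentiable ℂ h ∧ h z₀ ≠ 0 ∧ ∀ z, A z = (z - z₀) ^ m * h z := by
  obtain ⟨p, hp⟩ := (hA.analyticAt z₀)
  have hp0 : p ≠ 0 := by
    rintro rfl
    apply h0
    have h1 : A =ᶠ[𝓝 z₀] 0 := hp.locally_zero_iff.2 rfl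
    exact AnalyticOnNhd.eq_of_eventuallyEq (fun z _ => hA.analyticAt z)
      (fun z _ => analyticAt_const) h1
  refine ⟨p.order, (Function.swap dslope z₀)^[p.order] A, ?_,
    hp.iterate_dslope_fslope_ne_zero hp0, fun z => hp.eq_pow_order_mul_iterate_dslope z⟩
  have key : ∀ n : ℕ, Differentiable ℂ ((Function.swap dslope z₀)^[n] A) := by
    intro n
    induction n with
    | zero => simpa using hA
    | succ n ih =>
      rw [Function.iterate_succ_apply']
      have := (Complex.differentiableOn_dslope (c := z₀) (s := Set.univ) (by simp)).2
        ih.differentiableOn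
      exact differentiableOn_univ.1 this
  exact key _

theorem ne_zero_of_eq_mul {A h k : ℂ → ℂ} (h0 : A ≠ 0) (H : ∀ z, A z = k z * h z) : h ≠ 0 := by
  rintro rfl
  exact h0 (funext fun z => by simp [H z])

theorem finite_zeros_closedBall {A : ℂ → ℂ} (hA : Differentiable ℂ A) (h0 : A ≠ 0) (ρ : ℝ) :
    {z | z ∈ Metric.closedBall (0 : ℂ) ρ ∧ A z = 0}.Finite := by
  by_contra hinf
  obtain ⟨z, -, hz⟩ := Set.Infinite.exists_accPt_of_subset_isCompact (s := {z | z ∈ Metric.closedBall (0 : ℂ) ρ ∧ A z = 0}) hinf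
    (isCompact_closedBall (0 : ℂ) ρ) (fun z hz => hz.1)
  apply h0
  refine AnalyticOnNhd.eq_of_frequently_eq (z₀ := z) (fun z _ => hA.analyticAt z)
    (fun z _ => analyticAt_const) ?_
  rw [accPt_iff_frequently_nhdsNE] at hz
  exact hz.mono fun w hw => hw.2

theorem exists_factor_closedBall {A : ℂ → ℂ} (hA : Differentiable ℂ A) (h0 : A ≠ 0) (ρ : ℝ) :
    ∃ (N : ℕ) (u : Fin N → ℂ) (h : ℂ → ℂ), Differentiable ℂ h ∧
      (∀ z ∈ Metric.closedBall (0 : ℂ) ρ, h z ≠ 0) ∧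
      (∀ i, u i ∈ Metric.closedBall (0 : ℂ) ρ ∧ A (u i) = 0) ∧
      ∀ z, A z = (∏ i, (z - u i)) * h z := by
  obtain ⟨n, hn⟩ : ∃ n, {z | z ∈ Metric.closedBall (0 : ℂ) ρ ∧ A z = 0}.ncard = n := ⟨_, rfl⟩
  induction n using Nat.strong_induction_on generalizing A with
  | _ n ih =>
    by_cases hz : ∃ z₀ ∈ Metric.closedBall (0 : ℂ) ρ, A z₀ = 0
    · obtain ⟨z₀, hz₀, hAz⟩ := hz
      obtain ⟨m, h, hh, hh0, hm⟩ := exists_eq_pow_mul_of_entire hA h0 z₀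
      have hhne := ne_zero_of_eq_mul h0 hm
      have hsub : {z | z ∈ Metric.closedBall (0 : ℂ) ρ ∧ h z = 0} ⊂
          {z | z ∈ Metric.closedBall (0 : ℂ) ρ ∧ A z = 0} := by
        refine ⟨fun z hz => ⟨hz.1, by rw [hm, hz.2, mul_zero]⟩, fun hs => hh0 (hs ⟨hz₀, hAz⟩).2⟩
      obtain ⟨N, u, k, hk, hk0, hu, huk⟩ := ih _ (hn ▸ Set.ncard_lt_ncard hsub
        (finite_zeros_closedBall hA h0 ρ)) hh hhne rfl
      refine ⟨m + N, Fin.append (fun _ => z₀) u, k, hk, hk0, fun i => ?_, fun z => ?_⟩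
      · refine Fin.addCases (fun i => ?_) (fun i => ?_) i
        · simpa using ⟨by simpa using hz₀, hAz⟩
        · have := hu i
          simp only [Fin.append_right]
          exact ⟨this.1, by rw [hm, this.2, mul_zero]⟩
      · rw [Fin.prod_univ_add]
        simp [hm z, huk z, mul_assoc]
    · push Not at hz
      exact ⟨0, Fin.elim0, A, hA, hz, fun i => i.elim0, fun z => by simp⟩

/-! ### Circle averages -/

theorem circleIntegrable_log_norm_of_meromorphic {u : ℂ → ℂ} (hu : Meromorphic u) (R : ℝ) :
    CircleIntegrable (fun z => Real.log ‖u z‖) 0 R :=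
  MeromorphicOn.circleIntegrable_log_norm fun x _ => hu x

theorem circleIntegrable_posLog_norm_of_meromorphic {u : ℂ → ℂ} (hu : Meromorphic u) (R : ℝ) :
    CircleIntegrable (fun z => Real.posLog ‖u z‖) 0 R :=
  MeromorphicOn.circleIntegrable_posLog_norm fun x _ => hu x

theorem Differentiable.meromorphic' {u : ℂ → ℂ} (hu : Differentiable ℂ u) : Meromorphic u :=
  fun x => (hu.analyticAt x).meromorphicAt

/-- A meromorphic function without poles has circle averages of `log ‖u‖` bounded below. -/
theorem le_circleAverage_log_norm {u : ℂ → ℂ} (hu : Meromorphic u)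
    (hpole : ∀ z, 0 ≤ meromorphicOrderAt u z) {R : ℝ} (hR : 1 ≤ R) :
    Real.log ‖meromorphicTrailingCoeffAt u 0‖ ≤ Real.circleAverage (fun z => Real.log ‖u z‖) 0 R := by
  have hR0 : 0 < R := by linarith
  have hmer : MeromorphicOn u (Metric.closedBall 0 |R|) := fun x _ => hu x
  rw [MeromorphicOn.circleAverage_log_norm hR0.ne' hmer]
  have hdiv : ∀ z, 0 ≤ MeromorphicOn.divisor u (Metric.closedBall 0 |R|) z := by
    intro z
    by_cases hz : z ∈ Metric.closedBall (0 : ℂ) |R|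
    · rw [MeromorphicOn.divisor_apply hmer hz]
      have := hpole z
      cases h : meromorphicOrderAt u z with
      | top => simp
      | coe a => rw [h] at this; simpa using this
    · simp [hz]
  have h1 : 0 ≤ ∑ᶠ z, (MeromorphicOn.divisor u (Metric.closedBall 0 |R|) z : ℝ) *
      Real.log (R * ‖(0 : ℂ) - z‖⁻¹) := by
    apply finsum_nonneg
    intro z
    by_cases hz : z ∈ Metric.closedBall (0 : ℂ) |R|
    · apply mul_nonneg (by exact_mod_cast hdiv z)
      by_cases hz0 : z = 0
      · simp [hz0]
      · apply Real.log_nonneg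
        have : ‖z‖ ≤ R := by simpa [abs_of_pos hR0] using hz
        rw [zero_sub, norm_neg, ← div_eq_mul_inv, le_div_iff₀ (by positivity)]
        linarith
    · simp [hz]
  have h2 : 0 ≤ (MeromorphicOn.divisor u (Metric.closedBall 0 |R|) 0 : ℝ) * Real.log R :=
    mul_nonneg (by exact_mod_cast hdiv 0) (Real.log_nonneg hR)
  linarith

theorem log_norm_le_circleAverage {u : ℂ → ℂ} (hu : Differentiable ℂ u) (h0 : u 0 ≠ 0)
    {R : ℝ} (hR : 0 < R) :
    Real.log ‖u 0‖ ≤ Real.circleAverage (fun z => Real.log ‖u z‖) 0 R := by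
  have ha : AnalyticOnNhd ℂ u (Metric.closedBall 0 |R|) := fun x _ => hu.analyticAt x
  rw [AnalyticOnNhd.circleAverage_log_norm hR.ne' ha h0]
  have h1 : 0 ≤ ∑ᶠ z, (MeromorphicOn.divisor u (Metric.closedBall 0 |R|) z : ℝ) *
      Real.log (R * ‖(0 : ℂ) - z‖⁻¹) := by
    apply finsum_nonneg
    intro z
    by_cases hz : z ∈ Metric.closedBall (0 : ℂ) |R|
    · apply mul_nonneg
      · have h3 := MeromorphicOn.AnalyticOnNhd.divisor_nonneg ha z
        exact_mod_cast h3
      by_cases hz0 : z = 0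
      · simp [hz0]
      · apply Real.log_nonneg
        have : ‖z‖ ≤ R := by simpa [abs_of_pos hR] using hz
        rw [zero_sub, norm_neg, ← div_eq_mul_inv, le_div_iff₀ (by positivity)]
        linarith
    · simp [hz]
  linarith

/-! ### Oscillation of a harmonic function in terms of its mean -/

theorem harmonic_sub_le {L : ℂ → ℝ} {R : ℝ} (hL : InnerProductSpace.HarmonicOnNhd L (Metric.closedBall 0 R))
    {ζ w : ℂ} (hζ : ‖ζ‖ < R) (hw : ‖w‖ < R) :
    |L ζ - L w| ≤ 2 * R * ‖ζ - w‖ / ((R - ‖ζ‖) * (R - ‖w‖)) * Real.circleAverage (fun z => |L z|) 0 R := by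
  have hR : 0 < R := lt_of_le_of_lt (norm_nonneg _) hw
  have hLc : ContinuousOn L (Metric.sphere 0 |R|) := by
    intro x hx
    rw [abs_of_pos hR] at hx
    exact (hL x (Metric.sphere_subset_closedBall hx)).1.continuousAt.continuousWithinAt
  have hden : ∀ v : ℂ, ‖v‖ < R → ∀ x ∈ Metric.sphere (0 : ℂ) |R|, x - v ≠ 0 := by
    intro v hv x hx h
    rw [sub_eq_zero] at h
    subst h
    simp [abs_of_pos hR] at hx
    linarith
  have hKc : ∀ v : ℂ, ‖v‖ < R → ContinuousOn (Complex.re ∘ herglotzRieszKernel 0 v)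
      (Metric.sphere 0 |R|) := by
    intro v hv
    rw [herglotzRieszKernel_fun_def]
    apply Complex.continuous_re.comp_continuousOn
    apply ContinuousOn.div (by fun_prop) (by fun_prop)
    intro x hx
    simpa using hden v hv x hx
  have h_circ : ∀ v : ℂ, ‖v‖ < R → CircleIntegrable ((Complex.re ∘ herglotzRieszKernel 0 v) • L) 0 R := by
    intro v hv
    exact ContinuousOn.circleIntegrable' ((hKc v hv).smul hLc)
  rw [← hL.circleAverage_re_herglotzRieszKernel_smul (w := ζ) (by simpa using hζ),
    ← hL.circleAverage_re_herglotzRieszKernel_smul (w := w) (by simpa using hw),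
    ← Real.circleAverage_sub (h_circ ζ hζ) (h_circ w hw)]
  refine (Real.abs_circleAverage_le_circleAverage_abs).trans ?_
  rw [← smul_eq_mul, ← Real.circleAverage_fun_smul]
  apply Real.circleAverage_mono
  · exact ContinuousOn.circleIntegrable' ((((hKc ζ hζ).smul hLc).sub ((hKc w hw).smul hLc)).abs)
  · exact ContinuousOn.circleIntegrable' (by fun_prop)
  · intro x hx
    have hx' := hx
    rw [abs_of_pos hR] at hx
    have hxR : ‖x‖ = R := by simpa using hx
    simp only [Pi.abs_apply, Pi.sub_apply, smul_eq_mul, Pi.mul_apply, Function.comp_apply]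
    rw [← sub_mul, abs_mul]
    apply mul_le_mul_of_nonneg_right _ (abs_nonneg _)
    rw [← Complex.sub_re]
    refine (Complex.abs_re_le_norm _).trans ?_
    have h1 := hden ζ hζ x hx'
    have h2 := hden w hw x hx'
    have : herglotzRieszKernel 0 ζ x - herglotzRieszKernel 0 w x =
        2 * x * (ζ - w) / ((x - ζ) * (x - w)) := by
      simp only [herglotzRieszKernel_def, sub_zero]
      field_simp
      ring
    rw [this, norm_div, norm_mul, norm_mul, norm_mul, hxR]
    have e1 : R - ‖ζ‖ ≤ ‖x - ζ‖ := by rw [← hxR]; exact norm_sub_norm_le _ _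
    have e2 : R - ‖w‖ ≤ ‖x - w‖ := by rw [← hxR]; exact norm_sub_norm_le _ _
    have e3 : 0 < R - ‖ζ‖ := by linarith
    have e4 : 0 < R - ‖w‖ := by linarith
    simp only [Complex.norm_ofNat]
    gcongr

/-! ### Averages of `‖z - u‖ ^ (-1/2)` -/

/-- The function `|sin θ| ^ (-1/2)`. -/
def invSqrtSin (θ : ℝ) : ℝ := |Real.sin θ| ^ (-(1 / 2) : ℝ)

theorem invSqrtSin_periodic : Function.Periodic invSqrtSin Real.pi := by
  intro x
  simp [invSqrtSin, Real.sin_add_pi]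

theorem intervalIntegrable_invSqrtSin (a b : ℝ) : IntervalIntegrable invSqrtSin volume a b := by
  have hmeas : Measurable invSqrtSin := by
    unfold invSqrtSin
    fun_prop
  have h1 : IntervalIntegrable invSqrtSin volume 0 (Real.pi / 2) := by
    have h2 : IntervalIntegrable (fun x : ℝ => (2 / Real.pi) ^ (-(1 / 2) : ℝ) * x ^ (-(1 / 2) : ℝ))
        volume 0 (Real.pi / 2) :=
      (intervalIntegral.intervalIntegrable_rpow' (by norm_num)).const_mul _
    refine h2.mono_fun hmeas.aestronglyMeasurable ?_
    rw [Filter.EventuallyLE, ae_restrict_iff' measurableSet_uIoc]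
    refine Eventually.of_forall fun x hx => ?_
    rw [Set.uIoc_of_le (by positivity)] at hx
    have hs := Real.mul_le_sin hx.1.le hx.2
    have h3 : 0 < 2 / Real.pi * x := mul_pos (by positivity) hx.1
    rw [← Real.mul_rpow (by positivity) hx.1.le]
    unfold invSqrtSin
    rw [Real.norm_of_nonneg (by positivity), Real.norm_of_nonneg (by positivity),
      abs_of_pos (by linarith)]
    exact Real.rpow_le_rpow_of_nonpos h3 hs (by norm_num)
  have h2 : IntervalIntegrable invSqrtSin volume (Real.pi / 2) Real.pi := by
    have := h1.comp_sub_left Real.pi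
    have h3 : (fun x => invSqrtSin (Real.pi - x)) = invSqrtSin := by
      funext x
      simp [invSqrtSin]
    rw [h3] at this
    convert this.symm using 1 <;> ring
  exact invSqrtSin_periodic.intervalIntegrable₀ Real.pi_pos.ne' (h1.trans h2) a b

/-- The integral of `|sin θ| ^ (-1/2)` over a full period. -/
def invSqrtSinMean : ℝ := (2 * Real.pi)⁻¹ * ∫ θ in (0 : ℝ)..2 * Real.pi, invSqrtSin θ

theorem invSqrtSinMean_nonneg : 0 ≤ invSqrtSinMean := by
  apply mul_nonneg (by positivity)
  apply intervalIntegral.integral_nonneg (by positivity)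
  intro x _
  unfold invSqrtSin
  positivity

theorem sin_le_norm_circleMap_sub (r : ℝ) (u : ℂ) (θ : ℝ) :
    |r| * |Real.sin (θ - u.arg)| ≤ ‖circleMap 0 r θ - u‖ := by
  have h1 : u = ‖u‖ * Complex.exp (u.arg * Complex.I) := (Complex.norm_mul_exp_arg_mul_I u).symm
  have h2 : circleMap 0 r θ - u =
      (r * Complex.exp ((θ - u.arg : ℝ) * Complex.I) - ‖u‖) * Complex.exp (u.arg * Complex.I) := by
    conv_lhs => rw [h1]
    rw [sub_mul, mul_assoc, ← Complex.exp_add]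
    simp only [circleMap_zero]
    congr 3
    push_cast
    ring
  rw [h2, norm_mul, Complex.norm_exp_ofReal_mul_I, mul_one]
  refine le_trans (le_of_eq ?_) (Complex.abs_im_le_norm _)
  rw [← abs_mul, Complex.sub_im, Complex.im_ofReal_mul, Complex.exp_ofReal_mul_I_im,
    Complex.ofReal_im, sub_zero]

theorem rpow_norm_circleMap_sub_le {r : ℝ} (hr : 1 ≤ r) (u : ℂ) {θ : ℝ}
    (hθ : Real.sin (θ - u.arg) ≠ 0) :
    ‖circleMap 0 r θ - u‖ ^ (-(1 / 2) : ℝ) ≤ invSqrtSin (θ - u.arg) := by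
  have h := sin_le_norm_circleMap_sub r u θ
  have h1 : |Real.sin (θ - u.arg)| ≤ ‖circleMap 0 r θ - u‖ := by
    refine le_trans ?_ h
    rw [abs_of_pos (by linarith : 0 < r)]
    exact le_mul_of_one_le_left (abs_nonneg _) hr
  exact Real.rpow_le_rpow_of_nonpos (abs_pos.2 hθ) h1 (by norm_num)

theorem ae_sin_ne_zero (a : ℝ) : ∀ᵐ θ : ℝ, Real.sin (θ - a) ≠ 0 := by
  have : {θ : ℝ | Real.sin (θ - a) = 0}.Countable := by
    have h : {θ : ℝ | Real.sin (θ - a) = 0} ⊆ Set.range fun n : ℤ => n * Real.pi + a := by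
      intro θ hθ
      obtain ⟨n, hn⟩ := Real.sin_eq_zero_iff.1 hθ
      exact ⟨n, by simp [hn]⟩
    exact (Set.countable_range _).mono h
  have h2 := this.ae_notMem volume
  filter_upwards [h2] with θ hθ using hθ

theorem circleIntegrable_rpow_norm_sub {r : ℝ} (hr : 1 ≤ r) (u : ℂ) :
    CircleIntegrable (fun z => ‖z - u‖ ^ (-(1 / 2) : ℝ)) 0 r := by
  have h1 : IntervalIntegrable (fun θ => invSqrtSin (θ - u.arg)) volume 0 (2 * Real.pi) := by
    have := (intervalIntegrable_invSqrtSin (0 - u.arg) (2 * Real.pi - u.arg)).comp_sub_right u.arg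
    simpa using this
  refine h1.mono_fun ?_ ?_
  · apply Measurable.aestronglyMeasurable
    fun_prop
  · filter_upwards [ae_restrict_of_ae (ae_sin_ne_zero u.arg)] with θ hθ
    rw [Real.norm_of_nonneg (by positivity), Real.norm_of_nonneg (by unfold invSqrtSin; positivity)]
    exact rpow_norm_circleMap_sub_le hr u hθ

theorem circleAverage_rpow_norm_sub_le {r : ℝ} (hr : 1 ≤ r) (u : ℂ) :
    Real.circleAverage (fun z => ‖z - u‖ ^ (-(1 / 2) : ℝ)) 0 r ≤ invSqrtSinMean := by
  unfold Real.circleAverage invSqrtSinMean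
  rw [smul_eq_mul]
  apply mul_le_mul_of_nonneg_left _ (by positivity)
  have h1 : IntervalIntegrable (fun θ => invSqrtSin (θ - u.arg)) volume 0 (2 * Real.pi) := by
    have := (intervalIntegrable_invSqrtSin (0 - u.arg) (2 * Real.pi - u.arg)).comp_sub_right u.arg
    simpa using this
  have h2 : ∫ θ in (0 : ℝ)..2 * Real.pi, invSqrtSin (θ - u.arg) =
      ∫ θ in (0 : ℝ)..2 * Real.pi, invSqrtSin θ := by
    rw [intervalIntegral.integral_comp_sub_right]
    have hp : Function.Periodic invSqrtSin (2 * Real.pi) := by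
      simpa using invSqrtSin_periodic.nat_mul 2
    have := hp.intervalIntegral_add_eq (0 - u.arg) 0
    rw [zero_add] at this
    rw [← this]
    congr 1
    ring
  rw [← h2]
  apply intervalIntegral.integral_mono_ae (by positivity) (circleIntegrable_rpow_norm_sub hr u) h1
  filter_upwards [ae_sin_ne_zero u.arg] with θ hθ
  exact rpow_norm_circleMap_sub_le hr u hθ

theorem circleAverage_mono_codiscreteWithin {f g : ℂ → ℝ} {R : ℝ} (hR : R ≠ 0)
    (hf : CircleIntegrable f 0 R) (hg : CircleIntegrable g 0 R)
    (h : ∀ᶠ z in codiscreteWithin (Metric.sphere (0 : ℂ) |R|), f z ≤ g z) :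
    Real.circleAverage f 0 R ≤ Real.circleAverage g 0 R := by
  have h1 : f =ᶠ[codiscreteWithin (Metric.sphere (0 : ℂ) |R|)] fun z => min (f z) (g z) := by
    filter_upwards [h] with z hz
    rw [min_eq_left hz]
  rw [Real.circleAverage_congr_codiscreteWithin h1 hR]
  exact Real.circleAverage_mono (hf.congr_codiscreteWithin h1) hg fun x _ => min_le_right _ _

theorem circleAverage_mono_codiscrete {f g : ℂ → ℝ} {R : ℝ} (hR : R ≠ 0)
    (hf : CircleIntegrable f 0 R) (hg : CircleIntegrable g 0 R)
    (h : ∀ᶠ z in codiscrete ℂ, f z ≤ g z) :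
    Real.circleAverage f 0 R ≤ Real.circleAverage g 0 R :=
  circleAverage_mono_codiscreteWithin hR hf hg
    (codiscreteWithin_mono (Set.subset_univ _) h)

theorem one_add_sum_le_sq {ι : Type*} (s : Finset ι) {S : ℝ} (hS : 0 ≤ S) (x : ι → ℝ)
    (hx : ∀ i, 0 ≤ x i) :
    1 + S + ∑ i ∈ s, x i ≤ (1 + S + ∑ i ∈ s, Real.sqrt (x i)) ^ 2 := by
  classical
  induction s using Finset.induction_on with
  | empty => simp; nlinarith
  | insert a s ha ih =>
    rw [Finset.sum_insert ha, Finset.sum_insert ha]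
    have h1 : 0 ≤ ∑ i ∈ s, Real.sqrt (x i) := Finset.sum_nonneg fun i _ => Real.sqrt_nonneg _
    have h2 := Real.sq_sqrt (hx a)
    have h3 := Real.sqrt_nonneg (x a)
    nlinarith [mul_nonneg h3 h1, mul_nonneg h3 hS]

theorem circleAverage_le_of_le_log {r : ℝ} (hr : 1 ≤ r) {N : ℕ} (w : Fin N → ℂ) {S : ℝ}
    (hS : 0 ≤ S) {a b : ℝ} (hb : 0 ≤ b) {φ : ℂ → ℝ} (hφ : CircleIntegrable φ 0 r)
    (h : ∀ᶠ z in codiscreteWithin (Metric.sphere (0 : ℂ) |r|),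
      φ z ≤ a + b * Real.log (1 + S + ∑ i, ‖z - w i‖⁻¹)) :
    Real.circleAverage φ 0 r ≤ a + 2 * b * Real.log (1 + S + N * invSqrtSinMean) := by
  have hI := invSqrtSinMean_nonneg
  set Y : ℝ := 1 + S + N * invSqrtSinMean with hY
  have hYpos : 0 < Y := by positivity
  let p : ℂ → ℝ := fun z => ∑ i, ‖z - w i‖ ^ (-(1 / 2) : ℝ)
  have hp : CircleIntegrable p 0 r :=
    CircleIntegrable.fun_sum Finset.univ fun i _ => circleIntegrable_rpow_norm_sub hr (w i)
  have hpa : Real.circleAverage p 0 r ≤ N * invSqrtSinMean := by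
    show Real.circleAverage (fun z => ∑ i, ‖z - w i‖ ^ (-(1 / 2) : ℝ)) 0 r ≤ _
    rw [Real.circleAverage_fun_sum fun i _ => circleIntegrable_rpow_norm_sub hr (w i)]
    calc _ ≤ ∑ _i : Fin N, invSqrtSinMean :=
          Finset.sum_le_sum fun i _ => circleAverage_rpow_norm_sub_le hr (w i)
      _ = _ := by simp
  let G : ℂ → ℝ := fun z => (a + 2 * b * (Real.log Y + (1 + S) / Y - 1)) + (2 * b / Y) * p z
  have hcp : CircleIntegrable (fun z => (2 * b / Y) * p z) 0 r := IntervalIntegrable.const_mul hp _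
  have hG : CircleIntegrable G 0 r := (circleIntegrable_const _ _ _).add hcp
  have hGa : Real.circleAverage G 0 r ≤ a + 2 * b * Real.log Y := by
    have e1 : Real.circleAverage G 0 r =
        (a + 2 * b * (Real.log Y + (1 + S) / Y - 1)) + (2 * b / Y) * Real.circleAverage p 0 r := by
      show Real.circleAverage ((fun _ => _) + (fun z => (2 * b / Y) * p z)) 0 r = _
      rw [Real.circleAverage_add (circleIntegrable_const _ _ _) hcp, Real.circleAverage_const]
      congr 1
      exact Real.circleAverage_fun_smul (a := 2 * b / Y) (f := p)
    rw [e1]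
    have e2 : (2 * b / Y) * Real.circleAverage p 0 r ≤ (2 * b / Y) * (N * invSqrtSinMean) := by
      gcongr
    have e3 : 2 * b * ((1 + S) / Y) + (2 * b / Y) * (N * invSqrtSinMean) = 2 * b := by
      field_simp
      rw [hY]
    nlinarith
  refine le_trans (circleAverage_mono_codiscreteWithin (by linarith) hφ hG ?_) hGa
  filter_upwards [h] with z hz
  refine hz.trans ?_
  have h1 := one_add_sum_le_sq Finset.univ hS (fun i => ‖z - w i‖⁻¹) fun i => by positivity
  have h2 : ∀ i, Real.sqrt (‖z - w i‖⁻¹) = ‖z - w i‖ ^ (-(1 / 2) : ℝ) := fun i => by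
    rw [Real.sqrt_eq_rpow, ← Real.rpow_neg_one, ← Real.rpow_mul (norm_nonneg _)]
    norm_num
  simp only [h2] at h1
  have hs : 0 ≤ ∑ i, ‖z - w i‖⁻¹ := Finset.sum_nonneg fun i _ => by positivity
  have hp0 : 0 ≤ p z := Finset.sum_nonneg fun i _ => by positivity
  have h3 : Real.log (1 + S + ∑ i, ‖z - w i‖⁻¹) ≤ 2 * Real.log (1 + S + p z) := by
    have := Real.log_le_log (by positivity) h1
    rwa [Real.log_pow] at this
  have h4 : Real.log (1 + S + p z) ≤ Real.log Y + ((1 + S + p z) / Y - 1) := by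
    have := Real.log_le_sub_one_of_pos (x := (1 + S + p z) / Y) (by positivity)
    rw [Real.log_div (by positivity) (by positivity)] at this
    linarith
  have h5 : a + b * Real.log (1 + S + ∑ i, ‖z - w i‖⁻¹) ≤
      a + b * (2 * (Real.log Y + ((1 + S + p z) / Y - 1))) := by
    gcongr
    linarith
  refine h5.trans (le_of_eq ?_)
  simp only [G]
  field_simp
  ring

/-! ### A pointwise estimate for logarithmic derivatives -/

theorem norm_sub_le_mul_exp {z u ζ : ℂ} {ρ : ℝ} (hz : z ≠ u) (hρ : ‖ζ - z‖ ≤ ρ) :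
    ‖ζ - u‖ ≤ ‖z - u‖ * Real.exp (ρ * ‖z - u‖⁻¹) := by
  have h0 : 0 < ‖z - u‖ := norm_pos_iff.2 (sub_ne_zero.2 hz)
  have h1 : ‖ζ - u‖ ≤ ρ + ‖z - u‖ := by
    have : ζ - u = (ζ - z) + (z - u) := by ring
    rw [this]
    exact (norm_add_le _ _).trans (by linarith)
  have h2 := Real.add_one_le_exp (ρ * ‖z - u‖⁻¹)
  calc ‖ζ - u‖ ≤ ‖z - u‖ * (ρ * ‖z - u‖⁻¹ + 1) := by
        rw [mul_add, mul_one, mul_left_comm, mul_inv_cancel₀ h0.ne']; linarith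
    _ ≤ _ := by gcongr

theorem norm_sub_inv_le_mul_exp {z u ζ : ℂ} {ρ : ℝ} (hz : z ≠ u) (hρ : ‖ζ - z‖ ≤ ρ)
    (hρ' : ρ * ‖z - u‖⁻¹ ≤ 1 / 2) :
    ζ ≠ u ∧ ‖ζ - u‖⁻¹ ≤ ‖z - u‖⁻¹ * Real.exp (2 * ρ * ‖z - u‖⁻¹) := by
  have h0 : 0 < ‖z - u‖ := norm_pos_iff.2 (sub_ne_zero.2 hz)
  set x := ρ * ‖z - u‖⁻¹ with hx
  have hx0 : 0 ≤ x := mul_nonneg ((norm_nonneg _).trans hρ) (by positivity)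
  have hρx : ρ = ‖z - u‖ * x := by rw [hx]; field_simp
  have h1 : ‖z - u‖ * (1 - x) ≤ ‖ζ - u‖ := by
    have : z - u = (ζ - u) - (ζ - z) := by ring
    have h := norm_sub_le (ζ - u) (ζ - z)
    rw [← this] at h
    nlinarith
  have h2 : 0 < ‖z - u‖ * (1 - x) := mul_pos h0 (by linarith)
  have h3 : (1 - x)⁻¹ ≤ Real.exp (2 * x) := by
    have e1 : 1 ≤ (1 - x) * (1 + 2 * x) := by nlinarith
    have e2 := Real.add_one_le_exp (2 * x)
    rw [inv_le_iff_one_le_mul₀' (by linarith)]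
    nlinarith
  refine ⟨fun h => ?_, ?_⟩
  · rw [h, sub_self, norm_zero] at h1; linarith
  · calc ‖ζ - u‖⁻¹ ≤ (‖z - u‖ * (1 - x))⁻¹ := by gcongr
      _ = ‖z - u‖⁻¹ * (1 - x)⁻¹ := by rw [mul_inv]
      _ ≤ _ := by rw [mul_assoc 2 ρ, ← hx]; gcongr

theorem harmonicOnNhd_log_norm_sub {h k : ℂ → ℂ} {R : ℝ} (hh : Differentiable ℂ h)
    (hk : Differentiable ℂ k) (h0 : ∀ z ∈ Metric.closedBall (0 : ℂ) R, h z ≠ 0)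
    (k0 : ∀ z ∈ Metric.closedBall (0 : ℂ) R, k z ≠ 0) :
    InnerProductSpace.HarmonicOnNhd (fun z => Real.log ‖h z‖ - Real.log ‖k z‖)
      (Metric.closedBall 0 R) := by
  intro z hz
  exact ((hh.analyticAt z).harmonicAt_log_norm (h0 z hz)).sub
    ((hk.analyticAt z).harmonicAt_log_norm (k0 z hz))

theorem norm_iteratedDeriv_div_le {N M : ℕ} {u : Fin N → ℂ} {v : Fin M → ℂ} {h k : ℂ → ℂ}
    {r R K : ℝ} (hh : Differentiable ℂ h)
    (hk : Differentiable ℂ k) (h0 : ∀ z ∈ Metric.closedBall (0 : ℂ) R, h z ≠ 0)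
    (k0 : ∀ z ∈ Metric.closedBall (0 : ℂ) R, k z ≠ 0) (hr : 0 < r) (hrR : r < R)
    (hK : Real.circleAverage (fun z => |Real.log ‖h z‖ - Real.log ‖k z‖|) 0 R ≤ K)
    {z : ℂ} (hz : ‖z‖ = r) (hu : ∀ i, z ≠ u i) (hv : ∀ i, z ≠ v i) (j : ℕ) :
    ‖iteratedDeriv j (fun z => ((∏ i, (z - u i)) * h z) / ((∏ i, (z - v i)) * k z)) z‖ ≤
      j.factorial * Real.exp 1 * (2 * (4 * R * K / (R - r) ^ 2 + 2 / (R - r) +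
        (∑ i, ‖z - u i‖⁻¹ + ∑ i, ‖z - v i‖⁻¹))) ^ j *
        ‖((∏ i, (z - u i)) * h z) / ((∏ i, (z - v i)) * k z)‖ := by
  set F : ℂ → ℂ := fun z => ((∏ i, (z - u i)) * h z) / ((∏ i, (z - v i)) * k z) with hF
  set L : ℂ → ℝ := fun z => Real.log ‖h z‖ - Real.log ‖k z‖ with hL
  have hharm : InnerProductSpace.HarmonicOnNhd L (Metric.closedBall 0 R) :=
    harmonicOnNhd_log_norm_sub hh hk h0 k0
  have hR : 0 < R := hr.trans hrR
  have hRr : 0 < R - r := by linarith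
  have hK0 : 0 ≤ K := le_trans (Real.circleAverage_nonneg_of_nonneg fun x _ => abs_nonneg _) hK
  set U : ℝ := ∑ i, ‖z - u i‖⁻¹ with hU
  set V : ℝ := ∑ i, ‖z - v i‖⁻¹ with hV
  have hU0 : 0 ≤ U := Finset.sum_nonneg fun i _ => by positivity
  have hV0 : 0 ≤ V := Finset.sum_nonneg fun i _ => by positivity
  set Mh : ℝ := 4 * R * K / (R - r) ^ 2 with hMh
  have hM0 : 0 ≤ Mh := by positivity
  set Q : ℝ := Mh + 2 / (R - r) + (U + V) with hQ
  have hd0 : 0 < 2 / (R - r) := by positivity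
  have hQ0 : 0 < Q := by positivity
  set ρ : ℝ := (2 * Q)⁻¹ with hρ
  have hρ0 : 0 < ρ := by positivity
  have hρQ : ρ * Q = 1 / 2 := by rw [hρ]; field_simp
  have hρR : ρ ≤ (R - r) / 2 := by
    have h1 : 2 / (R - r) ≤ Q := by linarith
    rw [hρ, inv_le_comm₀ (by positivity) (by positivity)]
    rw [inv_div]
    linarith
  have key : ∀ ζ, ‖ζ - z‖ ≤ ρ → DifferentiableAt ℂ F ζ ∧ ‖F ζ‖ ≤ Real.exp 1 * ‖F z‖ := by
    intro ζ hζ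
    have hζr : ‖ζ‖ ≤ r + (R - r) / 2 := by
      have : ζ = z + (ζ - z) := by ring
      rw [this]
      exact (norm_add_le _ _).trans (by linarith)
    have hζR : ‖ζ‖ < R := by linarith
    have hzR : ‖z‖ < R := by linarith
    have hζm : ζ ∈ Metric.closedBall (0 : ℂ) R := by simpa using hζR.le
    have hzm : z ∈ Metric.closedBall (0 : ℂ) R := by simpa using hzR.le
    have hvi : ∀ i, ρ * ‖z - v i‖⁻¹ ≤ 1 / 2 := by
      intro i
      have h1 : ‖z - v i‖⁻¹ ≤ V :=
        Finset.single_le_sum (f := fun i => ‖z - v i‖⁻¹) (fun i _ => by positivity)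
          (Finset.mem_univ i)
      have h2 : ‖z - v i‖⁻¹ ≤ Q := by linarith
      nlinarith
    have hA := fun i => norm_sub_le_mul_exp (hu i) hζ
    have hB := fun i => norm_sub_inv_le_mul_exp (hv i) hζ (hvi i)
    have hLd : L ζ - L z ≤ ρ * Mh := by
      have h1 := harmonic_sub_le hharm hζR hzR
      have h2 : 2 * R * ‖ζ - z‖ / ((R - ‖ζ‖) * (R - ‖z‖)) *
          Real.circleAverage (fun z => |L z|) 0 R ≤
          2 * R * ρ / (((R - r) / 2) * (R - r)) * K := by
        have e1 : (R - r) / 2 ≤ R - ‖ζ‖ := by linarith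
        have e2 : R - r ≤ R - ‖z‖ := by linarith
        have e3 : 0 ≤ Real.circleAverage (fun z => |L z|) 0 R :=
          Real.circleAverage_nonneg_of_nonneg fun x _ => abs_nonneg _
        gcongr
      have h3 : 2 * R * ρ / (((R - r) / 2) * (R - r)) * K = ρ * Mh := by
        rw [hMh]; field_simp; ring
      exact (le_abs_self _).trans (h1.trans (h2.trans h3.le))
    have hprodv : ∏ i, (ζ - v i) ≠ 0 :=
      Finset.prod_ne_zero_iff.2 fun i _ => sub_ne_zero.2 (hB i).1
    refine ⟨?_, ?_⟩
    · have d1 : DifferentiableAt ℂ (fun z => (∏ i, (z - u i)) * h z) ζ :=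
        DifferentiableAt.mul (by fun_prop) (hh ζ)
      have d2 : DifferentiableAt ℂ (fun z => (∏ i, (z - v i)) * k z) ζ :=
        DifferentiableAt.mul (by fun_prop) (hk ζ)
      exact d1.div d2 (mul_ne_zero hprodv (k0 ζ hζm))
    · have hnorm : ∀ x ∈ Metric.closedBall (0 : ℂ) R, ‖F x‖ =
          (∏ i, ‖x - u i‖) * (∏ i, ‖x - v i‖⁻¹) * Real.exp (L x) := by
        intro x hx
        simp only [hF, hL]
        rw [Real.exp_sub, Real.exp_log (norm_pos_iff.2 (h0 x hx)),
          Real.exp_log (norm_pos_iff.2 (k0 x hx))]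
        simp only [norm_div, norm_mul, norm_prod, Finset.prod_inv_distrib]
        rw [div_eq_mul_inv, mul_inv]
        ring
      rw [hnorm ζ hζm, hnorm z hzm]
      have p1 : ∏ i, ‖ζ - u i‖ ≤ (∏ i, ‖z - u i‖) * Real.exp (ρ * U) := by
        rw [hU, Finset.mul_sum, Real.exp_sum, ← Finset.prod_mul_distrib]
        exact Finset.prod_le_prod (fun i _ => norm_nonneg _) fun i _ => hA i
      have p2 : ∏ i, ‖ζ - v i‖⁻¹ ≤ (∏ i, ‖z - v i‖⁻¹) * Real.exp (2 * ρ * V) := by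
        rw [hV, Finset.mul_sum, Real.exp_sum, ← Finset.prod_mul_distrib]
        exact Finset.prod_le_prod (fun i _ => by positivity) fun i _ => (hB i).2
      have p3 : Real.exp (L ζ) ≤ Real.exp (L z) * Real.exp (ρ * Mh) := by
        rw [← Real.exp_add]
        exact Real.exp_le_exp.2 (by linarith)
      have q1 : 0 ≤ ∏ i, ‖z - u i‖ := Finset.prod_nonneg fun i _ => norm_nonneg _
      have q2 : 0 ≤ ∏ i, ‖z - v i‖⁻¹ := Finset.prod_nonneg fun i _ => by positivity
      have q3 : 0 ≤ ∏ i, ‖ζ - v i‖⁻¹ := Finset.prod_nonneg fun i _ => by positivity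
      calc (∏ i, ‖ζ - u i‖) * (∏ i, ‖ζ - v i‖⁻¹) * Real.exp (L ζ)
          ≤ ((∏ i, ‖z - u i‖) * Real.exp (ρ * U)) * ((∏ i, ‖z - v i‖⁻¹) * Real.exp (2 * ρ * V)) *
            (Real.exp (L z) * Real.exp (ρ * Mh)) := by gcongr
        _ = Real.exp (ρ * U + 2 * ρ * V + ρ * Mh) *
            ((∏ i, ‖z - u i‖) * (∏ i, ‖z - v i‖⁻¹) * Real.exp (L z)) := by
          rw [Real.exp_add, Real.exp_add]; ring
        _ ≤ _ := by
          gcongr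
          have : ρ * U + 2 * ρ * V + ρ * Mh ≤ 2 * (ρ * Q) := by
            rw [hQ]
            nlinarith [mul_nonneg hρ0.le hU0, mul_nonneg hρ0.le hM0, mul_nonneg hρ0.le hd0.le]
          linarith
  have hdc : DiffContOnCl ℂ F (Metric.ball z ρ) := by
    apply DifferentiableOn.diffContOnCl
    rw [closure_ball z hρ0.ne']
    intro ζ hζ
    exact (key ζ (by simpa [dist_eq_norm] using hζ)).1.differentiableWithinAt
  have := Complex.norm_iteratedDeriv_le_of_forall_mem_sphere_norm_le j hρ0 hdc
    (C := Real.exp 1 * ‖F z‖) fun ζ hζ => (key ζ (by simpa [dist_eq_norm] using hζ.le)).2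
  refine this.trans (le_of_eq ?_)
  show _ = j.factorial * Real.exp 1 * (2 * Q) ^ j * ‖F z‖
  rw [hρ, inv_pow, div_inv_eq_mul]
  ring

theorem eventually_ne_zero_codiscrete {A : ℂ → ℂ} (hA : Differentiable ℂ A) (h0 : A ≠ 0) :
    ∀ᶠ z in codiscrete ℂ, A z ≠ 0 := by
  obtain ⟨x, hx⟩ := Function.ne_iff.1 h0
  exact AnalyticOnNhd.preimage_zero_mem_codiscrete (fun z _ => hA.analyticAt z) hx

theorem log_norm_prod_mul {N : ℕ} {u : Fin N → ℂ} {h : ℂ → ℂ} {z : ℂ}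
    (hz : (∏ i, (z - u i)) * h z ≠ 0) :
    Real.log ‖(∏ i, (z - u i)) * h z‖ = ∑ i, Real.log ‖z - u i‖ + Real.log ‖h z‖ := by
  have h1 := left_ne_zero_of_mul hz
  have h2 := right_ne_zero_of_mul hz
  rw [norm_mul, Real.log_mul (norm_ne_zero_iff.2 h1) (norm_ne_zero_iff.2 h2), norm_prod,
    Real.log_prod]
  intro i hi
  exact norm_ne_zero_iff.2 (Finset.prod_ne_zero_iff.1 h1 i hi)

theorem circleIntegrable_log_norm_sub (u : ℂ) (R : ℝ) :
    CircleIntegrable (fun z => Real.log ‖z - u‖) 0 R :=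
  circleIntegrable_log_norm_sub_const R

theorem circleAverage_sum_log_norm_sub {N : ℕ} {u : Fin N → ℂ} {R : ℝ}
    (hR : 0 ≤ R) (hu : ∀ i, u i ∈ Metric.closedBall (0 : ℂ) R) :
    Real.circleAverage (fun z => ∑ i, Real.log ‖z - u i‖) 0 R = N * Real.log R := by
  rw [Real.circleAverage_fun_sum fun i _ => circleIntegrable_log_norm_sub (u i) R]
  have : ∀ i, Real.circleAverage (fun z => Real.log ‖z - u i‖) 0 R = Real.log R := fun i =>
    circleAverage_log_norm_sub_const_of_mem_closedBall (by rw [abs_of_nonneg hR]; exact hu i)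
  simp [this]

theorem card_mul_log_le {A h : ℂ → ℂ} {N : ℕ} {u : Fin N → ℂ} {R₁ R₂ : ℝ}
    (hA : Differentiable ℂ A) (hh : Differentiable ℂ h)
    (hA0 : A 0 ≠ 0) (hR₁ : 0 < R₁) (hR : R₁ ≤ R₂)
    (hu : ∀ i, u i ∈ Metric.closedBall (0 : ℂ) R₁)
    (hAh : ∀ z, A z = (∏ i, (z - u i)) * h z) :
    N * Real.log (R₂ / R₁) + Real.log ‖A 0‖ ≤
      Real.circleAverage (fun z => Real.log ‖A z‖) 0 R₂ := by
  have hR₂ : 0 < R₂ := by linarith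
  have hA' : A ≠ 0 := fun h => hA0 (by rw [h]; rfl)
  have hh0 : h 0 ≠ 0 := right_ne_zero_of_mul (hAh 0 ▸ hA0)
  have e1 : (fun z => Real.log ‖A z‖) =ᶠ[codiscreteWithin (Metric.sphere (0 : ℂ) |R₂|)]
      (fun z => ∑ i, Real.log ‖z - u i‖) + fun z => Real.log ‖h z‖ := by
    filter_upwards [codiscreteWithin_mono (Set.subset_univ _)
      (eventually_ne_zero_codiscrete hA hA')] with z hz
    have hz' : A z ≠ 0 := hz
    rw [hAh] at hz'
    rw [hAh, log_norm_prod_mul hz']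
    rfl
  rw [Real.circleAverage_congr_codiscreteWithin e1 hR₂.ne', Real.circleAverage_add
    (CircleIntegrable.fun_sum _ fun i _ => circleIntegrable_log_norm_sub (u i) R₂)
    (circleIntegrable_log_norm_of_meromorphic hh.meromorphic' R₂),
    circleAverage_sum_log_norm_sub hR₂.le fun i => Metric.closedBall_subset_closedBall hR (hu i)]
  have e2 := log_norm_le_circleAverage hh hh0 hR₂
  have e3 : Real.log ‖A 0‖ ≤ N * Real.log R₁ + Real.log ‖h 0‖ := by
    have hA0' := hA0
    rw [hAh] at hA0'
    rw [hAh, log_norm_prod_mul hA0']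
    have : ∑ i, Real.log ‖0 - u i‖ ≤ ∑ _i : Fin N, Real.log R₁ := by
      apply Finset.sum_le_sum
      intro i _
      have h1 := Finset.prod_ne_zero_iff.1 (left_ne_zero_of_mul hA0') i (Finset.mem_univ i)
      apply Real.log_le_log (norm_pos_iff.2 h1)
      simpa using hu i
    simp only [Finset.sum_const, Finset.card_univ, Fintype.card_fin, nsmul_eq_mul] at this
    linarith
  rw [Real.log_div hR₂.ne' hR₁.ne']
  linarith

theorem abs_log_norm_sub_le {z u : ℂ} {R : ℝ} (hR : 1 ≤ R) (hz : ‖z‖ ≤ R) (hu : ‖u‖ ≤ R) :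
    |Real.log ‖z - u‖| ≤ 2 * Real.log (2 * R) - Real.log ‖z - u‖ := by
  have h1 : 0 ≤ Real.log (2 * R) := Real.log_nonneg (by linarith)
  have h2 : Real.log ‖z - u‖ ≤ Real.log (2 * R) := by
    by_cases h : z = u
    · simp [h, h1]
    · apply Real.log_le_log (norm_pos_iff.2 (sub_ne_zero.2 h))
      exact (norm_sub_le _ _).trans (by linarith)
  rw [abs_le]
  constructor <;> linarith

theorem circleAverage_abs_log_sub_le {A B h k : ℂ → ℂ} {N M : ℕ} {u : Fin N → ℂ} {v : Fin M → ℂ}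
    {R a d : ℝ} {Φ : ℂ → ℝ} (hΦ : Continuous Φ)
    (hA : Differentiable ℂ A) (hB : Differentiable ℂ B)
    (hh : Differentiable ℂ h) (hk : Differentiable ℂ k) (hA0 : A ≠ 0) (hB0 : B ≠ 0) (hR : 1 ≤ R)
    (hu : ∀ i, u i ∈ Metric.closedBall (0 : ℂ) R)
    (hv : ∀ i, v i ∈ Metric.closedBall (0 : ℂ) R)
    (hAh : ∀ z, A z = (∏ i, (z - u i)) * h z) (hBk : ∀ z, B z = (∏ i, (z - v i)) * k z)
    (hAΦ : ∀ z, ‖A z‖ ≤ Real.exp (a + d * Φ z)) (hBΦ : ∀ z, ‖B z‖ ≤ Real.exp (a + d * Φ z)) :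
    Real.circleAverage (fun z => |Real.log ‖h z‖ - Real.log ‖k z‖|) 0 R ≤
      2 * a + 2 * d * Real.circleAverage Φ 0 R - Real.log ‖meromorphicTrailingCoeffAt A 0‖
        - Real.log ‖meromorphicTrailingCoeffAt B 0‖ + (N + M) * (2 * Real.log (2 * R)) := by
  have hR0 : 0 < R := by linarith
  have iA := circleIntegrable_log_norm_of_meromorphic hA.meromorphic' R
  have iB := circleIntegrable_log_norm_of_meromorphic hB.meromorphic' R
  have ih := circleIntegrable_log_norm_of_meromorphic hh.meromorphic' R
  have ik := circleIntegrable_log_norm_of_meromorphic hk.meromorphic' R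
  have iΦ : CircleIntegrable Φ 0 R := hΦ.continuousOn.circleIntegrable'
  have iu : CircleIntegrable (fun z => ∑ i, Real.log ‖z - u i‖) 0 R :=
    CircleIntegrable.fun_sum _ fun i _ => circleIntegrable_log_norm_sub (u i) R
  have iv : CircleIntegrable (fun z => ∑ i, Real.log ‖z - v i‖) 0 R :=
    CircleIntegrable.fun_sum _ fun i _ => circleIntegrable_log_norm_sub (v i) R
  have i1 : CircleIntegrable ((2 * d) • Φ) 0 R := IntervalIntegrable.const_mul iΦ (2 * d)
  have ic := circleIntegrable_const (2 * a + (N + M) * (2 * Real.log (2 * R))) (0 : ℂ) R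
  have i2 := ic.add i1
  have i3 := i2.sub iA
  have i4 := i3.sub iB
  have i5 := i4.sub iu
  have i6 := i5.sub iv
  have habs : CircleIntegrable (fun z => |Real.log ‖h z‖ - Real.log ‖k z‖|) 0 R :=
    CircleIntegrable.abs (ih.sub ik)
  refine (circleAverage_mono_codiscreteWithin hR0.ne' habs i6 ?_).trans ?_
  · filter_upwards [codiscreteWithin_mono (Set.subset_univ _)
      (eventually_ne_zero_codiscrete hA hA0), codiscreteWithin_mono (Set.subset_univ _)
      (eventually_ne_zero_codiscrete hB hB0), self_mem_codiscreteWithin _] with z hzA hzB hz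
    replace hzA : A z ≠ 0 := hzA
    replace hzB : B z ≠ 0 := hzB
    have hzR : ‖z‖ = R := by simpa [abs_of_pos hR0] using hz
    have hlA : Real.log ‖A z‖ ≤ a + d * Φ z :=
      (Real.log_le_iff_le_exp (norm_pos_iff.2 hzA)).2 (hAΦ z)
    have hlB : Real.log ‖B z‖ ≤ a + d * Φ z :=
      (Real.log_le_iff_le_exp (norm_pos_iff.2 hzB)).2 (hBΦ z)
    have sA : Real.log ‖A z‖ = ∑ i, Real.log ‖z - u i‖ + Real.log ‖h z‖ := by
      rw [hAh] at hzA ⊢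
      exact log_norm_prod_mul hzA
    have sB : Real.log ‖B z‖ = ∑ i, Real.log ‖z - v i‖ + Real.log ‖k z‖ := by
      rw [hBk] at hzB ⊢
      exact log_norm_prod_mul hzB
    have tu : |∑ i, Real.log ‖z - u i‖| ≤
        N * (2 * Real.log (2 * R)) - ∑ i, Real.log ‖z - u i‖ := by
      refine (Finset.abs_sum_le_sum_abs _ _).trans ((Finset.sum_le_sum fun i _ =>
        abs_log_norm_sub_le hR hzR.le (by simpa using hu i)).trans ?_)
      simp
    have tv : |∑ i, Real.log ‖z - v i‖| ≤
        M * (2 * Real.log (2 * R)) - ∑ i, Real.log ‖z - v i‖ := by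
      refine (Finset.abs_sum_le_sum_abs _ _).trans ((Finset.sum_le_sum fun i _ =>
        abs_log_norm_sub_le hR hzR.le (by simpa using hv i)).trans ?_)
      simp
    rw [abs_le] at tu tv
    simp only [Pi.sub_apply, Pi.add_apply, Pi.smul_apply, smul_eq_mul]
    rw [abs_le]
    constructor <;> linarith
  · rw [Real.circleAverage_sub i5 iv, Real.circleAverage_sub i4 iu, Real.circleAverage_sub i3 iB,
      Real.circleAverage_sub i2 iA, Real.circleAverage_add ic i1, Real.circleAverage_const,
      Real.circleAverage_smul, circleAverage_sum_log_norm_sub hR0.le hu,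
      circleAverage_sum_log_norm_sub hR0.le hv]
    have e1 := le_circleAverage_log_norm hA.meromorphic'
      (fun z => (hA.analyticAt z).meromorphicOrderAt_nonneg) hR
    have e2 := le_circleAverage_log_norm hB.meromorphic'
      (fun z => (hB.analyticAt z).meromorphicOrderAt_nonneg) hR
    have e3 := Real.log_nonneg hR
    have e4 : 0 ≤ (N : ℝ) * Real.log R := by positivity
    have e5 : 0 ≤ (M : ℝ) * Real.log R := by positivity
    rw [smul_eq_mul]
    linarith

theorem exists_factor_closedBall_count {A : ℂ → ℂ} (hA : Differentiable ℂ A) (hA0 : A ≠ 0) :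
    ∃ κ : ℝ, 0 ≤ κ ∧ ∀ ρ R : ℝ, 0 < ρ → ρ ≤ R → 1 ≤ R → ∃ (N : ℕ) (u : Fin N → ℂ) (h : ℂ → ℂ),
      Differentiable ℂ h ∧ (∀ z ∈ Metric.closedBall (0 : ℂ) ρ, h z ≠ 0) ∧
      (∀ i, u i ∈ Metric.closedBall (0 : ℂ) ρ) ∧ (∀ z, A z = (∏ i, (z - u i)) * h z) ∧
      N * Real.log (R / ρ) ≤ κ * (1 + Real.log (R / ρ)) +
        Real.circleAverage (fun z => Real.log ‖A z‖) 0 R := by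
  obtain ⟨m, A₁, hA₁, hA₁0, hm⟩ := exists_eq_pow_mul_of_entire hA hA0 0
  have hA₁' := ne_zero_of_eq_mul hA0 hm
  refine ⟨m + |Real.log ‖A₁ 0‖|, by positivity, fun ρ R hρ hρR hR => ?_⟩
  obtain ⟨N, u, h, hh, hh0, hu, hAh⟩ := exists_factor_closedBall hA₁ hA₁' ρ
  refine ⟨m + N, Fin.append (fun _ => 0) u, h, hh, hh0, ?_, ?_, ?_⟩
  · intro i
    refine Fin.addCases (fun i => ?_) (fun i => ?_) i
    · simpa using hρ.le
    · simpa using (hu i).1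
  · intro z
    rw [Fin.prod_univ_add]
    simp [hm z, hAh z, mul_assoc]
  · have h1 := card_mul_log_le hA₁ hh hA₁0 hρ hρR (fun i => (hu i).1) hAh
    have hR0 : R ≠ 0 := by linarith
    have h2 : Real.circleAverage (fun z => Real.log ‖A₁ z‖) 0 R ≤
        Real.circleAverage (fun z => Real.log ‖A z‖) 0 R := by
      apply circleAverage_mono_codiscreteWithin hR0
        (circleIntegrable_log_norm_of_meromorphic hA₁.meromorphic' R)
        (circleIntegrable_log_norm_of_meromorphic hA.meromorphic' R)
      filter_upwards [codiscreteWithin_mono (Set.subset_univ _)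
        (eventually_ne_zero_codiscrete hA hA0), self_mem_codiscreteWithin _] with z hzA hz
      replace hzA : A z ≠ 0 := hzA
      have hzR : ‖z‖ = R := by simpa [abs_of_pos (by linarith : 0 < R)] using hz
      rw [hm] at hzA
      have h3 := right_ne_zero_of_mul hzA
      apply Real.log_le_log (norm_pos_iff.2 h3)
      rw [hm, norm_mul, norm_pow, sub_zero, hzR]
      exact le_mul_of_one_le_left (norm_nonneg _) (one_le_pow₀ hR)
    have h3 : 0 ≤ Real.log (R / ρ) := Real.log_nonneg ((one_le_div hρ).2 hρR)
    have h4 := neg_abs_le (Real.log ‖A₁ 0‖)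
    have h5 := mul_nonneg (abs_nonneg (Real.log ‖A₁ 0‖)) h3
    have h6 : (0 : ℝ) ≤ m := by positivity
    push_cast
    nlinarith

/-- Radii at which the average of `Φ` grows slowly. -/
structure GoodRadius (Φ : ℂ → ℝ) (r : ℝ) : Prop where
  one_le : 1 ≤ r
  one_le_avg : 1 ≤ Real.circleAverage Φ 0 r
  log_le : Real.log r ≤ 2 * Real.circleAverage Φ 0 r
  avg_half : Real.circleAverage Φ 0 (r * (1 + 1 / (2 * Real.circleAverage Φ 0 r))) ≤
    2 * Real.circleAverage Φ 0 r
  avg_full : Real.circleAverage Φ 0 (r * (1 + 1 / Real.circleAverage Φ 0 r)) ≤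
    2 * Real.circleAverage Φ 0 r

theorem circleAverage_log_norm_le {A : ℂ → ℂ} {Φ : ℂ → ℝ} {a d R : ℝ} (hΦ : Continuous Φ)
    (hA : Differentiable ℂ A) (hA0 : A ≠ 0) (hR : R ≠ 0)
    (hAΦ : ∀ z, ‖A z‖ ≤ Real.exp (a + d * Φ z)) :
    Real.circleAverage (fun z => Real.log ‖A z‖) 0 R ≤ a + d * Real.circleAverage Φ 0 R := by
  have iΦ : CircleIntegrable Φ 0 R := hΦ.continuousOn.circleIntegrable'
  have i1 : CircleIntegrable (d • Φ) 0 R := IntervalIntegrable.const_mul iΦ d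
  have ic := circleIntegrable_const a (0 : ℂ) R
  have : a + d * Real.circleAverage Φ 0 R = Real.circleAverage ((fun _ => a) + d • Φ) 0 R := by
    rw [Real.circleAverage_add ic i1, Real.circleAverage_const, Real.circleAverage_smul,
      smul_eq_mul]
  rw [this]
  apply circleAverage_mono_codiscrete hR
    (circleIntegrable_log_norm_of_meromorphic hA.meromorphic' R) (ic.add i1)
  filter_upwards [eventually_ne_zero_codiscrete hA hA0] with z hz
  exact (Real.log_le_iff_le_exp (norm_pos_iff.2 hz)).2 (hAΦ z)

theorem Meromorphic.iteratedDeriv' {F : ℂ → ℂ} (hF : Meromorphic F) (j : ℕ) :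
    Meromorphic (iteratedDeriv j F) := by
  rw [iteratedDeriv_eq_iterate]
  exact hF.iterated_deriv

set_option maxHeartbeats 2000000 in
theorem exists_proximity_iteratedDeriv_div_le {A B : ℂ → ℂ} {Φ : ℂ → ℝ} {a d : ℝ}
    (hΦ : Continuous Φ) (hA : Differentiable ℂ A) (hB : Differentiable ℂ B)
    (hA0 : A ≠ 0) (hB0 : B ≠ 0) (ha : 0 ≤ a) (hd : 0 ≤ d)
    (hAΦ : ∀ z, ‖A z‖ ≤ Real.exp (a + d * Φ z)) (hBΦ : ∀ z, ‖B z‖ ≤ Real.exp (a + d * Φ z))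
    (j : ℕ) :
    ∃ C : ℝ, ∀ r, GoodRadius Φ r →
      ValueDistribution.proximity
        (fun z => iteratedDeriv j (fun w => A w / B w) z / (A z / B z)) ⊤ r ≤
        C * (1 + Real.log (Real.circleAverage Φ 0 r)) := by
  obtain ⟨κ₁, hκ₁, hfA⟩ := exists_factor_closedBall_count hA hA0
  obtain ⟨κ₂, hκ₂, hfB⟩ := exists_factor_closedBall_count hB hB0
  have hI := invSqrtSinMean_nonneg
  set I := invSqrtSinMean with hIdef
  set c₁ : ℝ := 4 * (2 * κ₁ + a + 2 * d) with hc₁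
  set c₂ : ℝ := 4 * (2 * κ₂ + a + 2 * d) with hc₂
  set cA := Real.log ‖meromorphicTrailingCoeffAt A 0‖ with hcA
  set cB := Real.log ‖meromorphicTrailingCoeffAt B 0‖ with hcB
  set c₃ : ℝ := 2 * a + 4 * d + |cA| + |cB| + 8 * (c₁ + c₂) with hc₃
  set c₄ : ℝ := 5 + 32 * c₃ + (c₁ + c₂) * I with hc₄
  clear_value cA cB
  have p₁ : 0 ≤ c₁ := by positivity
  have p₂ : 0 ≤ c₂ := by positivity
  have p₃ : 0 ≤ c₃ := by positivity
  have p₄ : 1 ≤ c₄ := by have : 0 ≤ (c₁ + c₂) * I := by positivity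
                         linarith
  set a₀ := Real.log (j.factorial * Real.exp 1 * 2 ^ j) with ha₀
  have hbig : 1 ≤ (j.factorial : ℝ) * Real.exp 1 * 2 ^ j := by
    have e1 : (1 : ℝ) ≤ j.factorial := by exact_mod_cast Nat.succ_le_of_lt j.factorial_pos
    have e2 : (1 : ℝ) ≤ Real.exp 1 := Real.one_le_exp (by norm_num)
    have e3 : (1 : ℝ) ≤ 2 ^ j := one_le_pow₀ (by norm_num)
    exact one_le_mul_of_one_le_of_one_le (one_le_mul_of_one_le_of_one_le e1 e2) e3
  have ha₀0 : 0 ≤ a₀ := Real.log_nonneg hbig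
  refine ⟨a₀ + 2 * j * c₄ + 10 * j, fun r hr => ?_⟩
  set τ := Real.circleAverage Φ 0 r with hτ
  have hτ1 : 1 ≤ τ := hr.one_le_avg
  have hr1 : 1 ≤ r := hr.one_le
  have hr0 : 0 < r := by linarith
  have hτ0 : 0 < τ := by linarith
  set R₁ := r * (1 + 1 / (2 * τ)) with hR₁
  set R₂ := r * (1 + 1 / τ) with hR₂
  have hR₁r : R₁ - r = r / (2 * τ) := by rw [hR₁]; field_simp; ring
  have hrR₁ : r < R₁ := by
    have : 0 < r / (2 * τ) := by positivity
    linarith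
  have hR₂R₁ : R₂ - R₁ = r / (2 * τ) := by rw [hR₁, hR₂]; field_simp; ring
  have hR₁R₂ : R₁ ≤ R₂ := by
    have : 0 < r / (2 * τ) := by positivity
    linarith
  have hR₂r : R₂ ≤ 2 * r := by
    have : 1 / τ ≤ 1 := by rw [div_le_one hτ0]; exact hτ1
    have h2 : r * (1 / τ) ≤ r * 1 := mul_le_mul_of_nonneg_left this hr0.le
    rw [hR₂, mul_add]; linarith
  have hR₁0 : 0 < R₁ := by linarith
  have hR₁1 : 1 ≤ R₁ := by linarith
  have hx1 : Real.log (R₂ / R₁) ≤ 1 := by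
    refine (Real.log_le_sub_one_of_pos (by positivity)).trans ?_
    have : R₂ / R₁ ≤ 2 := by rw [div_le_iff₀ hR₁0]; linarith
    linarith
  have hx2 : 1 / (4 * τ) ≤ Real.log (R₂ / R₁) := by
    have h1 := Real.one_sub_inv_le_log_of_pos (x := R₂ / R₁) (by positivity)
    refine le_trans ?_ h1
    rw [inv_div, div_le_iff₀ (by positivity)]
    have h2 : 1 - R₁ / R₂ = (R₂ - R₁) / R₂ := by rw [sub_div, div_self (by linarith)]
    rw [h2, hR₂R₁, div_mul_eq_mul_div, le_div_iff₀ (by linarith)]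
    have h3 : r / (2 * τ) * (4 * τ) = 2 * r := by field_simp; ring
    linarith
  have count : ∀ (E : ℂ → ℂ) (κ : ℝ) (N : ℕ), Differentiable ℂ E → E ≠ 0 → 0 ≤ κ →
      (∀ z, ‖E z‖ ≤ Real.exp (a + d * Φ z)) →
      N * Real.log (R₂ / R₁) ≤ κ * (1 + Real.log (R₂ / R₁)) +
        Real.circleAverage (fun z => Real.log ‖E z‖) 0 R₂ →
      (N : ℝ) ≤ 4 * (2 * κ + a + 2 * d) * τ ^ 2 := by
    intro E κ N hE hE0 hκ hEΦ hN
    have h1 := circleAverage_log_norm_le hΦ hE hE0 (by linarith : R₂ ≠ 0) hEΦ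
    have h2 : d * Real.circleAverage Φ 0 R₂ ≤ d * (2 * τ) := by gcongr; exact hr.avg_full
    have h3 : (N : ℝ) * (1 / (4 * τ)) ≤ 2 * κ + a + 2 * d * τ := by
      have h4 : (N : ℝ) * (1 / (4 * τ)) ≤ N * Real.log (R₂ / R₁) := by gcongr
      have h7 : κ * (1 + Real.log (R₂ / R₁)) ≤ κ * 2 := by gcongr; linarith
      linarith
    have h5 : 2 * κ + a + 2 * d * τ ≤ (2 * κ + a + 2 * d) * τ := by
      have h8 : 2 * κ + a ≤ (2 * κ + a) * τ := le_mul_of_one_le_right (by positivity) hτ1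
      linarith
    have h6 : (N : ℝ) = N * (1 / (4 * τ)) * (4 * τ) := by
      rw [mul_assoc, one_div_mul_cancel (by linarith), mul_one]
    rw [h6]
    calc _ ≤ (2 * κ + a + 2 * d) * τ * (4 * τ) :=
          mul_le_mul_of_nonneg_right (h3.trans h5) (by linarith)
      _ = _ := by ring
  obtain ⟨N, u, h, hh, hh0, hu, hAh, hN⟩ := hfA R₁ R₂ hR₁0 hR₁R₂ (by linarith)
  obtain ⟨M, v, k, hk, hk0, hv, hBk, hM⟩ := hfB R₁ R₂ hR₁0 hR₁R₂ (by linarith)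
  have hN' : (N : ℝ) ≤ c₁ * τ ^ 2 := count A κ₁ N hA hA0 hκ₁ hAΦ hN
  have hM' : (M : ℝ) ≤ c₂ * τ ^ 2 := count B κ₂ M hB hB0 hκ₂ hBΦ hM
  have hK : Real.circleAverage (fun z => |Real.log ‖h z‖ - Real.log ‖k z‖|) 0 R₁ ≤ c₃ * τ ^ 3 := by
    refine (circleAverage_abs_log_sub_le hΦ hA hB hh hk hA0 hB0 hR₁1 hu hv hAh hBk hAΦ hBΦ).trans ?_
    have h1 : 2 * d * Real.circleAverage Φ 0 R₁ ≤ 2 * d * (2 * τ) := by gcongr; exact hr.avg_half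
    have h2 : Real.log (2 * R₁) ≤ 4 * τ := by
      have h3 : Real.log (2 * R₁) ≤ Real.log (4 * r) :=
        Real.log_le_log (by positivity) (by linarith)
      rw [Real.log_mul (x := 4) (by norm_num) (by linarith)] at h3
      have h4 : Real.log 4 ≤ 2 := by
        have : (4 : ℝ) = 2 ^ 2 := by norm_num
        rw [this, Real.log_pow]
        have := Real.log_two_lt_d9
        norm_num at this ⊢
        linarith
      have h5 : Real.log r ≤ 2 * τ := hr.log_le
      linarith
    have h3 : ((N : ℝ) + M) * (2 * Real.log (2 * R₁)) ≤ (c₁ * τ ^ 2 + c₂ * τ ^ 2) * (2 * (4 * τ)) := by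
      have : 0 ≤ Real.log (2 * R₁) := Real.log_nonneg (by linarith)
      gcongr
    have h4 := neg_abs_le cA
    have h5 := neg_abs_le cB
    have t2 : 1 ≤ τ ^ 3 := one_le_pow₀ hτ1
    have t3 : τ ≤ τ ^ 3 := le_self_pow₀ hτ1 (by norm_num)
    have g1 : 2 * a ≤ 2 * a * τ ^ 3 := le_mul_of_one_le_right (by positivity) t2
    have g2 : |cA| ≤ |cA| * τ ^ 3 := le_mul_of_one_le_right (by positivity) t2
    have g3 : |cB| ≤ |cB| * τ ^ 3 := le_mul_of_one_le_right (by positivity) t2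
    have g4 : 4 * d * τ ≤ 4 * d * τ ^ 3 := by gcongr
    have g5 : c₃ * τ ^ 3 = 2 * a * τ ^ 3 + 4 * d * τ ^ 3 + |cA| * τ ^ 3 + |cB| * τ ^ 3 +
      (c₁ * τ ^ 2 + c₂ * τ ^ 2) * (2 * (4 * τ)) := by rw [hc₃]; ring
    linarith
  set K := c₃ * τ ^ 3 with hKdef
  have hK0 : 0 ≤ K := by positivity
  set S := 4 * R₁ * K / (R₁ - r) ^ 2 + 2 / (R₁ - r) with hS
  have hd0 : 0 < R₁ - r := by linarith
  have hS0 : 0 ≤ S := by positivity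
  have hSle : S ≤ (32 * c₃ + 4) * τ ^ 5 := by
    have h1 : 2 / (R₁ - r) ≤ 4 * τ ^ 5 := by
      rw [hR₁r, div_div_eq_mul_div, div_le_iff₀ hr0]
      have : τ ≤ τ ^ 5 := le_self_pow₀ hτ1 (by norm_num)
      have h2 : τ * 1 ≤ τ ^ 5 * r := mul_le_mul this hr1 (by norm_num) (by positivity)
      linarith
    have h2 : 4 * R₁ * K / (R₁ - r) ^ 2 ≤ 32 * c₃ * τ ^ 5 := by
      have h3 : 4 * R₁ * K / (R₁ - r) ^ 2 ≤ 4 * (2 * r) * K / (R₁ - r) ^ 2 := by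
        gcongr; linarith
      refine h3.trans ?_
      rw [hR₁r, hKdef]
      have h4 : 4 * (2 * r) * (c₃ * τ ^ 3) / (r / (2 * τ)) ^ 2 = 32 * c₃ * τ ^ 5 / r := by
        field_simp; ring
      rw [h4]
      exact div_le_self (by positivity) hr1
    linarith
  rw [ValueDistribution.proximity_top]
  have hFmer : Meromorphic (fun z => A z / B z) := hA.meromorphic'.div hB.meromorphic'
  have hFj : Meromorphic (fun z => iteratedDeriv j (fun w => A w / B w) z / (A z / B z)) :=
    (hFmer.iteratedDeriv' j).div hFmer
  have hφ := circleIntegrable_posLog_norm_of_meromorphic hFj r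
  have hmain := circleAverage_le_of_le_log hr1 (Fin.append u v) hS0 (a := a₀) (b := j)
    (by positivity) hφ ?_
  · refine hmain.trans ?_
    have hl : Real.log (1 + S + (N + M : ℕ) * I) ≤ c₄ + 5 * Real.log τ := by
      have h1 : 1 + S + ((N + M : ℕ) : ℝ) * I ≤ c₄ * τ ^ 5 := by
        push_cast
        have t1 : 1 ≤ τ ^ 5 := one_le_pow₀ hτ1
        have t2 : τ ^ 2 ≤ τ ^ 5 := pow_le_pow_right₀ hτ1 (by norm_num)
        have t3 : ((N : ℝ) + M) * I ≤ (c₁ * τ ^ 5 + c₂ * τ ^ 5) * I := by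
          gcongr
          · exact hN'.trans (by gcongr)
          · exact hM'.trans (by gcongr)
        rw [hc₄]
        linarith
      have h2 := Real.log_le_log (by positivity) h1
      rw [Real.log_mul (by positivity) (by positivity), Real.log_pow] at h2
      have h3 := Real.log_le_sub_one_of_pos (by linarith : 0 < c₄)
      push_cast at h2 ⊢
      linarith
    have hlog : 0 ≤ Real.log τ := Real.log_nonneg hτ1
    have h2 : 2 * (j : ℝ) * Real.log (1 + S + (N + M : ℕ) * I) ≤ 2 * j * (c₄ + 5 * Real.log τ) := by
      gcongr
    have h3 : 0 ≤ (j : ℝ) := by positivity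
    have q1 := mul_nonneg ha₀0 hlog
    have q2 := mul_nonneg (mul_nonneg h3 (by linarith : 0 ≤ c₄)) hlog
    refine (add_le_add_right h2 a₀).trans ?_
    linarith
  · have hfin : (Set.range u ∪ Set.range v).Finite := (Set.finite_range u).union (Set.finite_range v)
    filter_upwards [compl_finite_mem_codiscreteWithin hfin,
      self_mem_codiscreteWithin _] with z hz hzr
    have hzr' : ‖z‖ = r := by simpa [abs_of_pos hr0] using hzr
    have hzu : ∀ i, z ≠ u i := fun i hi => hz (Or.inl ⟨i, hi.symm⟩)
    have hzv : ∀ i, z ≠ v i := fun i hi => hz (Or.inr ⟨i, hi.symm⟩)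
    have hpt := norm_iteratedDeriv_div_le hh hk hh0 hk0 hr0 hrR₁ hK hzr' hzu hzv j
    have hFeq : (fun w => A w / B w) =
        fun z => ((∏ i, (z - u i)) * h z) / ((∏ i, (z - v i)) * k z) := by
      funext w; rw [hAh, hBk]
    rw [← hFeq, ← hAh, ← hBk] at hpt
    set s := ∑ i, ‖z - u i‖⁻¹ + ∑ i, ‖z - v i‖⁻¹ with hs
    have hs0 : 0 ≤ s := by
      apply add_nonneg <;> exact Finset.sum_nonneg fun i _ => by positivity
    have hsum : ∑ i, ‖z - Fin.append u v i‖⁻¹ = s := by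
      rw [Fin.sum_univ_add]; simp [hs]
    rw [hsum]
    have h1 : ‖iteratedDeriv j (fun w => A w / B w) z / (A z / B z)‖ ≤
        j.factorial * Real.exp 1 * 2 ^ j * (1 + S + s) ^ j := by
      rw [norm_div]
      apply div_le_of_le_mul₀ (norm_nonneg _) (by positivity)
      refine hpt.trans ?_
      rw [mul_assoc _ (2 ^ j), ← mul_pow]
      have h3 : S + s ≤ 1 + S + s := by linarith
      have h4 : 0 ≤ S + s := by linarith
      gcongr
    have h2 : 1 ≤ (1 + S + s) ^ j := one_le_pow₀ (by linarith)
    refine (Real.posLog_le_posLog (norm_nonneg _) h1).trans ?_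
    rw [Real.posLog_eq_log (by
      rw [abs_of_nonneg (by positivity)]
      exact one_le_mul_of_one_le_of_one_le hbig h2),
      Real.log_mul (by linarith) (by positivity), Real.log_pow]

theorem exists_le_of_doubling {T : ℝ → ℝ} (hT : Continuous T)
    (hT' : Tendsto T atTop atTop) (r₀ : ℝ) :
    ∃ r, r₀ ≤ r ∧ 1 ≤ T r ∧ T (r * (1 + 1 / (2 * T r))) ≤ 2 * T r ∧
      T (r * (1 + 1 / T r)) ≤ 2 * T r := by
  obtain ⟨r₁, hT₁⟩ := ((eventually_ge_atTop (max r₀ 1)).and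
    (hT'.eventually_ge_atTop 1)).exists_forall_of_atTop
  by_contra hcon
  push Not at hcon
  have step : ∀ r, r₁ ≤ r → ∃ r', r ≤ r' ∧ r' ≤ r * (1 + 1 / T r) ∧ 2 * T r < T r' := by
    intro r hr
    obtain ⟨h1, h2⟩ := hT₁ r hr
    have hr0 : r₀ ≤ r := (le_max_left _ _).trans h1
    have hr1 : 1 ≤ r := (le_max_right _ _).trans h1
    have hpos : 0 < T r := by linarith
    have hle : 1 / (2 * T r) ≤ 1 / T r := by
      apply one_div_le_one_div_of_le hpos; linarith
    have hnn : 0 ≤ 1 / (2 * T r) := by positivity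
    by_cases h : T (r * (1 + 1 / (2 * T r))) ≤ 2 * T r
    · exact ⟨_, le_mul_of_one_le_right (by linarith) (by linarith), le_rfl, hcon r hr0 h2 h⟩
    · exact ⟨_, le_mul_of_one_le_right (by linarith) (by linarith),
        mul_le_mul_of_nonneg_left (by linarith) (by linarith), not_le.1 h⟩
  choose! σ h1 h2 h3 using step
  set x : ℕ → ℝ := fun k => σ^[k] r₁
  have hx : ∀ k, x (k + 1) = σ (x k) := fun k => Function.iterate_succ_apply' _ _ _
  have hge : ∀ k, r₁ ≤ x k := by
    intro k
    induction k with
    | zero => exact le_rfl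
    | succ k ih => rw [hx]; exact ih.trans (h1 _ ih)
  have hTx : ∀ k, 2 ^ k ≤ T (x k) := by
    intro k
    induction k with
    | zero => simpa using (hT₁ _ (hge 0)).2
    | succ k ih => rw [hx, pow_succ]; linarith [h3 _ (hge k)]
  have hr₁0 : 0 < r₁ := by linarith [(le_max_right r₀ 1).trans (hT₁ r₁ le_rfl).1]
  have hxle : ∀ k, x k ≤ r₁ * Real.exp (2 - 2 * (1 / 2) ^ k) := by
    intro k
    induction k with
    | zero => simp [x]
    | succ k ih =>
      rw [hx]
      have hb : 1 / T (x k) ≤ (1 / 2) ^ k := by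
        rw [one_div_pow]
        exact one_div_le_one_div_of_le (by positivity) (hTx k)
      have hxk : 0 < x k := hr₁0.trans_le (hge k)
      calc σ (x k) ≤ x k * (1 + 1 / T (x k)) := h2 _ (hge k)
        _ ≤ x k * Real.exp ((1 / 2) ^ k) := by
            apply mul_le_mul_of_nonneg_left _ hxk.le
            linarith [Real.add_one_le_exp ((1 / 2 : ℝ) ^ k)]
        _ ≤ r₁ * Real.exp (2 - 2 * (1 / 2) ^ k) * Real.exp ((1 / 2) ^ k) :=
            mul_le_mul_of_nonneg_right ih (Real.exp_pos _).le
        _ = _ := by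
            rw [mul_assoc, ← Real.exp_add]
            congr 2
            rw [pow_succ]; ring
  obtain ⟨M, hM⟩ := (isCompact_Icc (a := r₁) (b := r₁ * Real.exp 2)).bddAbove_image
    hT.continuousOn
  obtain ⟨k, hk⟩ := pow_unbounded_of_one_lt M (one_lt_two)
  have := hM ⟨x k, ⟨hge k, (hxle k).trans ?_⟩, rfl⟩
  · linarith [hTx k]
  · apply mul_le_mul_of_nonneg_left _ hr₁0.le
    apply Real.exp_le_exp.2
    have : (0 : ℝ) ≤ (1 / 2) ^ k := by positivity
    linarith

theorem frequently_goodRadius {Φ : ℂ → ℝ} (hΦ : Continuous Φ) {C : ℝ}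
    (hC : ∀ r, 1 ≤ r → Real.log r - C ≤ Real.circleAverage Φ 0 r) :
    ∃ᶠ r in atTop, GoodRadius Φ r := by
  have hlim : Tendsto (Real.circleAverage Φ 0) atTop atTop := by
    apply tendsto_atTop_mono' _ _ (tendsto_atTop_add_const_right _ (-C) Real.tendsto_log_atTop)
    filter_upwards [eventually_ge_atTop 1] with r hr
    linarith [hC r hr]
  rw [Filter.frequently_atTop]
  intro r₀
  obtain ⟨r, hr, h1, h2, h3⟩ := exists_le_of_doubling (Real.Continuous.circleAverage hΦ) hlim
    (max (max r₀ 1) (Real.exp (2 * C)))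
  have hr1 : 1 ≤ r := (le_max_right _ _).trans ((le_max_left _ _).trans hr)
  refine ⟨r, (le_max_left _ _).trans ((le_max_left _ _).trans hr), hr1, h1, ?_, h2, h3⟩
  have := hC r hr1
  have h4 : 2 * C ≤ Real.log r :=
    (Real.le_log_iff_exp_le (by linarith)).2 ((le_max_right _ _).trans hr)
  linarith

/-- The filter of good radii tending to infinity. -/
def goodFilter (Φ : ℂ → ℝ) : Filter ℝ := atTop ⊓ 𝓟 {r | GoodRadius Φ r}

theorem eventually_goodRadius (Φ : ℂ → ℝ) : ∀ᶠ r in goodFilter Φ, GoodRadius Φ r :=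
  mem_inf_of_right (mem_principal_self _)

/-- A function on radii is negligible if it is logarithmically bounded in the mean of `Φ`. -/
def Negl (Φ : ℂ → ℝ) (m : ℝ → ℝ) : Prop :=
  ∃ C, ∀ᶠ r in goodFilter Φ, m r ≤ C * (1 + Real.log (Real.circleAverage Φ 0 r))

theorem one_le_of_good {Φ : ℂ → ℝ} {r : ℝ} (h : GoodRadius Φ r) :
    1 ≤ 1 + Real.log (Real.circleAverage Φ 0 r) := by
  linarith [Real.log_nonneg h.one_le_avg]

theorem Negl.mono {Φ : ℂ → ℝ} {m m' : ℝ → ℝ} (h : Negl Φ m)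
    (hle : ∀ᶠ r in goodFilter Φ, m' r ≤ m r) : Negl Φ m' := by
  obtain ⟨C, hC⟩ := h
  exact ⟨C, by filter_upwards [hC, hle] with r h1 h2 using h2.trans h1⟩

theorem Negl.add {Φ : ℂ → ℝ} {m m' : ℝ → ℝ} (h : Negl Φ m) (h' : Negl Φ m') :
    Negl Φ (m + m') := by
  obtain ⟨C, hC⟩ := h
  obtain ⟨D, hD⟩ := h'
  refine ⟨C + D, ?_⟩
  filter_upwards [hC, hD] with r h1 h2
  rw [Pi.add_apply, add_mul]
  exact add_le_add h1 h2

theorem Negl.const (Φ : ℂ → ℝ) (c : ℝ) : Negl Φ (fun _ => c) := by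
  refine ⟨|c|, ?_⟩
  filter_upwards [eventually_goodRadius Φ] with r hr
  exact (le_abs_self c).trans (le_mul_of_one_le_right (abs_nonneg c) (one_le_of_good hr))

/-- Meromorphic functions whose proximity function is negligible. -/
structure SmallMer (Φ : ℂ → ℝ) (u : ℂ → ℂ) : Prop where
  mer : Meromorphic u
  negl : Negl Φ (ValueDistribution.proximity u ⊤)

namespace SmallMer
variable {Φ : ℂ → ℝ} {u v : ℂ → ℂ}

theorem const (c : ℂ) : SmallMer Φ (fun _ => c) :=
  ⟨(differentiable_const c).meromorphic', (Negl.const Φ _).mono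
    (.of_forall fun r => (ValueDistribution.proximity_const (c := c) (r := r)).le)⟩

theorem mul (hu : SmallMer Φ u) (hv : SmallMer Φ v) : SmallMer Φ (u * v) :=
  ⟨hu.mer.mul hv.mer, (hu.negl.add hv.negl).mono
    (.of_forall fun r => ValueDistribution.proximity_mul_top_le hu.mer hv.mer r)⟩

theorem add (hu : SmallMer Φ u) (hv : SmallMer Φ v) : SmallMer Φ (u + v) :=
  ⟨hu.mer.add hv.mer, ((hu.negl.add hv.negl).add (Negl.const Φ _)).mono
    (.of_forall fun r => ValueDistribution.proximity_add_top_le hu.mer hv.mer r)⟩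

theorem neg (hu : SmallMer Φ u) : SmallMer Φ (-u) := by
  have := (const (Φ := Φ) (-1)).mul hu
  convert this using 1
  ext z; simp

theorem sub (hu : SmallMer Φ u) (hv : SmallMer Φ v) : SmallMer Φ (u - v) := by
  rw [sub_eq_add_neg]; exact hu.add hv.neg

theorem pow (hu : SmallMer Φ u) (k : ℕ) : SmallMer Φ (u ^ k) := by
  induction k with
  | zero => exact const 1
  | succ k ih => rw [pow_succ]; exact ih.mul hu

theorem sum {ι : Type*} {s : Finset ι} {u : ι → ℂ → ℂ} (h : ∀ i ∈ s, SmallMer Φ (u i)) :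
    SmallMer Φ (∑ i ∈ s, u i) := by
  classical
  induction s using Finset.induction_on with
  | empty => exact const 0
  | insert i s hi ih =>
    rw [Finset.sum_insert hi]
    exact (h i (Finset.mem_insert_self i s)).add
      (ih fun j hj => h j (Finset.mem_insert_of_mem hj))

theorem prod {ι : Type*} {s : Finset ι} {u : ι → ℂ → ℂ} (h : ∀ i ∈ s, SmallMer Φ (u i)) :
    SmallMer Φ (∏ i ∈ s, u i) := by
  classical
  induction s using Finset.induction_on with
  | empty => exact const 1
  | insert i s hi ih =>
    rw [Finset.prod_insert hi]
    exact (h i (Finset.mem_insert_self i s)).mul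
      (ih fun j hj => h j (Finset.mem_insert_of_mem hj))

theorem eventually_ne_zero_goodFilter : ∀ᶠ r in goodFilter Φ, r ≠ 0 := by
  filter_upwards [eventually_goodRadius Φ] with r hr
  have := hr.one_le
  intro h; linarith

theorem congr (hu : SmallMer Φ u) (hv : Meromorphic v) (h : u =ᶠ[codiscrete ℂ] v) :
    SmallMer Φ v :=
  ⟨hv, hu.negl.mono (by
    filter_upwards [eventually_ne_zero_goodFilter (Φ := Φ)] with r hr
    exact (ValueDistribution.proximity_congr_codiscrete h hr).symm.le)⟩

end SmallMer

theorem smallMer_iteratedDeriv_div {A B : ℂ → ℂ} {Φ : ℂ → ℝ}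
    (hΦ : Continuous Φ) (hA : Differentiable ℂ A) (hB : Differentiable ℂ B)
    (hA0 : A ≠ 0) (hB0 : B ≠ 0) {a d : ℝ} (ha : 0 ≤ a) (hd : 0 ≤ d)
    (hAΦ : ∀ z, ‖A z‖ ≤ Real.exp (a + d * Φ z)) (hBΦ : ∀ z, ‖B z‖ ≤ Real.exp (a + d * Φ z))
    (j : ℕ) :
    SmallMer Φ (fun z => iteratedDeriv j (fun w => A w / B w) z / (A z / B z)) := by
  have hAB : Meromorphic (fun z => A z / B z) := hA.meromorphic'.div hB.meromorphic'
  refine ⟨(hAB.iteratedDeriv' j).div hAB, ?_⟩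
  obtain ⟨C, hC⟩ := exists_proximity_iteratedDeriv_div_le hΦ hA hB hA0 hB0 ha hd hAΦ hBΦ j
  exact ⟨C, by filter_upwards [eventually_goodRadius Φ] with r hr using hC r hr⟩

/-- Entire functions with negligible proximity function form a subring. -/
def smallRing (Φ : ℂ → ℝ) : Subring (ℂ → ℂ) where
  carrier := {u | Differentiable ℂ u ∧ SmallMer Φ u}
  mul_mem' := fun hu hv => ⟨hu.1.mul hv.1, hu.2.mul hv.2⟩
  one_mem' := ⟨differentiable_const 1, SmallMer.const 1⟩
  add_mem' := fun hu hv => ⟨hu.1.add hv.1, hu.2.add hv.2⟩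
  zero_mem' := ⟨differentiable_const 0, SmallMer.const 0⟩
  neg_mem' := fun hu => ⟨hu.1.neg, hu.2.neg⟩

theorem eventually_codiscrete_iff {p : ℂ → Prop} :
    (∀ᶠ z in codiscrete ℂ, p z) ↔ ∀ x, ∀ᶠ z in 𝓝[≠] x, p z := by
  rw [Filter.Eventually, mem_codiscrete]
  simp only [disjoint_principal_right, compl_compl]
  rfl

instance : (codiscrete ℂ).NeBot := by
  rw [← Filter.frequently_true_iff_neBot]
  intro h
  have := (eventually_codiscrete_iff.1 h 0).exists
  simp at this

theorem entire_mul_ne_zero {u v : ℂ → ℂ} (hu : Differentiable ℂ u) (hv : Differentiable ℂ v)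
    (hu0 : u ≠ 0) (hv0 : v ≠ 0) : u * v ≠ 0 := by
  intro h
  obtain ⟨z, h1, h2⟩ :=
    ((eventually_ne_zero_codiscrete hu hu0).and (eventually_ne_zero_codiscrete hv hv0)).exists
  exact mul_ne_zero h1 h2 (congrFun h z)

theorem entire_prod_ne_zero {ι : Type*} {s : Finset ι} {u : ι → ℂ → ℂ}
    (hu : ∀ i ∈ s, Differentiable ℂ (u i)) (hu0 : ∀ i ∈ s, u i ≠ 0) : ∏ i ∈ s, u i ≠ 0 := by
  intro h
  obtain ⟨z, hz⟩ := ((Finset.eventually_all s).2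
    fun i hi => eventually_ne_zero_codiscrete (hu i hi) (hu0 i hi)).exists
  have := congrFun h z
  rw [Finset.prod_apply] at this
  exact Finset.prod_ne_zero_iff.2 hz this

instance (Φ : ℂ → ℝ) : IsDomain (smallRing Φ) := by
  have : NoZeroDivisors (smallRing Φ) := ⟨fun {a b} hab => by
    by_contra! hcon
    refine entire_mul_ne_zero a.2.1 b.2.1 (fun h => hcon.1 (Subtype.ext h))
      (fun h => hcon.2 (Subtype.ext h)) (congrArg Subtype.val hab)⟩
  have : Nontrivial (smallRing Φ) := ⟨0, 1, fun h => zero_ne_one (congrFun (congrArg Subtype.val h) 0)⟩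
  exact NoZeroDivisors.to_isDomain _

/-- Removable singularities: a meromorphic function without poles is entire off a discrete set. -/
theorem exists_entire_of_order_nonneg {u : ℂ → ℂ} (hu : Meromorphic u)
    (h : ∀ z, 0 ≤ meromorphicOrderAt u z) :
    ∃ v : ℂ → ℂ, Differentiable ℂ v ∧ u =ᶠ[codiscrete ℂ] v ∧
      (∀ z, u =ᶠ[𝓝[≠] z] v) ∧ ∀ z, 0 < meromorphicOrderAt u z → v z = 0 := by
  have hu' : MeromorphicOn u Set.univ := fun z _ => hu z
  set v := toMeromorphicNFOn u Set.univ
  have hNF : MeromorphicNFOn v Set.univ := meromorphicNFOn_toMeromorphicNFOn u Set.univ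
  have hord : ∀ z, meromorphicOrderAt v z = meromorphicOrderAt u z := fun z =>
    meromorphicOrderAt_toMeromorphicNFOn hu' (Set.mem_univ z)
  have han : ∀ z, AnalyticAt ℂ v z := fun z =>
    (hNF (Set.mem_univ z)).meromorphicOrderAt_nonneg_iff_analyticAt.1 (by rw [hord]; exact h z)
  have hd : Differentiable ℂ v := fun z => (han z).differentiableAt
  refine ⟨v, hd, toMeromorphicNFOn_eqOn_codiscrete hu', fun z => ?_, fun z hz => ?_⟩
  · exact (hu'.toMeromorphicNFOn_eq_self_on_nhdsNE (Set.mem_univ z)).symm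
  · by_contra hne
    have := (hNF (Set.mem_univ z)).meromorphicOrderAt_eq_zero_iff.2 hne
    rw [hord] at this
    exact hz.ne' this

/-- The Wronskian determinant. -/
def wron {n : ℕ} (h : Fin n → ℂ → ℂ) (z : ℂ) : ℂ :=
  Matrix.det (Matrix.of fun i j : Fin n => iteratedDeriv i (h j) z)

theorem wron_congr {n : ℕ} {h k : Fin n → ℂ → ℂ} {z : ℂ} (H : ∀ j, h j =ᶠ[𝓝 z] k j) :
    wron h z = wron k z := by
  unfold wron
  congr 1
  ext i j
  exact (H j).iteratedDeriv_eq i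

theorem wron_mul {n : ℕ} {φ : ℂ → ℂ} {h : Fin n → ℂ → ℂ} {z : ℂ} (hφ : AnalyticAt ℂ φ z)
    (hh : ∀ j, AnalyticAt ℂ (h j) z) :
    wron (fun j => φ * h j) z = φ z ^ n * wron h z := by
  unfold wron
  set L : Matrix (Fin n) (Fin n) ℂ := Matrix.of fun i k =>
    if (k : ℕ) ≤ i then ((i : ℕ).choose k : ℂ) * iteratedDeriv (i - k) φ z else 0 with hL
  have hLdet : L.det = φ z ^ n := by
    rw [Matrix.det_of_isLowerTriangular L]
    · simp [hL]
    · intro i k hik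
      have : (i : ℕ) < k := hik
      rw [hL, Matrix.of_apply, if_neg (not_le.2 this)]
  rw [← hLdet, ← Matrix.det_mul]
  congr 1
  ext i j
  rw [Matrix.mul_apply, Matrix.of_apply]
  beta_reduce
  rw [mul_comm φ,
    iteratedDeriv_mul (hh j).contDiffAt hφ.contDiffAt]
  simp only [hL, Matrix.of_apply, ite_mul, zero_mul]
  rw [Fin.sum_univ_eq_sum_range (fun k => if k ≤ (i : ℕ) then
    ((i : ℕ).choose k : ℂ) * iteratedDeriv (i - k) φ z * iteratedDeriv k (h j) z else 0) n,
    ← Finset.sum_filter]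
  have : Finset.filter (fun k => k ≤ (i : ℕ)) (Finset.range n) = Finset.range (i + 1) := by
    ext k
    have := i.2
    simp only [Finset.mem_filter, Finset.mem_range]
    omega
  rw [this]
  exact Finset.sum_congr rfl fun k _ => by ring

theorem wron_cons_one {n : ℕ} (u : Fin n → ℂ → ℂ) (z : ℂ) :
    wron (Fin.cons (fun _ => 1) u : Fin (n + 1) → ℂ → ℂ) z = wron (fun j => deriv (u j)) z := by
  unfold wron
  rw [Matrix.det_succ_column_zero, Fin.sum_univ_succ]
  have h0 : ∀ i : Fin n, iteratedDeriv ((i : ℕ) + 1) (fun _ : ℂ => (1 : ℂ)) z = 0 := by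
    intro i
    rw [iteratedDeriv_succ']
    simp
  simp only [Matrix.of_apply, Fin.cons_zero, Fin.val_zero, pow_zero, iteratedDeriv_zero, one_mul,
    Fin.val_succ, h0, mul_zero, zero_mul, Finset.sum_const_zero, add_zero]
  congr 1
  ext i j
  simp [Matrix.submatrix_apply, iteratedDeriv_succ']

theorem exists_linear_relation_of_wron_eq_zero : ∀ (n : ℕ) (h : Fin n → ℂ → ℂ) (U : Set ℂ),
    IsOpen U → U.Nonempty → (∀ j, AnalyticOnNhd ℂ (h j) U) → (∀ z ∈ U, wron h z = 0) →
    ∃ V ⊆ U, IsOpen V ∧ V.Nonempty ∧ ∃ c : Fin n → ℂ, c ≠ 0 ∧ ∀ z ∈ V, ∑ j, c j * h j z = 0 := by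
  intro n
  induction n with
  | zero =>
    intro h U _ ⟨z, hz⟩ _ hw
    have := hw z hz
    simp [wron] at this
  | succ n ih =>
    intro h U hU hne hh hw
    by_cases h0 : ∀ z ∈ U, h 0 z = 0
    · refine ⟨U, subset_rfl, hU, hne, Pi.single 0 1, by simp, fun z hz => ?_⟩
      simp [Pi.single_apply, h0 z hz]
    push Not at h0
    obtain ⟨z₀, hz₀, hz₀'⟩ := h0
    obtain ⟨ε, hε, hball⟩ := Metric.eventually_nhds_iff_ball.1
      ((hU.eventually_mem hz₀).and ((hh 0 z₀ hz₀).continuousAt.eventually_ne hz₀'))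
    set B := Metric.ball z₀ ε with hB
    have hBU : B ⊆ U := fun z hz => (hball z hz).1
    have hB0 : ∀ z ∈ B, h 0 z ≠ 0 := fun z hz => (hball z hz).2
    set u : Fin n → ℂ → ℂ := fun j => h j.succ / h 0 with hu
    have hua : ∀ j, AnalyticOnNhd ℂ (u j) B := fun j z hz =>
      (hh j.succ z (hBU hz)).div (hh 0 z (hBU hz)) (hB0 z hz)
    have hw' : ∀ z ∈ B, wron (fun j => deriv (u j)) z = 0 := by
      intro z hz
      rw [← wron_cons_one]
      have h1 : wron h z = wron (fun j => h 0 * (Fin.cons (fun _ => 1) u : Fin (n + 1) → ℂ → ℂ) j) z := by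
        apply wron_congr
        intro j
        filter_upwards [Metric.isOpen_ball.mem_nhds hz] with w hw
        refine Fin.cases ?_ (fun j => ?_) j
        · simp
        · simp [hu, mul_div_cancel₀ _ (hB0 w hw)]
      rw [hw z (hBU hz), wron_mul (hh 0 z (hBU hz))] at h1
      · exact (mul_eq_zero.1 h1.symm).resolve_left (pow_ne_zero _ (hB0 z hz))
      · intro j
        refine Fin.cases ?_ (fun j => ?_) j
        · exact analyticAt_const
        · exact hua j z hz
    obtain ⟨V, hVB, hV, hVne, c, hc, hcV⟩ := ih (fun j => deriv (u j)) B Metric.isOpen_ball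
      ⟨z₀, Metric.mem_ball_self hε⟩ (fun j => (hua j).deriv) hw'
    obtain ⟨z₁, hz₁⟩ := hVne
    obtain ⟨δ, hδ, hballV⟩ := Metric.isOpen_iff.1 hV z₁ hz₁
    set S : ℂ → ℂ := fun z => ∑ j, c j * u j z
    have hSd : ∀ z ∈ Metric.ball z₁ δ, HasDerivAt S 0 z := by
      intro z hz
      have : HasDerivAt S (∑ j, c j * deriv (u j) z) z := by
        apply HasDerivAt.fun_sum
        intro j _
        exact ((hua j z (hVB (hballV hz))).differentiableAt.hasDerivAt).const_mul (c j)
      rwa [hcV z (hballV hz)] at this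
    have hconst : ∀ z ∈ Metric.ball z₁ δ, S z = S z₁ := by
      intro z hz
      exact (convex_ball z₁ δ).is_const_of_fderivWithin_eq_zero (𝕜 := ℂ)
        (fun w hw => (hSd w hw).differentiableAt.differentiableWithinAt)
        (fun w hw => by
          rw [fderivWithin_of_isOpen Metric.isOpen_ball hw]
          ext
          simp [(hSd w hw).deriv]) hz (Metric.mem_ball_self hδ)
    refine ⟨Metric.ball z₁ δ, (hballV.trans hVB).trans hBU, Metric.isOpen_ball,
      ⟨z₁, Metric.mem_ball_self hδ⟩, Fin.cons (-S z₁) c, ?_, ?_⟩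
    · intro hzero
      apply hc
      ext j
      simpa using congrFun hzero j.succ
    · intro z hz
      have h1 := hconst z hz
      have h2 := hB0 z (hVB (hballV hz))
      rw [Fin.sum_univ_succ]
      simp only [Fin.cons_zero, Fin.cons_succ]
      rw [← h1]
      simp only [S, hu, Pi.div_apply]
      rw [neg_mul, Finset.sum_mul, neg_add_eq_zero]
      exact Finset.sum_congr rfl fun j _ => by field_simp

theorem wron_ne_zero {n : ℕ} {h : Fin n → ℂ → ℂ} (hh : ∀ j, Differentiable ℂ (h j))
    (hli : ∀ c : Fin n → ℂ, (∀ z, ∑ j, c j * h j z = 0) → c = 0) : wron h ≠ 0 := by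
  intro hw
  obtain ⟨V, -, hV, ⟨z₀, hz₀⟩, c, hc, hcV⟩ := exists_linear_relation_of_wron_eq_zero n h Set.univ
    isOpen_univ Set.univ_nonempty (fun j z _ => (hh j).analyticAt z) (fun z _ => congrFun hw z)
  apply hc
  apply hli
  have hS : Differentiable ℂ (fun z => ∑ j, c j * h j z) := by
    apply Differentiable.fun_sum
    exact fun j _ => (hh j).const_mul _
  have : (fun z => ∑ j, c j * h j z) = fun _ => 0 := by
    apply AnalyticOnNhd.eq_of_eventuallyEq (𝕜 := ℂ) (z₀ := z₀) (fun z _ => hS.analyticAt z)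
      (fun z _ => analyticAt_const)
    filter_upwards [hV.mem_nhds hz₀] with w hw using hcV w hw
  exact fun z => congrFun this z

theorem iteratedDeriv_linear_comb {m : ℕ} {h : Fin m → ℂ → ℂ} (hh : ∀ j, Differentiable ℂ (h j))
    (c : Fin m → ℂ) (i : ℕ) (z : ℂ) :
    iteratedDeriv i (fun z => ∑ j, c j * h j z) z = ∑ j, c j * iteratedDeriv i (h j) z := by
  rw [iteratedDeriv_fun_sum]
  · refine Finset.sum_congr rfl fun j _ => ?_
    rw [iteratedDeriv_const_mul_field]
  · exact fun j _ => (((hh j).analyticAt z).const_smul (c := c j)).contDiffAt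

theorem wron_linear_comb {n : ℕ} {h : Fin n → ℂ → ℂ} (hh : ∀ j, Differentiable ℂ (h j))
    (A : Fin n → Fin n → ℂ) (z : ℂ) :
    wron (fun k z => ∑ j, A k j * h j z) z = (Matrix.of A).det * wron h z := by
  unfold wron
  rw [mul_comm, ← Matrix.det_transpose (Matrix.of A), ← Matrix.det_mul]
  congr 1
  ext i k
  rw [Matrix.mul_apply, Matrix.of_apply, iteratedDeriv_linear_comb hh]
  exact Finset.sum_congr rfl fun j _ => by simp [mul_comm]

theorem iteratedDeriv_differentiable {u : ℂ → ℂ} (hu : Differentiable ℂ u) (i : ℕ) :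
    Differentiable ℂ (iteratedDeriv i u) := by
  have := hu.contDiff (n := ⊤)
  exact this.differentiable_iteratedDeriv i (by simp)

theorem wron_eq_sum {n : ℕ} (h : Fin n → ℂ → ℂ) :
    wron h = ∑ σ : Equiv.Perm (Fin n), (fun _ => ((Equiv.Perm.sign σ : ℤ) : ℂ)) *
      ∏ i, iteratedDeriv (σ i) (h i) := by
  ext z
  unfold wron
  rw [Matrix.det_apply']
  simp [Finset.sum_apply, Finset.prod_apply]

theorem wron_differentiable {n : ℕ} {h : Fin n → ℂ → ℂ} (hh : ∀ j, Differentiable ℂ (h j)) :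
    Differentiable ℂ (wron h) := by
  rw [wron_eq_sum]
  apply Differentiable.sum
  intro σ _
  apply (differentiable_const _).mul
  apply Differentiable.finsetProd
  exact fun i _ => iteratedDeriv_differentiable (hh i) _

/-- `u` has order at least `m` at `z`. -/
def OrdGe (u : ℂ → ℂ) (z : ℂ) (m : ℤ) : Prop :=
  ∃ v : ℂ → ℂ, AnalyticAt ℂ v z ∧ ∀ᶠ w in 𝓝[≠] z, u w = (w - z) ^ m * v w

/-- `u` has order exactly `m` at `z`. -/
def OrdEq (u : ℂ → ℂ) (z : ℂ) (m : ℤ) : Prop :=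
  ∃ v : ℂ → ℂ, AnalyticAt ℂ v z ∧ v z ≠ 0 ∧ ∀ᶠ w in 𝓝[≠] z, u w = (w - z) ^ m * v w

theorem eventually_sub_ne_zero (z : ℂ) : ∀ᶠ w in 𝓝[≠] z, w - z ≠ 0 := by
  filter_upwards [self_mem_nhdsWithin] with w hw using sub_ne_zero.2 hw

theorem eventually_nhds_of_eventually_nhdsNE {z : ℂ} {p : ℂ → Prop} (h : ∀ᶠ w in 𝓝[≠] z, p w) :
    ∀ᶠ w in 𝓝[≠] z, ∀ᶠ x in 𝓝 w, p x := by
  filter_upwards [eventually_eventually_nhdsWithin.2 h, self_mem_nhdsWithin] with w h1 h2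
  rwa [isOpen_compl_singleton.nhdsWithin_eq h2] at h1

theorem AnalyticAt.ordGe {u : ℂ → ℂ} {z : ℂ} (hu : AnalyticAt ℂ u z) : OrdGe u z 0 :=
  ⟨u, hu, .of_forall fun w => by simp⟩

theorem AnalyticAt.ordEq {u : ℂ → ℂ} {z : ℂ} (hu : AnalyticAt ℂ u z) (h0 : u z ≠ 0) :
    OrdEq u z 0 :=
  ⟨u, hu, h0, .of_forall fun w => by simp⟩

theorem OrdEq.ordGe {u : ℂ → ℂ} {z : ℂ} {m : ℤ} (h : OrdEq u z m) : OrdGe u z m :=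
  let ⟨v, hv, _, he⟩ := h; ⟨v, hv, he⟩

namespace OrdGe
variable {u v : ℂ → ℂ} {z : ℂ} {m k : ℤ}

theorem congr (h : OrdGe u z m) (huv : u =ᶠ[𝓝[≠] z] v) : OrdGe v z m := by
  obtain ⟨p, hp, he⟩ := h
  exact ⟨p, hp, by filter_upwards [he, huv] with w h1 h2 using h2 ▸ h1⟩

theorem mono (h : OrdGe u z m) (hk : k ≤ m) : OrdGe u z k := by
  obtain ⟨p, hp, he⟩ := h
  obtain ⟨j, rfl⟩ := Int.le.dest hk
  refine ⟨fun w => (w - z) ^ j * p w, by fun_prop, ?_⟩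
  filter_upwards [he, eventually_sub_ne_zero z] with w h1 h2
  rw [h1, zpow_add₀ h2, zpow_natCast, mul_assoc]

theorem mul (h : OrdGe u z m) (h' : OrdGe v z k) : OrdGe (u * v) z (m + k) := by
  obtain ⟨p, hp, he⟩ := h
  obtain ⟨q, hq, he'⟩ := h'
  refine ⟨p * q, hp.mul hq, ?_⟩
  filter_upwards [he, he', eventually_sub_ne_zero z] with w h1 h2 h3
  rw [Pi.mul_apply, Pi.mul_apply, h1, h2, zpow_add₀ h3]; ring

theorem add (h : OrdGe u z m) (h' : OrdGe v z m) : OrdGe (u + v) z m := by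
  obtain ⟨p, hp, he⟩ := h
  obtain ⟨q, hq, he'⟩ := h'
  refine ⟨p + q, hp.add hq, ?_⟩
  filter_upwards [he, he'] with w h1 h2
  rw [Pi.add_apply, Pi.add_apply, h1, h2]; ring

theorem neg (h : OrdGe u z m) : OrdGe (-u) z m := by
  obtain ⟨p, hp, he⟩ := h
  refine ⟨-p, hp.neg, ?_⟩
  filter_upwards [he] with w h1
  rw [Pi.neg_apply, Pi.neg_apply, h1]; ring

theorem sub (h : OrdGe u z m) (h' : OrdGe v z m) : OrdGe (u - v) z m := by
  rw [sub_eq_add_neg]; exact h.add h'.neg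

theorem zero : OrdGe 0 z m :=
  ⟨0, analyticAt_const, .of_forall fun w => by simp⟩

theorem sum {ι : Type*} {s : Finset ι} {u : ι → ℂ → ℂ} (h : ∀ i ∈ s, OrdGe (u i) z m) :
    OrdGe (∑ i ∈ s, u i) z m := by
  classical
  induction s using Finset.induction_on with
  | empty => exact zero
  | insert i s hi ih =>
    rw [Finset.sum_insert hi]
    exact (h i (Finset.mem_insert_self i s)).add
      (ih fun j hj => h j (Finset.mem_insert_of_mem hj))

theorem prod {ι : Type*} {s : Finset ι} {u : ι → ℂ → ℂ} {m : ι → ℤ}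
    (h : ∀ i ∈ s, OrdGe (u i) z (m i)) : OrdGe (∏ i ∈ s, u i) z (∑ i ∈ s, m i) := by
  classical
  induction s using Finset.induction_on with
  | empty => exact (analyticAt_const (v := (1 : ℂ))).ordGe
  | insert i s hi ih =>
    rw [Finset.prod_insert hi, Finset.sum_insert hi]
    exact (h i (Finset.mem_insert_self i s)).mul
      (ih fun j hj => h j (Finset.mem_insert_of_mem hj))

theorem deriv (h : OrdGe u z m) : OrdGe (deriv u) z (m - 1) := by
  obtain ⟨p, hp, he⟩ := h
  refine ⟨fun w => m * p w + (w - z) * _root_.deriv p w, ?_, ?_⟩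
  · have := hp.deriv
    fun_prop
  · have h1 : ∀ᶠ w in 𝓝[≠] z, ∀ᶠ x in 𝓝 w, u x = (x - z) ^ m * p x :=
      eventually_nhds_of_eventually_nhdsNE he
    filter_upwards [h1, eventually_sub_ne_zero z,
      hp.eventually_analyticAt.filter_mono nhdsWithin_le_nhds] with w h1 h2 h3
    have h4 : HasDerivAt (fun x => (x - z) ^ m * p x)
        ((m * (w - z) ^ (m - 1)) * p w + (w - z) ^ m * _root_.deriv p w) w := by
      have := (hasDerivAt_zpow m (w - z) (Or.inl h2)).comp w ((hasDerivAt_id w).sub_const z)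
      rw [mul_one] at this
      exact this.mul h3.differentiableAt.hasDerivAt
    rw [(show u =ᶠ[𝓝 w] _ from h1).deriv_eq, h4.deriv, zpow_sub_one₀ h2]
    field_simp

theorem iteratedDeriv (h : OrdGe u z m) (i : ℕ) : OrdGe (iteratedDeriv i u) z (m - i) := by
  induction i with
  | zero => simpa using h
  | succ i ih =>
    rw [iteratedDeriv_succ]
    exact ih.deriv.mono (by push_cast; omega)

theorem tendsto (h : OrdGe u z 1) : Tendsto u (𝓝[≠] z) (𝓝 0) := by
  obtain ⟨p, hp, he⟩ := h
  have : Tendsto (fun w => (w - z) ^ (1 : ℤ) * p w) (𝓝[≠] z) (𝓝 0) := by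
    have hc : ContinuousAt (fun w => (w - z) ^ (1 : ℤ) * p w) z := by
      have := hp.continuousAt
      simp only [zpow_one]
      fun_prop
    have := hc.tendsto.mono_left (nhdsWithin_le_nhds (s := {z}ᶜ))
    simpa using this
  exact this.congr' (by filter_upwards [he] with w hw using hw.symm)

theorem eq_zero (h : OrdGe u z 1) (hu : ContinuousAt u z) : u z = 0 :=
  tendsto_nhds_unique (hu.tendsto.mono_left (nhdsWithin_le_nhds (s := {z}ᶜ))) h.tendsto

theorem meromorphicOrderAt_ge (h : OrdGe u z m) :
    MeromorphicAt u z ∧ (m : WithTop ℤ) ≤ meromorphicOrderAt u z := by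
  obtain ⟨p, hp, he⟩ := h
  have hid : MeromorphicAt (fun w => w - z) z := by
    have : AnalyticAt ℂ (fun w => w - z) z := by fun_prop
    exact this.meromorphicAt
  have hmer : MeromorphicAt ((fun w => w - z) ^ m * p) z := (hid.zpow m).mul hp.meromorphicAt
  have he' : u =ᶠ[𝓝[≠] z] (fun w => w - z) ^ m * p := he
  refine ⟨hmer.congr he'.symm, ?_⟩
  rw [meromorphicOrderAt_congr he', meromorphicOrderAt_mul (hid.zpow m) hp.meromorphicAt]
  have h1 : meromorphicOrderAt ((fun w => w - z) ^ m) z = m := meromorphicOrderAt_zpow_id_sub_const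
  rw [h1]
  exact le_add_of_nonneg_right hp.meromorphicOrderAt_nonneg

end OrdGe

theorem analyticAt_ordGe_one {u : ℂ → ℂ} {z : ℂ} (hu : AnalyticAt ℂ u z) (h0 : u z = 0) :
    OrdGe u z 1 := by
  obtain ⟨p, hp⟩ := hu
  refine ⟨dslope u z, ⟨_, hp.has_fpower_series_dslope_fslope⟩, .of_forall fun w => ?_⟩
  have := sub_smul_dslope u z w
  rw [h0, sub_zero, smul_eq_mul] at this
  rw [zpow_one, this]

namespace OrdEq
variable {u v : ℂ → ℂ} {z : ℂ} {m k : ℤ}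

theorem mul (h : OrdEq u z m) (h' : OrdEq v z k) : OrdEq (u * v) z (m + k) := by
  obtain ⟨p, hp, hp0, he⟩ := h
  obtain ⟨q, hq, hq0, he'⟩ := h'
  refine ⟨p * q, hp.mul hq, mul_ne_zero hp0 hq0, ?_⟩
  filter_upwards [he, he', eventually_sub_ne_zero z] with w h1 h2 h3
  rw [Pi.mul_apply, Pi.mul_apply, h1, h2, zpow_add₀ h3]; ring

theorem inv (h : OrdEq u z m) : OrdEq u⁻¹ z (-m) := by
  obtain ⟨p, hp, hp0, he⟩ := h
  refine ⟨p⁻¹, hp.inv hp0, inv_ne_zero hp0, ?_⟩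
  filter_upwards [he] with w h1
  rw [Pi.inv_apply, h1, mul_inv, zpow_neg, Pi.inv_apply]

theorem prod {ι : Type*} {s : Finset ι} {u : ι → ℂ → ℂ} {m : ι → ℤ}
    (h : ∀ i ∈ s, OrdEq (u i) z (m i)) : OrdEq (∏ i ∈ s, u i) z (∑ i ∈ s, m i) := by
  classical
  induction s using Finset.induction_on with
  | empty => exact (analyticAt_const (v := (1 : ℂ))).ordEq one_ne_zero
  | insert i s hi ih =>
    rw [Finset.prod_insert hi, Finset.sum_insert hi]
    exact (h i (Finset.mem_insert_self i s)).mul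
      (ih fun j hj => h j (Finset.mem_insert_of_mem hj))

theorem le_of_ordGe (h : OrdEq u z m) (h' : OrdGe u z k) : k ≤ m := by
  by_contra! hlt
  obtain ⟨p, hp, hp0, he⟩ := h
  have h1 : OrdGe p z 1 := by
    have h2 : OrdGe (fun w => (w - z) ^ (-m)) z (-m) :=
      ⟨fun _ => 1, analyticAt_const, .of_forall fun w => (by simp)⟩
    have := h2.mul h'
    apply (this.mono (show (1 : ℤ) ≤ _ by omega)).congr
    filter_upwards [he, eventually_sub_ne_zero z] with w h1 h2
    rw [Pi.mul_apply, h1, zpow_neg]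
    field_simp
  exact hp0 (h1.eq_zero hp.continuousAt)

theorem logDeriv (h : OrdEq u z m) :
    OrdGe (fun w => logDeriv u w - m * (w - z)⁻¹) z 0 := by
  obtain ⟨p, hp, hp0, he⟩ := h
  refine ⟨fun w => deriv p w / p w, hp.deriv.div hp hp0, ?_⟩
  have h1 : ∀ᶠ w in 𝓝[≠] z, ∀ᶠ x in 𝓝 w, u x = (x - z) ^ m * p x :=
    eventually_nhds_of_eventually_nhdsNE he
  filter_upwards [h1, eventually_sub_ne_zero z,
    hp.eventually_analyticAt.filter_mono nhdsWithin_le_nhds,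
    (hp.continuousAt.eventually_ne hp0).filter_mono nhdsWithin_le_nhds] with w h1 h2 h3 h5
  have h4 : HasDerivAt (fun x => (x - z) ^ m * p x)
      ((m * (w - z) ^ (m - 1)) * p w + (w - z) ^ m * _root_.deriv p w) w := by
    have := (hasDerivAt_zpow m (w - z) (Or.inl h2)).comp w ((hasDerivAt_id w).sub_const z)
    rw [mul_one] at this
    exact this.mul h3.differentiableAt.hasDerivAt
  rw [logDeriv_apply, (show u =ᶠ[𝓝 w] _ from h1).deriv_eq, h4.deriv, h1.self_of_nhds,
    zpow_sub_one₀ h2]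
  have := zpow_ne_zero m h2
  field_simp
  ring

theorem logDeriv_ordGe (h : OrdEq u z m) : OrdGe (_root_.logDeriv u) z (-1) := by
  have h1 : OrdGe (fun w => m * (w - z)⁻¹) z (-1) :=
    ⟨fun _ => m, analyticAt_const, .of_forall fun w => by rw [zpow_neg_one, mul_comm]⟩
  refine (h.logDeriv.mono (by norm_num) |>.add h1).congr (.of_forall fun w => ?_)
  simp

end OrdEq

theorem exists_ordEq {u : ℂ → ℂ} (hu : Differentiable ℂ u) (h0 : u ≠ 0) (z : ℂ) :
    ∃ m : ℕ, OrdEq u z m := by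
  obtain ⟨m, v, hv, hv0, he⟩ := exists_eq_pow_mul_of_entire hu h0 z
  exact ⟨m, v, hv.analyticAt z, hv0, .of_forall fun w => by rw [zpow_natCast]; exact he w⟩

/-- Growth of degree at most `d` with respect to `exp Φ`. -/
def DegBdd (Φ : ℂ → ℝ) (d : ℕ) (A : ℂ → ℂ) : Prop :=
  ∃ a : ℝ, 0 ≤ a ∧ ∀ z, ‖A z‖ ≤ Real.exp (a + d * Φ z)

theorem DegBdd.mul {Φ : ℂ → ℝ} {d e : ℕ} {A B : ℂ → ℂ} (hA : DegBdd Φ d A) (hB : DegBdd Φ e B) :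
    DegBdd Φ (d + e) (A * B) := by
  obtain ⟨a, ha, hA⟩ := hA
  obtain ⟨b, hb, hB⟩ := hB
  refine ⟨a + b, add_nonneg ha hb, fun z => ?_⟩
  rw [Pi.mul_apply, norm_mul]
  refine (mul_le_mul (hA z) (hB z) (norm_nonneg _) (Real.exp_pos _).le).trans ?_
  rw [← Real.exp_add]
  apply Real.exp_le_exp.2
  push_cast
  linarith

theorem smallMer_iteratedDeriv_quot {A B M : ℂ → ℂ} {Φ : ℂ → ℝ} (hΦ : Continuous Φ)
    (hA : Differentiable ℂ A) (hB : Differentiable ℂ B) (hM : Differentiable ℂ M)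
    (hA0 : A ≠ 0) (hB0 : B ≠ 0) (hM0 : M ≠ 0) {d : ℕ} (hAM : DegBdd Φ d (A * M))
    (hBM : DegBdd Φ d (B * M)) (j : ℕ) :
    SmallMer Φ (fun z => iteratedDeriv j (fun w => A w / B w) z / (A z / B z)) := by
  obtain ⟨a, ha, hAM⟩ := hAM
  obtain ⟨b, hb, hBM⟩ := hBM
  have key := smallMer_iteratedDeriv_div hΦ (hA.mul hM) (hB.mul hM)
    (entire_mul_ne_zero hA hM hA0 hM0) (entire_mul_ne_zero hB hM hB0 hM0)
    (a := a + b) (d := d) (by positivity) (by positivity)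
    (fun z => (hAM z).trans (Real.exp_le_exp.2 (by linarith)))
    (fun z => (hBM z).trans (Real.exp_le_exp.2 (by linarith))) j
  have hAB : Meromorphic (fun z => A z / B z) := hA.meromorphic'.div hB.meromorphic'
  refine key.congr ((hAB.iteratedDeriv' j).div hAB) ?_
  filter_upwards [eventually_ne_zero_codiscrete hM hM0] with z hz
  have h1 : (fun w => (A * M) w / (B * M) w) =ᶠ[𝓝 z] fun w => A w / B w := by
    filter_upwards [hM.continuous.continuousAt.eventually_ne hz] with w hw
    exact mul_div_mul_right _ _ hw
  have h2 : (A * M) z / (B * M) z = A z / B z := h1.self_of_nhds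
  rw [h1.iteratedDeriv_eq j, h2]

theorem smallMer_logDeriv_quot {A B M : ℂ → ℂ} {Φ : ℂ → ℝ} (hΦ : Continuous Φ)
    (hA : Differentiable ℂ A) (hB : Differentiable ℂ B) (hM : Differentiable ℂ M)
    (hA0 : A ≠ 0) (hB0 : B ≠ 0) (hM0 : M ≠ 0) {d : ℕ} (hAM : DegBdd Φ d (A * M))
    (hBM : DegBdd Φ d (B * M)) :
    SmallMer Φ (logDeriv A - logDeriv B) := by
  have := smallMer_iteratedDeriv_quot hΦ hA hB hM hA0 hB0 hM0 hAM hBM 1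
  refine this.congr (hA.meromorphic'.logDeriv.sub hB.meromorphic'.logDeriv) ?_
  filter_upwards [eventually_ne_zero_codiscrete hA hA0, eventually_ne_zero_codiscrete hB hB0]
    with z hz hz'
  rw [iteratedDeriv_one, Pi.sub_apply, ← logDeriv_div z hz hz' (hA z) (hB z), logDeriv_apply]

/-- A Wronskian divided by the product of its entries. -/
def wronQuot {n : ℕ} (h : Fin n → ℂ → ℂ) (z : ℂ) : ℂ := wron h z / ∏ j, h j z

theorem smallMer_wronQuot {n : ℕ} {h : Fin n → ℂ → ℂ} {M : ℂ → ℂ} {Φ : ℂ → ℝ} (hΦ : Continuous Φ)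
    (hh : ∀ j, Differentiable ℂ (h j)) (hM : Differentiable ℂ M) (hh0 : ∀ j, h j ≠ 0) (hM0 : M ≠ 0)
    {d : ℕ} (hhM : ∀ j, DegBdd Φ d (h j * M)) : SmallMer Φ (wronQuot h) := by
  have hmer : Meromorphic (wronQuot h) := by
    have hp : Differentiable ℂ (fun z => ∏ j, h j z) := by
      apply Differentiable.fun_finsetProd
      exact fun j _ => hh j
    exact (wron_differentiable hh).meromorphic'.div hp.meromorphic'
  rcases Nat.eq_zero_or_pos n with rfl | hn
  · refine (SmallMer.const 1).congr hmer (.of_forall fun z => ?_)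
    simp [wronQuot, wron]
  set b : Fin n := ⟨0, hn⟩
  set u : Fin n → ℂ → ℂ := fun j w => h j w / h b w with hu
  have hsmall : SmallMer Φ (∑ σ : Equiv.Perm (Fin n), (fun _ => ((Equiv.Perm.sign σ : ℤ) : ℂ)) *
      ∏ i, fun z => iteratedDeriv (σ i) (u i) z / u i z) :=
    SmallMer.sum fun σ _ => (SmallMer.const _).mul <| SmallMer.prod fun i _ =>
      smallMer_iteratedDeriv_quot hΦ (hh i) (hh b) hM (hh0 i) (hh0 b) hM0 (hhM i) (hhM b) _
  refine hsmall.congr hmer ?_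
  filter_upwards [eventually_all.2 fun j => eventually_ne_zero_codiscrete (hh j) (hh0 j)] with z hz
  have hua : ∀ j, AnalyticAt ℂ (u j) z := fun j =>
    ((hh j).analyticAt z).div ((hh b).analyticAt z) (hz b)
  have h1 : wron h z = h b z ^ n * wron u z := by
    rw [← wron_mul ((hh b).analyticAt z) hua]
    apply wron_congr
    intro j
    filter_upwards [(hh b).continuous.continuousAt.eventually_ne (hz b)] with w hw
    simp only [hu, Pi.mul_apply]
    field_simp
  have h2 : ∏ j, h j z = h b z ^ n * ∏ j, u j z := by
    have : h b z ^ n = ∏ _j : Fin n, h b z := by simp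
    rw [this, ← Finset.prod_mul_distrib]
    refine Finset.prod_congr rfl fun j _ => ?_
    have := hz b
    simp only [hu]
    field_simp
  rw [wronQuot, h1, h2, mul_div_mul_left _ _ (pow_ne_zero n (hz b)), wron_eq_sum]
  simp only [Finset.sum_apply, Pi.mul_apply, Finset.prod_apply, Finset.prod_div_distrib,
    Finset.sum_div, mul_div_assoc]

section GenPos
variable {n q : ℕ} {H : Fin q → Fin (n + 1) → ℂ}

theorem GenPos.det_ne_zero (hH : GenPos n q H) {κ : Fin (n + 1) → Fin q}
    (hκ : Function.Injective κ) : (Matrix.of fun j => H (κ j)).det ≠ 0 := by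
  classical
  have h := hH (Finset.univ.image κ) (by
    rw [Finset.card_image_of_injective _ hκ, Finset.card_univ, Fintype.card_fin])
  have h' : LinearIndependent ℂ (Matrix.of fun j => H (κ j)).row := by
    have := h.comp (fun j : Fin (n + 1) => (⟨κ j, Finset.mem_image_of_mem κ (Finset.mem_univ j)⟩ :
      {x // x ∈ Finset.univ.image κ})) (fun a b hab => hκ (congrArg Subtype.val hab))
    exact this
  rw [Matrix.linearIndependent_rows_iff_isUnit, Matrix.isUnit_iff_isUnit_det] at h'
  exact h'.ne_zero

theorem GenPos.exists_norm_le (hH : GenPos n q H) :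
    ∃ K : ℝ, 0 < K ∧ ∀ κ : Fin (n + 1) → Fin q, Function.Injective κ → ∀ x : Fin (n + 1) → ℂ,
      ∀ δ : ℝ, 0 ≤ δ → (∀ j, ‖∑ i, H (κ j) i * x i‖ ≤ δ) → ‖x‖ ≤ K * δ := by
  have h : ∀ κ : Fin (n + 1) → Fin q, ∃ K : ℝ, 0 < K ∧ (Function.Injective κ →
      ∀ x : Fin (n + 1) → ℂ, ∀ δ : ℝ, 0 ≤ δ → (∀ j, ‖∑ i, H (κ j) i * x i‖ ≤ δ) → ‖x‖ ≤ K * δ) := by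
    intro κ
    by_cases hκ : Function.Injective κ
    · have hdet := hH.det_ne_zero hκ
      have hinj : Function.Injective (Matrix.of fun j => H (κ j)).mulVec :=
        Matrix.mulVec_injective_iff_isUnit.2 ((Matrix.isUnit_iff_isUnit_det _).2 hdet.isUnit)
      obtain ⟨K, hK, hKL⟩ := LinearMap.exists_antilipschitzWith
        (Matrix.mulVecLin (Matrix.of fun j => H (κ j))) (LinearMap.ker_eq_bot.2 hinj)
      refine ⟨K, hK, fun _ x δ hδ hx => ?_⟩
      have h1 := hKL.le_mul_dist x 0
      rw [map_zero, dist_zero_right, dist_zero_right] at h1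
      refine h1.trans (mul_le_mul_of_nonneg_left ?_ K.2)
      exact (pi_norm_le_iff_of_nonneg hδ).2 fun j => hx j
    · exact ⟨1, one_pos, fun h => absurd h hκ⟩
  choose K hK hKx using h
  refine ⟨∑ κ, K κ + 1, by have := Finset.sum_nonneg fun κ (_ : κ ∈ Finset.univ) => (hK κ).le; linarith,
    fun κ hκ x δ hδ hx => (hKx κ hκ x δ hδ hx).trans (mul_le_mul_of_nonneg_right ?_ hδ)⟩
  have := Finset.single_le_sum (fun κ _ => (hK κ).le) (Finset.mem_univ κ)
  linarith

theorem GenPos.exists_wron_bound (hH : GenPos n q H) {f : Fin (n + 1) → ℂ → ℂ}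
    (hf : ∀ i, Differentiable ℂ (f i)) (Q : Finset (Fin q)) {p : ℕ} (hQ : Q.card = n + 1 + p) :
    ∃ C : ℝ, 0 ≤ C ∧ ∀ z, (∀ k, lform (H k) f z ≠ 0) →
      ‖fun i => f i z‖ ^ p * ‖wron f z‖ ≤
        C * (∑ κ : Fin (n + 1) → Fin q, ‖wronQuot (fun j => lform (H (κ j)) f) z‖) *
          ∏ k ∈ Q, ‖lform (H k) f z‖ := by
  classical
  obtain ⟨K, hK, hKx⟩ := hH.exists_norm_le
  set D : (Fin (n + 1) → Fin q) → ℝ := fun κ => ‖(Matrix.of fun j => H (κ j)).det‖⁻¹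
  refine ⟨(2 * K) ^ p * ∑ κ, D κ, by positivity, fun z hz => ?_⟩
  set F := ‖fun i => f i z‖ with hF
  set B := Q.filter (fun k => 2 * K * ‖lform (H k) f z‖ < F) with hB
  have hBc : B.card ≤ n + 1 := by
    by_contra! hlt
    obtain ⟨s, hs, hsc⟩ := Finset.exists_subset_card_eq hlt.le
    have hsF : ∀ j, ‖lform (H (s.orderEmbOfFin hsc j)) f z‖ ≤ F / (2 * K) := by
      intro j
      have := (Finset.mem_filter.1 (hs (Finset.orderEmbOfFin_mem s hsc j))).2
      rw [le_div_iff₀ (by positivity)]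
      linarith
    have h1 := hKx (s.orderEmbOfFin hsc) (s.orderEmbOfFin hsc).injective (fun i => f i z) (F / (2 * K))
      (by positivity) hsF
    have h2 : K * (F / (2 * K)) = F / 2 := by field_simp
    rw [h2] at h1
    obtain ⟨k, hk⟩ := Finset.card_pos.1 (show 0 < B.card by omega)
    have h3 := (Finset.mem_filter.1 hk).2
    have h4 : 0 ≤ 2 * K * ‖lform (H k) f z‖ := by positivity
    have : F = ‖fun i => f i z‖ := hF
    linarith
  obtain ⟨s, hBs, hsQ, hsc⟩ := Finset.exists_subsuperset_card_eq (Finset.filter_subset _ Q) hBc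
    (by omega)
  set κ := s.orderEmbOfFin hsc with hκ
  have hdet := hH.det_ne_zero κ.injective
  have hW : wron (fun j => lform (H (κ j)) f) z = (Matrix.of fun j => H (κ j)).det * wron f z :=
    wron_linear_comb hf (fun j => H (κ j)) z
  have hprod : ∏ j, lform (H (κ j)) f z = ∏ k ∈ s, lform (H k) f z := by
    have himg : Finset.univ.image κ = s := by
      apply Finset.coe_injective
      rw [Finset.coe_image, Finset.coe_univ, Set.image_univ, Finset.range_orderEmbOfFin]
    rw [← himg, Finset.prod_image (fun a _ b _ h => κ.injective h)]
  have hs0 : ∏ k ∈ s, ‖lform (H k) f z‖ ≠ 0 :=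
    Finset.prod_ne_zero_iff.2 fun k _ => norm_ne_zero_iff.2 (hz k)
  have hWn : ‖wron f z‖ = D κ * ‖wronQuot (fun j => lform (H (κ j)) f) z‖ *
      ∏ k ∈ s, ‖lform (H k) f z‖ := by
    have hdn := norm_ne_zero_iff.2 hdet
    simp only [wronQuot, D]
    rw [hprod, hW, norm_div, norm_mul, norm_prod]
    field_simp
  have hFp : F ^ p ≤ (2 * K) ^ p * ∏ k ∈ Q \ s, ‖lform (H k) f z‖ := by
    have hc : (Q \ s).card = p := by rw [Finset.card_sdiff_of_subset hsQ]; omega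
    rw [← hc, ← Finset.prod_const, ← Finset.prod_const, ← Finset.prod_mul_distrib]
    apply Finset.prod_le_prod
    · exact fun _ _ => norm_nonneg _
    · intro k hk
      rw [Finset.mem_sdiff] at hk
      by_contra! hlt
      exact hk.2 (hBs (Finset.mem_filter.2 ⟨hk.1, hlt⟩))
  have hV : ‖wronQuot (fun j => lform (H (κ j)) f) z‖ ≤
      ∑ κ : Fin (n + 1) → Fin q, ‖wronQuot (fun j => lform (H (κ j)) f) z‖ :=
    Finset.single_le_sum (f := fun κ : Fin (n + 1) → Fin q =>
      ‖wronQuot (fun j => lform (H (κ j)) f) z‖) (fun _ _ => norm_nonneg _) (Finset.mem_univ ⇑κ)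
  have hD : D κ ≤ ∑ κ, D κ :=
    Finset.single_le_sum (f := D) (fun κ _ => inv_nonneg.2 (norm_nonneg _)) (Finset.mem_univ ⇑κ)
  set S := ∑ κ : Fin (n + 1) → Fin q, ‖wronQuot (fun j => lform (H (κ j)) f) z‖
  have hD0 : 0 ≤ D κ := inv_nonneg.2 (norm_nonneg _)
  have hS0 : 0 ≤ S := Finset.sum_nonneg fun _ _ => norm_nonneg _
  have hDV : D κ * ‖wronQuot (fun j => lform (H (κ j)) f) z‖ ≤ (∑ κ, D κ) * S :=
    mul_le_mul hD hV (norm_nonneg _) (hD0.trans hD)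
  have hps : 0 ≤ ∏ k ∈ s, ‖lform (H k) f z‖ := Finset.prod_nonneg fun _ _ => norm_nonneg _
  rw [← Finset.prod_sdiff hsQ, hWn]
  calc F ^ p * (D κ * ‖wronQuot (fun j => lform (H (κ j)) f) z‖ * ∏ k ∈ s, ‖lform (H k) f z‖)
      ≤ ((2 * K) ^ p * ∏ k ∈ Q \ s, ‖lform (H k) f z‖) *
        ((∑ κ, D κ) * S * ∏ k ∈ s, ‖lform (H k) f z‖) := by
        apply mul_le_mul hFp (mul_le_mul_of_nonneg_right hDV hps)
        · positivity
        · positivity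
    _ = _ := by ring

theorem GenPos.wron_ordGe (hH : GenPos n q H) {f : Fin (n + 1) → ℂ → ℂ}
    (hf : ∀ i, Differentiable ℂ (f i)) (hq : n + 1 ≤ q) (k : Fin q) {z : ℂ} {m : ℤ}
    (hm : OrdGe (lform (H k) f) z m) : OrdGe (wron f) z (m - n) := by
  classical
  obtain ⟨s, hks, hsc⟩ : ∃ s : Finset (Fin q), k ∈ s ∧ s.card = n + 1 := by
    obtain ⟨s, hs, -, hc⟩ := Finset.exists_subsuperset_card_eq (Finset.subset_univ {k})
      (n := n + 1) (by simp) (by simpa using hq)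
    exact ⟨s, hs (Finset.mem_singleton_self k), hc⟩
  set κ := s.orderEmbOfFin hsc
  obtain ⟨j₀, hj₀⟩ : ∃ j, κ j = k := by
    have : k ∈ Set.range κ := by rw [Finset.range_orderEmbOfFin]; exact hks
    exact this
  have hdet := hH.det_ne_zero κ.injective
  have hd : ∀ k, Differentiable ℂ (lform (H k) f) := by
    intro k
    apply Differentiable.fun_sum
    exact fun j _ => (hf j).const_mul _
  have h1 : OrdGe (wron (fun j => lform (H (κ j)) f)) z (m - n) := by
    rw [wron_eq_sum]
    refine OrdGe.sum fun σ _ => ?_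
    have h2 : OrdGe (∏ i, iteratedDeriv (σ i) (lform (H (κ i)) f)) z (m - n) := by
      rw [← Finset.mul_prod_erase _ _ (Finset.mem_univ j₀)]
      have h3 : OrdGe (iteratedDeriv (σ j₀) (lform (H (κ j₀)) f)) z (m - n) := by
        rw [hj₀]
        exact (hm.iteratedDeriv _).mono (by have := (σ j₀).2; omega)
      have h4 : OrdGe (∏ i ∈ Finset.univ.erase j₀, iteratedDeriv (σ i) (lform (H (κ i)) f)) z 0 := by
        have := OrdGe.prod (s := Finset.univ.erase j₀) (m := fun _ => 0)
          (u := fun i => iteratedDeriv (σ i) (lform (H (κ i)) f)) (z := z)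
          (fun i _ => ((iteratedDeriv_differentiable (hd (κ i)) _).analyticAt z).ordGe)
        simpa using this
      simpa using h3.mul h4
    simpa using ((analyticAt_const (v := (((Equiv.Perm.sign σ : ℤ) : ℂ)))).ordGe).mul h2
  have h2 := ((analyticAt_const (v := (Matrix.of fun j => H (κ j)).det⁻¹)).ordGe (z := z)).mul h1
  rw [zero_add] at h2
  refine h2.congr (.of_forall fun w => ?_)
  have hW : wron (fun j => lform (H (κ j)) f) w = (Matrix.of fun j => H (κ j)).det * wron f w :=
    wron_linear_comb hf (fun j => H (κ j)) w
  rw [Pi.mul_apply, hW, inv_mul_cancel_left₀ hdet]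

end GenPos

theorem SmallMer.of_norm_le {Φ : ℂ → ℝ} {ι : Type*} [Fintype ι] {u : ℂ → ℂ} {v : ι → ℂ → ℂ}
    (hu : Meromorphic u) (hv : ∀ i, SmallMer Φ (v i)) {C : ℝ}
    (h : ∀ᶠ z in codiscrete ℂ, ‖u z‖ ≤ C * ∑ i, ‖v i z‖) : SmallMer Φ u := by
  classical
  have hsum : ∀ s : Finset ι, Negl Φ (fun r => ∑ i ∈ s, ValueDistribution.proximity (v i) ⊤ r) := by
    intro s
    induction s using Finset.induction_on with
    | empty => simpa using Negl.const Φ 0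
    | insert i s hi ih =>
      simp only [Finset.sum_insert hi]
      exact (hv i).negl.add ih
  set c := Real.posLog C + Real.log (Finset.univ : Finset ι).card
  refine ⟨hu, ((Negl.const Φ c).add (hsum Finset.univ)).mono ?_⟩
  filter_upwards [SmallMer.eventually_ne_zero_goodFilter (Φ := Φ)] with r hr
  simp only [ValueDistribution.proximity_top, Pi.add_apply]
  have hi : ∀ i ∈ Finset.univ, CircleIntegrable (fun z => Real.posLog ‖v i z‖) 0 r :=
    fun i _ => circleIntegrable_posLog_norm_of_meromorphic (hv i).mer r
  rw [← Real.circleAverage_fun_sum hi, ← Real.circleAverage_const c 0 r]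
  have hs : CircleIntegrable (fun z => ∑ i, Real.posLog ‖v i z‖) 0 r := CircleIntegrable.fun_sum _ hi
  have hc : CircleIntegrable (fun _ : ℂ => c) 0 r := circleIntegrable_const c 0 r
  have ha := Real.circleAverage_add hc hs
  rw [← ha]
  refine circleAverage_mono_codiscrete hr (circleIntegrable_posLog_norm_of_meromorphic hu r)
    (hc.add hs) ?_
  filter_upwards [h] with z hz
  refine (Real.posLog_le_posLog (norm_nonneg _) hz).trans ?_
  refine Real.posLog_mul.trans ?_
  have := Real.posLog_sum Finset.univ (fun i => ‖v i z‖)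
  simp only [Pi.add_apply, c]
  linarith

/-- The mixed minors `fᵢ gⱼ - fⱼ gᵢ`. -/
def pairMinor {ι : Type*} (f g : ι → ℂ → ℂ) (i j : ι) : ℂ → ℂ := f i * g j - f j * g i

theorem pairMinor_apply {ι : Type*} (f g : ι → ℂ → ℂ) (i j : ι) (z : ℂ) :
    pairMinor f g i j z = f i z * g j z - f j z * g i z := rfl

theorem pairMinor_differentiable {ι : Type*} {f g : ι → ℂ → ℂ} (hf : ∀ i, Differentiable ℂ (f i))
    (hg : ∀ i, Differentiable ℂ (g i)) (i j : ι) : Differentiable ℂ (pairMinor f g i j) :=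
  ((hf i).mul (hg j)).sub ((hf j).mul (hg i))

/-- The logarithmic size of a pair of tuples of functions. -/
def logSize {n : ℕ} (f g : Fin (n + 1) → ℂ → ℂ) (z : ℂ) : ℝ :=
  Real.log ‖fun i => f i z‖ + Real.log ‖fun i => g i z‖

theorem exp_logSize {n : ℕ} {f g : Fin (n + 1) → ℂ → ℂ} (hf : ReducedRepr n f)
    (hg : ReducedRepr n g) (z : ℂ) :
    Real.exp (logSize f g z) = ‖fun i => f i z‖ * ‖fun i => g i z‖ := by
  have h : ∀ {f : Fin (n + 1) → ℂ → ℂ}, ReducedRepr n f → 0 < ‖fun i => f i z‖ := fun hf => by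
    obtain ⟨i, hi⟩ := hf.2 z
    exact norm_pos_iff.2 fun h => hi (congrFun h i)
  rw [logSize, Real.exp_add, Real.exp_log (h hf), Real.exp_log (h hg)]

theorem continuous_logSize {n : ℕ} {f g : Fin (n + 1) → ℂ → ℂ} (hf : ReducedRepr n f)
    (hg : ReducedRepr n g) : Continuous (logSize f g) := by
  have h : ∀ {f : Fin (n + 1) → ℂ → ℂ}, ReducedRepr n f →
      Continuous fun z => Real.log ‖fun i => f i z‖ := fun hf => by
    refine Continuous.log (continuous_pi fun i => (hf.1 i).continuous).norm fun z => ?_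
    obtain ⟨i, hi⟩ := hf.2 z
    exact norm_ne_zero_iff.2 fun h => hi (congrFun h i)
  exact (h hf).add (h hg)

theorem norm_lform_le {n : ℕ} (a : Fin (n + 1) → ℂ) (f : Fin (n + 1) → ℂ → ℂ) (z : ℂ) :
    ‖lform a f z‖ ≤ (∑ i, ‖a i‖) * ‖fun i => f i z‖ := by
  rw [lform, Finset.sum_mul]
  refine norm_sum_le_of_le _ fun i _ => ?_
  rw [norm_mul]
  exact mul_le_mul_of_nonneg_left (norm_le_pi_norm (fun i => f i z) i) (norm_nonneg _)

theorem lform_differentiable {n : ℕ} (a : Fin (n + 1) → ℂ) {f : Fin (n + 1) → ℂ → ℂ}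
    (hf : ∀ i, Differentiable ℂ (f i)) : Differentiable ℂ (lform a f) := by
  apply Differentiable.fun_sum
  exact fun j _ => (hf j).const_mul _

theorem degBdd_lform_mul {n : ℕ} {f g : Fin (n + 1) → ℂ → ℂ} (hf : ReducedRepr n f)
    (hg : ReducedRepr n g) (a b : Fin (n + 1) → ℂ) :
    DegBdd (logSize f g) 1 (lform a f * lform b g) := by
  set c := 1 + (∑ i, ‖a i‖) * ∑ i, ‖b i‖
  have hc0 : 0 ≤ (∑ i, ‖a i‖) * ∑ i, ‖b i‖ := by positivity
  have hc : 1 ≤ c := by simp only [c]; linarith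
  refine ⟨Real.log c, Real.log_nonneg hc, fun z => ?_⟩
  rw [Nat.cast_one, one_mul, Real.exp_add, Real.exp_log (by linarith), exp_logSize hf hg,
    Pi.mul_apply, norm_mul]
  calc ‖lform a f z‖ * ‖lform b g z‖
      ≤ ((∑ i, ‖a i‖) * ‖fun i => f i z‖) * ((∑ i, ‖b i‖) * ‖fun i => g i z‖) :=
        mul_le_mul (norm_lform_le a f z) (norm_lform_le b g z) (norm_nonneg _) (by positivity)
    _ = ((∑ i, ‖a i‖) * ∑ i, ‖b i‖) * (‖fun i => f i z‖ * ‖fun i => g i z‖) := by ring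
    _ ≤ _ := mul_le_mul_of_nonneg_right (by simp only [c]; linarith) (by positivity)

theorem GenPos.smallMer_minorWron {n q : ℕ} {H : Fin q → Fin (n + 1) → ℂ} (hH : GenPos n q H)
    {f g : Fin (n + 1) → ℂ → ℂ} (hf : ReducedRepr n f) (hg : ReducedRepr n g)
    (hf0 : ∀ k, lform (H k) f ≠ 0) (hg0 : ∀ k, lform (H k) g ≠ 0)
    (e : Fin (n + 1) × Fin 2 ≃ Fin q) :
    SmallMer (logSize f g) (fun z =>
      (∏ t, pairMinor (fun k => lform (H k) f) (fun k => lform (H k) g) (e (t, 0)) (e (t, 1)) z) *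
        (wron f z * wron g z) / ∏ k, (lform (H k) f z * lform (H k) g z)) := by
  have hq : q = n + 1 + (n + 1) := by
    have := Fintype.card_congr e
    simp only [Fintype.card_prod, Fintype.card_fin] at this
    omega
  have hΦ := continuous_logSize hf hg
  have hdf := fun k => lform_differentiable (H k) hf.1
  have hdg := fun k => lform_differentiable (H k) hg.1
  set F := fun k => lform (H k) f with hF
  set G := fun k => lform (H k) g with hG
  have hmer : Meromorphic (fun z => (∏ t, pairMinor F G (e (t, 0)) (e (t, 1)) z) *
        (wron f z * wron g z) / ∏ k, (F k z * G k z)) := by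
    have h1 : Differentiable ℂ fun z => ∏ t, pairMinor F G (e (t, 0)) (e (t, 1)) z := by
      apply Differentiable.fun_finsetProd
      exact fun t _ => pairMinor_differentiable hdf hdg _ _
    have h2 : Differentiable ℂ fun z => ∏ k, (F k z * G k z) := by
      apply Differentiable.fun_finsetProd
      exact fun t _ => (hdf t).mul (hdg t)
    exact (h1.mul ((wron_differentiable hf.1).mul (wron_differentiable hg.1))).meromorphic'.div
      h2.meromorphic'
  obtain ⟨C, hC, hCf⟩ := hH.exists_wron_bound hf.1 Finset.univ (p := n + 1) (by simpa using hq)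
  obtain ⟨D, hD, hDg⟩ := hH.exists_wron_bound hg.1 Finset.univ (p := n + 1) (by simpa using hq)
  have k0 : Fin q := ⟨0, by omega⟩
  set c := ∑ k, ∑ i, ‖H k i‖
  have hc : ∀ (k : Fin q) (f : Fin (n + 1) → ℂ → ℂ) z, ‖lform (H k) f z‖ ≤ c * ‖fun i => f i z‖ := by
    intro k f z
    refine (norm_lform_le (H k) f z).trans (mul_le_mul_of_nonneg_right ?_ (norm_nonneg _))
    exact Finset.single_le_sum (f := fun k => ∑ i, ‖H k i‖)
      (fun k _ => Finset.sum_nonneg fun i _ => norm_nonneg _) (Finset.mem_univ k)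
  have hc0 : 0 ≤ c := Finset.sum_nonneg fun k _ => Finset.sum_nonneg fun i _ => norm_nonneg _
  refine SmallMer.of_norm_le (ι := (Fin (n + 1) → Fin q) × (Fin (n + 1) → Fin q))
    (v := fun κ => wronQuot (fun j => F (κ.1 j)) * wronQuot (fun j => G (κ.2 j)))
    hmer (fun κ => ?_) (C := (2 * c ^ 2) ^ (n + 1) * (C * D)) ?_
  · refine (smallMer_wronQuot (M := G k0) (d := 1) hΦ (fun j => hdf _) (hdg _) (fun j => hf0 _)
      (hg0 _) fun j => degBdd_lform_mul hf hg _ _).mul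
      (smallMer_wronQuot (M := F k0) (d := 1) hΦ (fun j => hdg _) (hdf _) (fun j => hg0 _)
      (hf0 _) fun j => ?_)
    rw [mul_comm]
    exact degBdd_lform_mul hf hg _ _
  · filter_upwards [eventually_all.2 fun k => eventually_ne_zero_codiscrete (hdf k) (hf0 k),
      eventually_all.2 fun k => eventually_ne_zero_codiscrete (hdg k) (hg0 k)] with z hz hz'
    have h1 := hCf z hz
    have h2 := hDg z hz'
    set a := ‖fun i => f i z‖
    set b := ‖fun i => g i z‖
    set S := ∑ κ : Fin (n + 1) → Fin q, ‖wronQuot (fun j => F (κ j)) z‖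
    set S' := ∑ κ : Fin (n + 1) → Fin q, ‖wronQuot (fun j => G (κ j)) z‖
    have h3 : ‖∏ t, pairMinor F G (e (t, 0)) (e (t, 1)) z‖ ≤ (2 * c ^ 2) ^ (n + 1) * (a ^ (n + 1) * b ^ (n + 1)) := by
      rw [norm_prod, ← mul_pow, ← mul_pow]
      have : ∀ t ∈ (Finset.univ : Finset (Fin (n + 1))),
          ‖pairMinor F G (e (t, 0)) (e (t, 1)) z‖ ≤ 2 * c ^ 2 * (a * b) := by
        intro t _
        rw [pairMinor_apply]
        have : ∀ i j, ‖F i z * G j z‖ ≤ c * a * (c * b) := fun i j => by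
          rw [norm_mul]
          exact mul_le_mul (hc i f z) (hc j g z) (norm_nonneg _) (by positivity)
        calc _ ≤ _ := norm_sub_le _ _
          _ ≤ c * a * (c * b) + c * a * (c * b) := add_le_add (this _ _) (this _ _)
          _ = _ := by ring
      refine (Finset.prod_le_prod (fun _ _ => norm_nonneg _) this).trans ?_
      simp
    have h4 : ∑ κ : (Fin (n + 1) → Fin q) × (Fin (n + 1) → Fin q),
        ‖(wronQuot (fun j => F (κ.1 j)) * wronQuot (fun j => G (κ.2 j))) z‖ = S * S' := by
      rw [Fintype.sum_prod_type, Finset.sum_mul_sum]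
      simp
    have h5 : ‖∏ k, (F k z * G k z)‖ = (∏ k, ‖F k z‖) * ∏ k, ‖G k z‖ := by
      simp [Finset.prod_mul_distrib]
    have hp : 0 < (∏ k, ‖F k z‖) * ∏ k, ‖G k z‖ :=
      mul_pos (Finset.prod_pos fun k _ => norm_pos_iff.2 (hz k))
        (Finset.prod_pos fun k _ => norm_pos_iff.2 (hz' k))
    rw [h4, norm_div, h5, div_le_iff₀ hp, norm_mul, norm_mul]
    have hS : 0 ≤ S := Finset.sum_nonneg fun _ _ => norm_nonneg _
    have hpF : 0 ≤ ∏ k, ‖F k z‖ := Finset.prod_nonneg fun _ _ => norm_nonneg _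
    calc _ ≤ (2 * c ^ 2) ^ (n + 1) * (a ^ (n + 1) * b ^ (n + 1)) * (‖wron f z‖ * ‖wron g z‖) :=
          mul_le_mul_of_nonneg_right h3 (by positivity)
      _ = (2 * c ^ 2) ^ (n + 1) * ((a ^ (n + 1) * ‖wron f z‖) * (b ^ (n + 1) * ‖wron g z‖)) := by ring
      _ ≤ (2 * c ^ 2) ^ (n + 1) * ((C * S * ∏ k, ‖F k z‖) * (D * S' * ∏ k, ‖G k z‖)) := by
          apply mul_le_mul_of_nonneg_left _ (by positivity)
          exact mul_le_mul h1 h2 (by positivity) (by positivity)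
      _ = _ := by ring

theorem eq_of_eventuallyEq_codiscrete {u v : ℂ → ℂ} (hu : Continuous u) (hv : Continuous v)
    (h : u =ᶠ[codiscrete ℂ] v) : u = v := by
  funext z
  have h1 := eventually_codiscrete_iff.1 h z
  have hu1 : Tendsto u (𝓝[≠] z) (𝓝 (u z)) := hu.continuousAt.tendsto.mono_left nhdsWithin_le_nhds
  have hv1 : Tendsto v (𝓝[≠] z) (𝓝 (v z)) := hv.continuousAt.tendsto.mono_left nhdsWithin_le_nhds
  exact tendsto_nhds_unique (hu1.congr' h1) hv1

theorem exists_perm_comp_eq {ι β : Type*} [Finite ι] {u v : β → ι} (hu : Function.Injective u)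
    (hv : Function.Injective v) : ∃ σ : Equiv.Perm ι, ∀ x, σ (u x) = v x := by
  classical
  refine ⟨((Equiv.ofInjective u hu).symm.trans (Equiv.ofInjective v hv)).extendSubtype, fun x => ?_⟩
  rw [Equiv.extendSubtype_apply_of_mem _ (u x) ⟨x, rfl⟩]
  have : (⟨u x, ⟨x, rfl⟩⟩ : Set.range u) = Equiv.ofInjective u hu x := rfl
  simp only [Equiv.trans_apply]
  rw [this, Equiv.symm_apply_apply]
  rfl

section
variable {ι : Type*} [Fintype ι]

/-- A product of mixed minors over a perfect pairing of the indices, times `V`, divided by the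
product of all the forms. -/
def minorWron {N : ℕ} (f g : ι → ℂ → ℂ) (V : ℂ → ℂ) (e : Fin (N + 1) × Fin 2 ≃ ι) : ℂ → ℂ :=
  (∏ t, pairMinor f g (e (t, 0)) (e (t, 1))) * V * (∏ k, f k * g k)⁻¹

/-- Two families of entire functions, having common zeros and separated zero sets, together with
the estimates coming from their Wronskians. -/
structure SharedForms (Φ : ℂ → ℝ) (N : ℕ) (f g : ι → ℂ → ℂ) (V : ℂ → ℂ) : Prop where
  cont : Continuous Φ
  df : ∀ i, Differentiable ℂ (f i)
  dg : ∀ i, Differentiable ℂ (g i)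
  dV : Differentiable ℂ V
  f0 : ∀ i, f i ≠ 0
  g0 : ∀ i, g i ≠ 0
  V0 : V ≠ 0
  sep : ∀ i j z, f i z = 0 → f j z = 0 → i = j
  common : ∀ i z, f i z = 0 ↔ g i z = 0
  minor_zero : ∀ k z, f k z = 0 → ∀ i j, pairMinor f g i j z = 0
  minor_ne : ∀ i j, i ≠ j → pairMinor f g i j ≠ 0
  bdd : ∀ i j, DegBdd Φ 1 (f i * g j)
  V_ord : ∀ k z (a b : ℕ), OrdGe (f k) z a → OrdGe (g k) z b →
    OrdGe V z (max 0 (a - N) + max 0 (b - N))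
  small : ∀ e : Fin (N + 1) × Fin 2 ≃ ι, SmallMer Φ (minorWron f g V e)

namespace SharedForms
variable {Φ : ℂ → ℝ} {N : ℕ} {f g : ι → ℂ → ℂ} {V : ℂ → ℂ}

theorem dP (h : SharedForms Φ N f g V) (i j : ι) : Differentiable ℂ (pairMinor f g i j) :=
  pairMinor_differentiable h.df h.dg i j

theorem minorWron_div_ordGe_of_ne (h : SharedForms Φ N f g V) (e : Fin (N + 1) × Fin 2 ≃ ι)
    (t : Fin (N + 1)) {z : ℂ} (hz : ∀ k, f k z ≠ 0) :
    OrdGe (minorWron f g V e * (pairMinor f g (e (t, 0)) (e (t, 1)))⁻¹) z 0 := by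
  classical
  have hP0 : pairMinor f g (e (t, 0)) (e (t, 1)) ≠ 0 :=
    h.minor_ne _ _ (by simp)
  have h1 : OrdEq (∏ k, f k * g k) z (∑ k : ι, (0 + 0)) := OrdEq.prod fun k _ =>
    (((h.df k).analyticAt z).ordEq (hz k)).mul
      (((h.dg k).analyticAt z).ordEq fun hk => hz k ((h.common k z).2 hk))
  have h2 : OrdGe (∏ s ∈ Finset.univ.erase t, pairMinor f g (e (s, 0)) (e (s, 1))) z
      (∑ s ∈ Finset.univ.erase t, 0) := OrdGe.prod fun s _ => ((h.dP _ _).analyticAt z).ordGe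
  have h3 := (h2.mul ((h.dV.analyticAt z).ordGe)).mul h1.inv.ordGe
  refine (h3.mono (by simp)).congr ?_
  filter_upwards [eventually_codiscrete_iff.1 (eventually_ne_zero_codiscrete (h.dP _ _) hP0) z]
    with w hw
  simp only [minorWron, Pi.mul_apply, Pi.inv_apply]
  rw [← Finset.mul_prod_erase _ _ (Finset.mem_univ t), Pi.mul_apply]
  field_simp

theorem minorWron_div_ordGe (h : SharedForms Φ N f g V) (e : Fin (N + 1) × Fin 2 ≃ ι)
    (t : Fin (N + 1)) {z : ℂ} {k : ι} {a b : ℕ} (hz : f k z = 0) (ha : OrdEq (f k) z a)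
    (hb : OrdEq (g k) z b) :
    OrdGe (minorWron f g V e * (pairMinor f g (e (t, 0)) (e (t, 1)))⁻¹) z
      (if (e.symm k).1 = t then -min (a : ℤ) b else -1) := by
  classical
  have hP0 : pairMinor f g (e (t, 0)) (e (t, 1)) ≠ 0 :=
    h.minor_ne _ _ (by simp)
  have ha1 : (1 : ℤ) ≤ a := ha.le_of_ordGe (analyticAt_ordGe_one ((h.df k).analyticAt z) hz)
  have hb1 : (1 : ℤ) ≤ b :=
    hb.le_of_ordGe (analyticAt_ordGe_one ((h.dg k).analyticAt z) ((h.common k z).1 hz))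
  have h1 : OrdEq (∏ i, f i * g i) z (a + b) := by
    have := OrdEq.prod (s := Finset.univ) (u := fun i => f i * g i) (z := z)
      (m := fun i => if i = k then (a + b : ℤ) else 0) fun i _ => by
        by_cases hi : i = k
        · subst hi
          simpa using ha.mul hb
        · simp only [hi, if_false]
          have hfi : f i z ≠ 0 := fun h0 => hi (h.sep _ _ _ h0 hz)
          exact (((h.df i).analyticAt z).ordEq hfi).mul
            (((h.dg i).analyticAt z).ordEq fun hk => hfi ((h.common i z).2 hk))
    simpa using this
  set tk := (e.symm k).1
  have hP : ∀ s, OrdGe (pairMinor f g (e (s, 0)) (e (s, 1))) z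
      (if s = tk then min (a : ℤ) b else 1) := by
    intro s
    split_ifs with hs
    · have key : ∀ i j, (i = k ∨ j = k) → OrdGe (pairMinor f g i j) z (min (a : ℤ) b) := by
        have han : ∀ i, OrdGe (f i) z 0 := fun i => ((h.df i).analyticAt z).ordGe
        have hbn : ∀ i, OrdGe (g i) z 0 := fun i => ((h.dg i).analyticAt z).ordGe
        rintro i j (rfl | rfl)
        · exact ((ha.ordGe.mul (hbn j)).mono (by simp)).sub (((han j).mul hb.ordGe).mono (by simp))
        · exact (((han i).mul hb.ordGe).mono (by simp)).sub ((ha.ordGe.mul (hbn i)).mono (by simp))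
      apply key
      have h4 : e (s, (e.symm k).2) = k := by
        rw [hs]
        exact e.apply_symm_apply k
      rcases Fin.exists_fin_two.1 ⟨(e.symm k).2, rfl⟩ with h5 | h5
      · left; rwa [h5] at h4
      · right; rwa [h5] at h4
    · exact analyticAt_ordGe_one ((h.dP _ _).analyticAt z) (h.minor_zero k z hz _ _)
  have h2 := OrdGe.prod (s := Finset.univ.erase t) fun s _ => hP s
  have hsum : ∑ s ∈ Finset.univ.erase t, (if s = tk then min (a : ℤ) b else 1) =
      N + min (a : ℤ) b - (if t = tk then min (a : ℤ) b else 1) := by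
    rw [Finset.sum_erase_eq_sub (Finset.mem_univ t)]
    congr 1
    have : ∀ s, (if s = tk then min (a : ℤ) b else 1) = 1 + (if s = tk then min (a : ℤ) b - 1 else 0) := by
      intro s; split_ifs <;> ring
    simp only [this, Finset.sum_add_distrib]
    simp
  have h3 := (h2.mul (h.V_ord k z a b ha.ordGe hb.ordGe)).mul h1.inv.ordGe
  rw [hsum] at h3
  refine (h3.mono ?_).congr ?_
  · by_cases htk : t = tk
    · rw [if_pos htk, if_pos htk.symm]; omega
    · rw [if_neg htk, if_neg (Ne.symm htk)]; omega
  filter_upwards [eventually_codiscrete_iff.1 (eventually_ne_zero_codiscrete (h.dP _ _) hP0) z]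
    with w hw
  simp only [minorWron, Pi.mul_apply, Pi.inv_apply]
  rw [← Finset.mul_prod_erase _ _ (Finset.mem_univ t), Pi.mul_apply]
  field_simp

theorem exists_smallRing_eq_minorWron (h : SharedForms Φ N f g V) (hN : 1 ≤ N)
    (e : Fin (N + 1) × Fin 2 ≃ ι) :
    ∃ u ∈ smallRing Φ, u ≠ 0 ∧ ∀ z, minorWron f g V e =ᶠ[𝓝[≠] z] u := by
  classical
  have hord : ∀ z, OrdGe (minorWron f g V e) z 0 := by
    intro z
    have main : ∃ t m, OrdGe (pairMinor f g (e (t, 0)) (e (t, 1))) z m ∧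
        OrdGe (minorWron f g V e * (pairMinor f g (e (t, 0)) (e (t, 1)))⁻¹) z (-m) := by
      by_cases hz : ∀ k, f k z ≠ 0
      · exact ⟨0, 0, ((h.dP _ _).analyticAt z).ordGe, h.minorWron_div_ordGe_of_ne e 0 hz⟩
      · push Not at hz
        obtain ⟨k, hk⟩ := hz
        obtain ⟨a, ha⟩ := exists_ordEq (h.df k) (h.f0 k) z
        obtain ⟨b, hb⟩ := exists_ordEq (h.dg k) (h.g0 k) z
        have : Nontrivial (Fin (N + 1)) := Fin.nontrivial_iff_two_le.2 (by omega)
        obtain ⟨t, ht⟩ := exists_ne (e.symm k).1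
        refine ⟨t, 1, analyticAt_ordGe_one ((h.dP _ _).analyticAt z) (h.minor_zero k z hk _ _), ?_⟩
        have := h.minorWron_div_ordGe e t hk ha hb
        rwa [if_neg ht.symm] at this
    obtain ⟨t, m, h1, h2⟩ := main
    refine ((h2.mul h1).mono (by simp)).congr ?_
    filter_upwards [eventually_codiscrete_iff.1
      (eventually_ne_zero_codiscrete (h.dP _ _) (h.minor_ne (e (t, 0)) (e (t, 1)) (by simp))) z] with w hw
    simp only [Pi.mul_apply, Pi.inv_apply]
    field_simp
  obtain ⟨u, hu, huc, hun, -⟩ := exists_entire_of_order_nonneg (h.small e).mer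
    fun z => by simpa using (hord z).meromorphicOrderAt_ge.2
  refine ⟨u, ⟨hu, (h.small e).congr hu.meromorphic' huc⟩, ?_, hun⟩
  rintro rfl
  obtain ⟨z, ⟨⟨hz, hz1⟩, hz2⟩, hz3⟩ := (((huc.and (eventually_ne_zero_codiscrete h.dV h.V0)).and
    (eventually_all.2 fun t => eventually_ne_zero_codiscrete (h.dP (e (t, 0)) (e (t, 1)))
      (h.minor_ne _ _ (by simp)))).and (eventually_all.2 fun k =>
        eventually_ne_zero_codiscrete ((h.df k).mul (h.dg k))
          (entire_mul_ne_zero (h.df k) (h.dg k) (h.f0 k) (h.g0 k)))).exists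
  refine absurd hz (mul_ne_zero (mul_ne_zero ?_ hz1) (inv_ne_zero ?_))
  · rw [Finset.prod_apply]; exact Finset.prod_ne_zero_iff.2 fun t _ => hz2 t
  · rw [Finset.prod_apply]; exact Finset.prod_ne_zero_iff.2 fun t _ => hz3 t

theorem exists_exchange (h : SharedForms Φ N f g V) (hN : 1 ≤ N)
    (e₀ : Fin (N + 1) × Fin 2 ≃ ι) {p : Fin 4 → ι} (hp : Function.Injective p) :
    ∃ a ∈ smallRing Φ, ∃ b ∈ smallRing Φ, a ≠ 0 ∧ b ≠ 0 ∧
      a * (pairMinor f g (p 0) (p 1) * pairMinor f g (p 2) (p 3)) =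
        b * (pairMinor f g (p 0) (p 3) * pairMinor f g (p 2) (p 1)) := by
  classical
  set l := Fin.last N
  have hl : (0 : Fin (N + 1)) ≠ l := by
    intro h0
    have := congrArg Fin.val h0
    simp only [Fin.val_zero, l, Fin.val_last] at this
    omega
  have hu : Function.Injective
      (fun x : Fin 4 => e₀ (![((0 : Fin (N + 1)), (0 : Fin 2)), (0, 1), (l, 0), (l, 1)] x)) := by
    refine e₀.injective.comp ?_
    intro x y hxy
    fin_cases x <;> fin_cases y <;> simp [hl, hl.symm] at hxy ⊢
  obtain ⟨σ, hσ⟩ := exists_perm_comp_eq hu hp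
  set e := e₀.trans σ
  have e0 : e (0, 0) = p 0 := hσ 0
  have e1 : e (0, 1) = p 1 := hσ 1
  have e2 : e (l, 0) = p 2 := hσ 2
  have e3 : e (l, 1) = p 3 := hσ 3
  set e' := e.trans (Equiv.swap (p 1) (p 3))
  have hpne : ∀ {i j}, i ≠ j → p i ≠ p j := fun hij => hp.ne hij
  have e0' : e' (0, 0) = p 0 := by
    simp only [e', Equiv.trans_apply, e0]
    exact Equiv.swap_apply_of_ne_of_ne (hpne (by decide)) (hpne (by decide))
  have e1' : e' (0, 1) = p 3 := by
    simp only [e', Equiv.trans_apply, e1, Equiv.swap_apply_left]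
  have e2' : e' (l, 0) = p 2 := by
    simp only [e', Equiv.trans_apply, e2]
    exact Equiv.swap_apply_of_ne_of_ne (hpne (by decide)) (hpne (by decide))
  have e3' : e' (l, 1) = p 1 := by
    simp only [e', Equiv.trans_apply, e3, Equiv.swap_apply_right]
  obtain ⟨a, ha, ha0, hae⟩ := h.exists_smallRing_eq_minorWron hN e'
  obtain ⟨b, hb, hb0, hbe⟩ := h.exists_smallRing_eq_minorWron hN e
  refine ⟨a, ha, b, hb, ha0, hb0, ?_⟩
  have hrest : ∀ t ∈ (Finset.univ.erase (0 : Fin (N + 1))).erase l, ∀ s, e' (t, s) = e (t, s) := by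
    intro t ht s
    simp only [Finset.mem_erase, Finset.mem_univ, and_true] at ht
    simp only [e', Equiv.trans_apply]
    apply Equiv.swap_apply_of_ne_of_ne
    · rw [← e1]; intro h0
      exact ht.2 (congrArg Prod.fst (e.injective h0))
    · rw [← e3]; intro h0
      exact ht.1 (congrArg Prod.fst (e.injective h0))
  have hl' : l ∈ Finset.univ.erase (0 : Fin (N + 1)) := by simp [hl.symm]
  have key : minorWron f g V e' * (pairMinor f g (p 0) (p 1) * pairMinor f g (p 2) (p 3)) =
      minorWron f g V e * (pairMinor f g (p 0) (p 3) * pairMinor f g (p 2) (p 1)) := by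
    simp only [minorWron]
    rw [← Finset.mul_prod_erase _ _ (Finset.mem_univ (0 : Fin (N + 1))),
      ← Finset.mul_prod_erase _ _ hl',
      ← Finset.mul_prod_erase Finset.univ (fun t => pairMinor f g (e (t, 0)) (e (t, 1)))
        (Finset.mem_univ (0 : Fin (N + 1))),
      ← Finset.mul_prod_erase _ (fun t => pairMinor f g (e (t, 0)) (e (t, 1))) hl',
      e0, e1, e2, e3, e0', e1', e2', e3',
      Finset.prod_congr rfl fun t ht => by rw [hrest t ht 0, hrest t ht 1]]
    ring
  refine eq_of_eventuallyEq_codiscrete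
    (ha.1.mul ((h.dP _ _).mul (h.dP _ _))).continuous
    (hb.1.mul ((h.dP _ _).mul (h.dP _ _))).continuous (eventually_codiscrete_iff.2 fun z => ?_)
  filter_upwards [hae z, hbe z] with w h1 h2
  have := congrFun key w
  simp only [Pi.mul_apply] at this ⊢
  rw [← h1, ← h2, this]

theorem exists_common_denominator [DecidableEq ι] (h : SharedForms Φ N f g V) (hN : 1 ≤ N)
    (e₀ : Fin (N + 1) × Fin 2 ≃ ι) :
    ∃ E ∈ smallRing Φ, E ≠ 0 ∧ ∀ i j, i ≠ j → ∀ z,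
      ((∀ k, f k z ≠ 0) → OrdGe (E * (pairMinor f g i j)⁻¹) z 0) ∧
      ∀ k (a b : ℕ), f k z = 0 → OrdEq (f k) z a → OrdEq (g k) z b →
        OrdGe (E * (pairMinor f g i j)⁻¹) z (if k = i ∨ k = j then -min (a : ℤ) b else -1) := by
  have hex : ∀ x : ι × ι, ∃ u ∈ smallRing Φ, u ≠ 0 ∧ (x.1 ≠ x.2 → ∀ z,
      ((∀ k, f k z ≠ 0) → OrdGe (u * (pairMinor f g x.1 x.2)⁻¹) z 0) ∧
      ∀ k (a b : ℕ), f k z = 0 → OrdEq (f k) z a → OrdEq (g k) z b →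
        OrdGe (u * (pairMinor f g x.1 x.2)⁻¹) z
          (if k = x.1 ∨ k = x.2 then -min (a : ℤ) b else -1)) := by
    rintro ⟨i, j⟩
    by_cases hij : i = j
    · exact ⟨1, one_mem _, one_ne_zero, fun h0 => absurd hij h0⟩
    have hu : Function.Injective
        (fun x : Fin 2 => e₀ (![((0 : Fin (N + 1)), (0 : Fin 2)), (0, 1)] x)) := by
      refine e₀.injective.comp ?_
      intro x y hxy
      fin_cases x <;> fin_cases y <;> simp at hxy ⊢
    have hv : Function.Injective ![i, j] := by
      intro x y hxy
      fin_cases x <;> fin_cases y <;> simp [hij, Ne.symm hij] at hxy ⊢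
    obtain ⟨σ, hσ⟩ := exists_perm_comp_eq hu hv
    set e := e₀.trans σ
    have e0 : e (0, 0) = i := hσ 0
    have e1 : e (0, 1) = j := hσ 1
    obtain ⟨u, hu, hu0, hue⟩ := h.exists_smallRing_eq_minorWron hN e
    have hc : ∀ z, minorWron f g V e * (pairMinor f g i j)⁻¹ =ᶠ[𝓝[≠] z]
        u * (pairMinor f g i j)⁻¹ := fun z => (hue z).mul (EventuallyEq.refl _ _)
    refine ⟨u, hu, hu0, fun _ z => ⟨fun hz => ?_, fun k a b hz ha hb => ?_⟩⟩
    · have := h.minorWron_div_ordGe_of_ne e 0 hz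
      rw [e0, e1] at this
      exact this.congr (hc z)
    · have := h.minorWron_div_ordGe e 0 hz ha hb
      rw [e0, e1] at this
      refine (this.congr (hc z)).mono ?_
      have hiff : (e.symm k).1 = 0 ↔ (k = i ∨ k = j) := by
        constructor
        · intro h0
          have h4 : e ((e.symm k).1, (e.symm k).2) = k := e.apply_symm_apply k
          rw [h0] at h4
          rcases Fin.exists_fin_two.1 ⟨(e.symm k).2, rfl⟩ with h5 | h5
          · left; rw [h5, e0] at h4; exact h4.symm
          · right; rw [h5, e1] at h4; exact h4.symm
        · rintro (rfl | rfl)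
          · rw [← e0, Equiv.symm_apply_apply]
          · rw [← e1, Equiv.symm_apply_apply]
      simp only [hiff, le_refl]
  choose u hu hu0 hux using hex
  refine ⟨∏ x, u x, prod_mem fun x _ => hu x,
    entire_prod_ne_zero (fun x _ => (hu x).1) (fun x _ => hu0 x), fun i j hij z => ?_⟩
  have heq : (∏ x, u x) * (pairMinor f g i j)⁻¹ =
      (∏ x ∈ Finset.univ.erase (i, j), u x) * (u (i, j) * (pairMinor f g i j)⁻¹) := by
    rw [← Finset.mul_prod_erase _ _ (Finset.mem_univ (i, j))]
    ring
  have h0 : OrdGe (∏ x ∈ Finset.univ.erase (i, j), u x) z 0 :=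
    ((prod_mem (S := smallRing Φ) fun x _ => hu x).1.analyticAt z).ordGe
  rw [heq]
  refine ⟨fun hz => ?_, fun k a b hz ha hb => ?_⟩
  · simpa using h0.mul ((hux (i, j) hij z).1 hz)
  · have := h0.mul ((hux (i, j) hij z).2 k a b hz ha hb)
    rwa [zero_add] at this

end SharedForms
end

theorem exists_isotropic_vector {R : Type*} [CommRing R] [IsDomain R] (a b w : Fin 5 → R)
    (hab : ∀ i j, i ≠ j → a i * b j - a j * b i ≠ 0) :
    ∃ ε : Fin 5 → R, ∑ i, b i ^ 2 * ε i = 0 ∧ ∑ i, a i * b i * ε i = 0 ∧ ∑ i, a i ^ 2 * ε i = 0 ∧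
      ∑ i, w i * ε i = 0 ∧ ∃ i₀, ∀ i, i ≠ i₀ → ε i ≠ 0 := by
  obtain ⟨ε, hε0, hε⟩ := (Matrix.exists_mulVec_eq_zero_iff
    (M := Matrix.of ![fun i => b i ^ 2, fun i => a i * b i, fun i => a i ^ 2, w, 0])).2
    (Matrix.det_eq_zero_of_row_eq_zero 4 fun j => rfl)
  have h0 : ∑ i, b i ^ 2 * ε i = 0 := congrFun hε 0
  have h1 : ∑ i, a i * b i * ε i = 0 := congrFun hε 1
  have h2 : ∑ i, a i ^ 2 * ε i = 0 := congrFun hε 2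
  have h3 : ∑ i, w i * ε i = 0 := congrFun hε 3
  refine ⟨ε, h0, h1, h2, h3, ?_⟩
  by_contra! hcon
  obtain ⟨p, -, hp⟩ := hcon 0
  obtain ⟨q, hqp, hq⟩ := hcon p
  have hidx : ∀ p q r : Fin 5, q ≠ p → r ≠ p → r ≠ q →
      ∃ j k, j ≠ r ∧ k ≠ r ∧ ∀ i, i ≠ r → i = p ∨ i = q ∨ i = j ∨ i = k := by decide +kernel
  refine hε0 (funext fun r => ?_)
  by_cases hrp : r = p
  · rw [hrp, hp]; rfl
  by_cases hrq : r = q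
  · rw [hrq, hq]; rfl
  obtain ⟨j, k, hj, hk, hall⟩ := hidx p q r hqp hrp hrq
  have hsum : ∑ i, ε i * ((a i * b j - a j * b i) * (a i * b k - a k * b i)) = 0 := by
    have : ∀ i, ε i * ((a i * b j - a j * b i) * (a i * b k - a k * b i)) =
        b j * b k * (a i ^ 2 * ε i) - (a j * b k + a k * b j) * (a i * b i * ε i) +
          a j * a k * (b i ^ 2 * ε i) := fun i => by ring
    simp only [this, Finset.sum_add_distrib, Finset.sum_sub_distrib, ← Finset.mul_sum, h0, h1, h2]
    ring
  rw [Finset.sum_eq_single r] at hsum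
  · exact (mul_eq_zero.1 hsum).resolve_right
      (mul_ne_zero (hab r j hj.symm) (hab r k hk.symm))
  · intro i _ hir
    rcases hall i hir with rfl | rfl | rfl | rfl
    · rw [hp, zero_mul]
    · rw [hq, zero_mul]
    · ring
    · ring
  · simp

theorem moment_identities {ι K : Type*} [Fintype ι] [Field K] {ε a b w L D : ι → K} {t l k : K}
    (h0 : ∑ i, b i ^ 2 * ε i = 0) (h1 : ∑ i, a i * b i * ε i = 0)
    (h3 : ∑ i, w i * ε i = 0)
    (hL : ∀ i, (t * b i - a i) * L i = t * b i * l - a i * D i)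
    (hw : ∀ i, w i = a i * b i * (D i + k)) :
    t * ∑ i, b i ^ 2 * ε i * L i = ∑ i, a i * b i * ε i * L i ∧
      t ^ 2 * ∑ i, b i ^ 2 * ε i * L i = ∑ i, a i ^ 2 * ε i * (L i - D i) := by
  have h4 : ∑ i, a i * b i * ε i * D i = 0 := by
    have : ∀ i, a i * b i * ε i * D i = w i * ε i - k * (a i * b i * ε i) := fun i => by
      rw [hw i]; ring
    simp only [this, Finset.sum_sub_distrib, ← Finset.mul_sum, h1, h3]
    ring
  have e1 : t * ∑ i, b i ^ 2 * ε i * L i = ∑ i, a i * b i * ε i * L i := by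
    have : ∀ i, t * (b i ^ 2 * ε i * L i) = a i * b i * ε i * L i + t * l * (b i ^ 2 * ε i) -
        a i * b i * ε i * D i := fun i => by
      linear_combination (b i * ε i) * hL i
    rw [Finset.mul_sum]
    simp only [this, Finset.sum_add_distrib, Finset.sum_sub_distrib, ← Finset.mul_sum, h0, h4]
    ring
  refine ⟨e1, ?_⟩
  rw [pow_two, mul_assoc, e1, Finset.mul_sum]
  have : ∀ i, t * (a i * b i * ε i * L i) = a i ^ 2 * ε i * (L i - D i) +
      t * l * (a i * b i * ε i) := fun i => by
    linear_combination (a i * ε i) * hL i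
  simp only [this, Finset.sum_add_distrib, ← Finset.mul_sum, h1]
  ring

theorem Meromorphic.eventually_eq_zero_or_ne_zero {u : ℂ → ℂ} (hu : Meromorphic u) :
    (∀ᶠ z in codiscrete ℂ, u z = 0) ∨ ∀ᶠ z in codiscrete ℂ, u z ≠ 0 := by
  have hu' : MeromorphicOn u Set.univ := fun z _ => hu z
  by_cases h : ∃ z, meromorphicOrderAt u z ≠ ⊤
  · right
    obtain ⟨z₀, hz₀⟩ := h
    refine eventually_codiscrete_iff.2 fun z => ?_
    rw [← meromorphicOrderAt_ne_top_iff_eventually_ne_zero (hu z)]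
    exact hu'.meromorphicOrderAt_ne_top_of_isPreconnected isPreconnected_univ (Set.mem_univ z₀)
      (Set.mem_univ z) hz₀
  · left
    push Not at h
    exact eventually_codiscrete_iff.2 fun z => meromorphicOrderAt_eq_top_iff.1 (h z)

theorem wronskian_mem_smallRing {Φ : ℂ → ℝ} (hΦ : Continuous Φ) {a b A B : ℂ → ℂ}
    (ha : a ∈ smallRing Φ) (hb : b ∈ smallRing Φ) (ha0 : a ≠ 0) (hb0 : b ≠ 0)
    (hA : Differentiable ℂ A) (hB : Differentiable ℂ B) (hA0 : A ≠ 0) (hB0 : B ≠ 0) {d : ℕ}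
    (hAd : DegBdd Φ d A) (hBd : DegBdd Φ d B) (h : a * B = b * A) :
    (∀ᶠ z in codiscrete ℂ, deriv a z * b z - a z * deriv b z =
      a z * b z * (logDeriv A z - logDeriv B z)) ∧
    deriv a * b - a * deriv b ∈ smallRing Φ := by
  have h1 : ∀ᶠ z in codiscrete ℂ, deriv a z * b z - a z * deriv b z =
      a z * b z * (logDeriv A z - logDeriv B z) := by
    filter_upwards [eventually_ne_zero_codiscrete ha.1 ha0, eventually_ne_zero_codiscrete hb.1 hb0,
      eventually_ne_zero_codiscrete hA hA0, eventually_ne_zero_codiscrete hB hB0] with z z1 z2 z3 z4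
    have e1 := logDeriv_mul (f := a) (g := B) z z1 z4 (ha.1 z) (hB z)
    have e2 := logDeriv_mul (f := b) (g := A) z z2 z3 (hb.1 z) (hA z)
    have e3 : (fun z => a z * B z) = fun z => b z * A z := h
    rw [e3, e2] at e1
    have e4 : logDeriv A z - logDeriv B z = logDeriv a z - logDeriv b z := by linear_combination e1
    rw [e4, logDeriv_apply, logDeriv_apply]
    field_simp
  have hd : ∀ {u : ℂ → ℂ}, Differentiable ℂ u → Differentiable ℂ (deriv u) := fun hu => by
    simpa using iteratedDeriv_differentiable hu 1
  have h2 : Differentiable ℂ (deriv a * b - a * deriv b) :=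
    ((hd ha.1).mul hb.1).sub (ha.1.mul (hd hb.1))
  refine ⟨h1, h2, ?_⟩
  have h3 := smallMer_logDeriv_quot (M := 1) hΦ hA hB (differentiable_const 1) hA0 hB0 one_ne_zero
    (by rwa [mul_one]) (by rwa [mul_one])
  refine ((ha.2.mul hb.2).mul h3).congr h2.meromorphic' ?_
  filter_upwards [h1] with z hz
  exact hz.symm

section
variable {ι : Type*}

theorem pairMinor_self (f g : ι → ℂ → ℂ) (i : ι) : pairMinor f g i i = 0 := by
  ext z; simp [pairMinor]

theorem pairMinor_pluecker (f g : ι → ℂ → ℂ) (i j k l : ι) :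
    pairMinor f g i k * pairMinor f g j l - pairMinor f g j k * pairMinor f g i l =
      pairMinor f g i j * pairMinor f g k l := by
  simp only [pairMinor]; ring

theorem DegBdd.pairMinor {Φ : ℂ → ℝ} {f g : ι → ℂ → ℂ} (h : ∀ i j, DegBdd Φ 1 (f i * g j)) (i j : ι) :
    DegBdd Φ 1 (pairMinor f g i j) := by
  obtain ⟨x, hx0, hx⟩ := h i j
  obtain ⟨y, hy0, hy⟩ := h j i
  refine ⟨x + y + Real.log 2, by positivity, fun z => ?_⟩
  have h1 : Real.exp (x + y + Real.log 2 + (1 : ℕ) * Φ z) =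
      2 * Real.exp (x + y + (1 : ℕ) * Φ z) := by
    rw [show x + y + Real.log 2 + (1 : ℕ) * Φ z = Real.log 2 + (x + y + (1 : ℕ) * Φ z) by ring,
      Real.exp_add, Real.exp_log two_pos]
  have h2 : ‖f i z * g j z‖ ≤ Real.exp (x + y + (1 : ℕ) * Φ z) :=
    (hx z).trans (Real.exp_le_exp.2 (by linarith))
  have h3 : ‖f j z * g i z‖ ≤ Real.exp (x + y + (1 : ℕ) * Φ z) :=
    (hy z).trans (Real.exp_le_exp.2 (by linarith))
  rw [h1, pairMinor_apply]
  exact (norm_sub_le _ _).trans (by linarith)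

/-- Coefficients in the small ring relating the minors at `s i`, together with an isotropic vector
for the associated quadratic relations. -/
structure IsotropicData (Φ : ℂ → ℝ) (f g : ι → ℂ → ℂ) (o : ι) (s : Fin 5 → ι)
    (a b ε : Fin 5 → ℂ → ℂ) : Prop where
  inj : Function.Injective s
  ne : ∀ i, s i ≠ o
  a_mem : ∀ i, a i ∈ smallRing Φ
  b_mem : ∀ i, b i ∈ smallRing Φ
  ε_mem : ∀ i, ε i ∈ smallRing Φ
  a_zero : a 0 = 0
  a_ne : ∀ i, i ≠ 0 → a i ≠ 0
  b_ne : ∀ i, b i ≠ 0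
  exch : ∀ i, a i * (pairMinor f g (s i) o * pairMinor f g (s 1) (s 0)) =
    b i * (pairMinor f g (s i) (s 0) * pairMinor f g (s 1) o)
  sum_bb : ∑ i, b i ^ 2 * ε i = 0
  sum_ab : ∑ i, a i * b i * ε i = 0
  sum_aa : ∑ i, a i ^ 2 * ε i = 0
  sum_w : ∑ i, (deriv (a i) * b i - a i * deriv (b i)) * ε i = 0
  ε_ne : ∃ i₀, ∀ i, i ≠ i₀ → ε i ≠ 0

namespace SharedForms
variable [Fintype ι] {Φ : ℂ → ℝ} {N : ℕ} {f g : ι → ℂ → ℂ} {V : ℂ → ℂ}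

theorem exists_exchange_coeff (h : SharedForms Φ N f g V) (hN : 1 ≤ N)
    (e₀ : Fin (N + 1) × Fin 2 ≃ ι) {o : ι} {s : Fin 5 → ι} (hs : Function.Injective s)
    (ho : ∀ i, s i ≠ o) (i : Fin 5) :
    ∃ a ∈ smallRing Φ, ∃ b ∈ smallRing Φ, (i = 0 → a = 0) ∧ (i ≠ 0 → a ≠ 0) ∧ b ≠ 0 ∧
      a * (pairMinor f g (s i) o * pairMinor f g (s 1) (s 0)) =
        b * (pairMinor f g (s i) (s 0) * pairMinor f g (s 1) o) := by
  by_cases i0 : i = 0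
  · subst i0
    exact ⟨0, zero_mem _, 1, one_mem _, fun _ => rfl, fun h0 => absurd rfl h0, one_ne_zero, by
      simp [pairMinor_self]⟩
  by_cases i1 : i = 1
  · subst i1
    exact ⟨1, one_mem _, 1, one_mem _, fun h0 => absurd h0 i0, fun _ => one_ne_zero, one_ne_zero,
      by ring⟩
  have hp : Function.Injective ![s i, o, s 1, s 0] := by
    have h1 := ho i
    have h2 := ho 1
    have h3 := ho 0
    have h4 := hs.ne i0
    have h5 := hs.ne i1
    have h6 : s 1 ≠ s 0 := hs.ne (by decide)
    have h7 := hs.eq_iff (a := i) (b := 0)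
    have h8 := hs.eq_iff (a := i) (b := 1)
    intro x y hxy
    fin_cases x <;> fin_cases y <;>
      simp_all [h1.symm, h2.symm, h3.symm, h4.symm, h5.symm, h6.symm]
  obtain ⟨a, ha, b, hb, ha0, hb0, hab⟩ := h.exists_exchange hN e₀ hp
  exact ⟨a, ha, b, hb, fun h0 => absurd h0 i0, fun _ => ha0, hb0, hab⟩

theorem exists_isotropicData (h : SharedForms Φ N f g V) (hN : 1 ≤ N)
    (e₀ : Fin (N + 1) × Fin 2 ≃ ι) {o : ι} {s : Fin 5 → ι} (hs : Function.Injective s)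
    (ho : ∀ i, s i ≠ o) : ∃ a b ε, IsotropicData Φ f g o s a b ε := by
  choose a ha b hb a0 a1 b0 hex using h.exists_exchange_coeff hN e₀ hs ho
  have hw : ∀ i, deriv (a i) * b i - a i * deriv (b i) ∈ smallRing Φ := by
    intro i
    by_cases i0 : i = 0
    · have : deriv (0 : ℂ → ℂ) = 0 := deriv_const' 0
      rw [a0 i i0, this]
      simp
    refine (wronskian_mem_smallRing h.cont (ha i) (hb i) (a1 i i0) (b0 i)
      ((h.dP (s i) (s 0)).mul (h.dP (s 1) o)) ((h.dP (s i) o).mul (h.dP (s 1) (s 0)))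
      (entire_mul_ne_zero (h.dP _ _) (h.dP _ _) (h.minor_ne _ _ (hs.ne i0)) (h.minor_ne _ _ (ho 1)))
      (entire_mul_ne_zero (h.dP _ _) (h.dP _ _) (h.minor_ne _ _ (ho i))
        (h.minor_ne _ _ (hs.ne (by decide))))
      ((DegBdd.pairMinor h.bdd _ _).mul (DegBdd.pairMinor h.bdd _ _))
      ((DegBdd.pairMinor h.bdd _ _).mul (DegBdd.pairMinor h.bdd _ _)) (hex i)).2
  obtain ⟨ε, e1, e2, e3, e4, i₀, e5⟩ := exists_isotropic_vector
    (fun i => (⟨a i, ha i⟩ : smallRing Φ)) (fun i => ⟨b i, hb i⟩)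
    (fun i => ⟨_, hw i⟩) (by
      intro i j hij h0
      have h1 : a i * b j - a j * b i = 0 := congrArg Subtype.val h0
      have h2 : b i * b j * (pairMinor f g (s 1) o * (pairMinor f g (s i) (s j) *
          pairMinor f g (s 0) o)) = 0 := by
        rw [← pairMinor_pluecker]
        linear_combination -(hex i) * b j * pairMinor f g (s j) o +
          (hex j) * b i * pairMinor f g (s i) o +
          h1 * pairMinor f g (s i) o * pairMinor f g (s j) o * pairMinor f g (s 1) (s 0)
      refine entire_mul_ne_zero ((hb i).1.mul (hb j).1)
        ((h.dP _ _).mul ((h.dP _ _).mul (h.dP _ _)))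
        (entire_mul_ne_zero (hb i).1 (hb j).1 (b0 i) (b0 j))
        (entire_mul_ne_zero (h.dP _ _) ((h.dP _ _).mul (h.dP _ _)) (h.minor_ne _ _ (ho 1))
          (entire_mul_ne_zero (h.dP _ _) (h.dP _ _) (h.minor_ne _ _ (hs.ne hij))
            (h.minor_ne _ _ (ho 0)))) h2)
  refine ⟨a, b, fun i => (ε i : ℂ → ℂ), hs, ho, ha, hb, fun i => (ε i).2, a0 0 rfl, a1, b0, hex,
    ?_, ?_, ?_, ?_, i₀, fun i hi h0 => e5 i hi (Subtype.ext h0)⟩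
  · simpa using congrArg (Subtype.val) e1
  · simpa using congrArg (Subtype.val) e2
  · simpa using congrArg (Subtype.val) e3
  · simpa using congrArg (Subtype.val) e4

end SharedForms
end

section
variable {κ : Type*} [Fintype κ]

/-- A combination of logarithmic derivatives of the quotients `q i / P i`. -/
def logForm (c q P : κ → ℂ → ℂ) : ℂ → ℂ := ∑ i, c i * (logDeriv (q i) - logDeriv (P i))

theorem logForm_apply (c q P : κ → ℂ → ℂ) (z : ℂ) :
    logForm c q P z = ∑ i, c i z * (logDeriv (q i) z - logDeriv (P i) z) := by
  simp [logForm]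

theorem sum_mul_eq_of_sum_eq_zero {c x y : κ → ℂ} (hc : ∑ i, c i = 0) (r : ℂ)
    (h : ∀ i, c i * x i = c i * (y i + r)) : ∑ i, c i * x i = ∑ i, c i * y i := by
  simp only [h, mul_add, Finset.sum_add_distrib, ← Finset.sum_mul, hc, zero_mul, add_zero]

theorem logForm_meromorphic {c q P : κ → ℂ → ℂ} (hc : ∀ i, Differentiable ℂ (c i))
    (hq : ∀ i, Differentiable ℂ (q i)) (hP : ∀ i, Differentiable ℂ (P i)) :
    Meromorphic (logForm c q P) := by
  classical
  have : ∀ s : Finset κ, Meromorphic (∑ i ∈ s, c i * (logDeriv (q i) - logDeriv (P i))) := by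
    intro s
    induction s using Finset.induction_on with
    | empty =>
      rw [Finset.sum_empty]
      exact (differentiable_const (0 : ℂ)).meromorphic'
    | insert i s hi ih =>
      rw [Finset.sum_insert hi]
      exact (((hc i).meromorphic').mul ((hq i).meromorphic'.logDeriv.sub
        (hP i).meromorphic'.logDeriv)).add ih
  exact this _

theorem smallMer_logForm {Φ : ℂ → ℝ} (hΦ : Continuous Φ) {c q P : κ → ℂ → ℂ} {A B M : ℂ → ℂ} {d : ℕ}
    (hc : ∀ i, c i ∈ smallRing Φ) (hsum : ∑ i, c i = 0)
    (hq : ∀ i, Differentiable ℂ (q i)) (hq0 : ∀ i, q i ≠ 0)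
    (hP : ∀ i, Differentiable ℂ (P i)) (hA : Differentiable ℂ A) (hA0 : A ≠ 0)
    (hB : Differentiable ℂ B) (hB0 : B ≠ 0) (hM : Differentiable ℂ M) (hM0 : M ≠ 0)
    (h : ∀ i, c i = 0 ∨ (P i ≠ 0 ∧ DegBdd Φ d (q i * A * M) ∧ DegBdd Φ d (B * P i * M))) :
    SmallMer Φ (logForm c q P) := by
  have h1 : ∀ i, SmallMer Φ (c i * (logDeriv (q i * A) - logDeriv (B * P i))) := by
    intro i
    rcases h i with h0 | ⟨hP0, h1, h2⟩
    · rw [h0, zero_mul]; exact SmallMer.const 0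
    · exact (hc i).2.mul (smallMer_logDeriv_quot hΦ ((hq i).mul hA) (hB.mul (hP i)) hM
        (entire_mul_ne_zero (hq i) hA (hq0 i) hA0) (entire_mul_ne_zero hB (hP i) hB0 hP0) hM0 h1 h2)
  refine (SmallMer.sum (s := Finset.univ) fun i _ => h1 i).congr
    (logForm_meromorphic (fun i => (hc i).1) hq hP) ?_
  have h2 : ∀ᶠ z in codiscrete ℂ, ∀ i, c i = 0 ∨ P i z ≠ 0 := by
    refine eventually_all.2 fun i => ?_
    rcases h i with h0 | ⟨hP0, -⟩
    · exact .of_forall fun _ => Or.inl h0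
    · exact (eventually_ne_zero_codiscrete (hP i) hP0).mono fun _ => Or.inr
  filter_upwards [h2, eventually_all.2 fun i => eventually_ne_zero_codiscrete (hq i) (hq0 i),
    eventually_ne_zero_codiscrete hA hA0, eventually_ne_zero_codiscrete hB hB0] with z z1 z2 z3 z4
  rw [logForm_apply, Finset.sum_apply]
  have hs : ∑ i, c i z = 0 := by simpa using congrFun hsum z
  refine sum_mul_eq_of_sum_eq_zero hs (logDeriv A z - logDeriv B z) fun i => ?_
  rcases z1 i with h0 | hP0
  · simp [h0]
  · rw [Pi.sub_apply]
    have e1 : logDeriv (q i * A) z = _ := logDeriv_mul z (z2 i) z3 (hq i z) (hA z)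
    have e2 : logDeriv (B * P i) z = _ := logDeriv_mul z z4 hP0 (hB z) (hP i z)
    rw [e1, e2]
    ring

theorem logDeriv_ordGe_neg_one {u : ℂ → ℂ} (hu : Differentiable ℂ u) (z : ℂ) :
    OrdGe (logDeriv u) z (-1) := by
  by_cases h0 : u = 0
  · have : logDeriv (0 : ℂ → ℂ) = 0 := by ext; simp [logDeriv_apply]
    rw [h0, this]
    exact OrdGe.zero
  · obtain ⟨m, hm⟩ := exists_ordEq hu h0 z
    exact hm.logDeriv_ordGe

theorem logForm_ordGe_neg_one {c q P : κ → ℂ → ℂ} (hc : ∀ i, Differentiable ℂ (c i))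
    (hq : ∀ i, Differentiable ℂ (q i)) (hP : ∀ i, Differentiable ℂ (P i)) (z : ℂ) :
    OrdGe (logForm c q P) z (-1) :=
  OrdGe.sum fun i _ => by
    simpa using ((hc i).analyticAt z).ordGe.mul
      ((logDeriv_ordGe_neg_one (hq i) z).sub (logDeriv_ordGe_neg_one (hP i) z))

theorem mul_logForm_ordGe {c q P : κ → ℂ → ℂ} {E : ℂ → ℂ} {z : ℂ} (hE : Differentiable ℂ E)
    (hc : ∀ i, Differentiable ℂ (c i)) (hq : ∀ i, Differentiable ℂ (q i))
    (hP : ∀ i, Differentiable ℂ (P i)) (hqz : ∀ i, q i z ≠ 0)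
    (h : ∀ i, c i = 0 ∨ OrdGe (E * (P i)⁻¹) z 0) : OrdGe (E * logForm c q P) z 0 := by
  rw [logForm, Finset.mul_sum]
  refine OrdGe.sum fun i _ => ?_
  rcases h i with h0 | h1
  · rw [h0, zero_mul, mul_zero]; exact OrdGe.zero
  have hd : ∀ {u : ℂ → ℂ}, Differentiable ℂ u → OrdGe (deriv u) z 0 := fun {u} hu => by
    have : Differentiable ℂ (deriv u) := by simpa using iteratedDeriv_differentiable hu 1
    exact (this.analyticAt z).ordGe
  have e1 : OrdGe (E * logDeriv (q i)) z 0 := by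
    have h2 := ((hE.analyticAt z).ordGe.mul (hd (hq i))).mul
      (((hq i).analyticAt z).ordEq (hqz i)).inv.ordGe
    exact (h2.mono (by simp)).congr (.of_forall fun w => by
      simp [logDeriv_apply, div_eq_mul_inv, mul_assoc])
  have e2 : OrdGe (E * logDeriv (P i)) z 0 := by
    have h2 := h1.mul (hd (hP i))
    exact (h2.mono (by simp)).congr (.of_forall fun w => by
      simp only [logDeriv_apply, div_eq_mul_inv, Pi.mul_apply, Pi.inv_apply]
      ring)
  have e3 := ((hc i).analyticAt z).ordGe.mul (e1.sub e2)
  rw [zero_add] at e3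
  convert e3 using 1
  ring

theorem logForm_sub_residue_ordGe {c q P : κ → ℂ → ℂ} {z : ℂ} {m k : κ → ℤ}
    (hc : ∀ i, Differentiable ℂ (c i))
    (h : ∀ i, c i = 0 ∨ (OrdEq (q i) z (m i) ∧ OrdEq (P i) z (k i))) :
    OrdGe (fun w => logForm c q P w - (w - z)⁻¹ * ∑ i, c i w * (m i - k i)) z 0 := by
  have h1 : OrdGe (∑ i, c i * ((fun w => logDeriv (q i) w - m i * (w - z)⁻¹) -
      fun w => logDeriv (P i) w - k i * (w - z)⁻¹)) z 0 := by
    refine OrdGe.sum fun i _ => ?_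
    rcases h i with h0 | ⟨h1, h2⟩
    · rw [h0, zero_mul]; exact OrdGe.zero
    · simpa using ((hc i).analyticAt z).ordGe.mul (h1.logDeriv.sub h2.logDeriv)
  refine h1.congr (.of_forall fun w => ?_)
  simp only [logForm_apply, Finset.sum_apply, Pi.mul_apply, Pi.sub_apply, Finset.mul_sum,
    ← Finset.sum_sub_distrib]
  exact Finset.sum_congr rfl fun i _ => by ring

theorem sum_residue_eq_zero {c q P : κ → ℂ → ℂ} {z : ℂ} {m k : κ → ℤ}
    (hc : ∀ i, Differentiable ℂ (c i))
    (h : ∀ i, c i = 0 ∨ (OrdEq (q i) z (m i) ∧ OrdEq (P i) z (k i)))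
    (h0 : ∀ᶠ w in codiscrete ℂ, logForm c q P w = 0) : ∑ i, c i z * (m i - k i) = 0 := by
  have h1 := logForm_sub_residue_ordGe hc h
  have h2 : OrdGe (fun w => w - z) z 1 :=
    analyticAt_ordGe_one (by fun_prop) (sub_self z)
  have h3 : OrdGe (fun w => ∑ i, c i w * ((m i : ℂ) - k i)) z 1 := by
    refine ((h2.mul h1).neg.mono (by norm_num)).congr ?_
    filter_upwards [eventually_codiscrete_iff.1 h0 z, eventually_sub_ne_zero z] with w h4 h5
    simp only [Pi.neg_apply, Pi.mul_apply, h4]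
    field_simp
    ring
  refine h3.eq_zero (Continuous.continuousAt ?_)
  exact continuous_finsetSum _ fun i _ => (hc i).continuous.mul continuous_const

end

section
variable {ι : Type*} {Φ : ℂ → ℝ} {N : ℕ} {f g q : ι → ℂ → ℂ} {V : ℂ → ℂ}

/-- A family `q` having the zeros of the shared families `f`, `g` and satisfying the syzygies of
their minors. -/
structure IsSide (Φ : ℂ → ℝ) (f g q : ι → ℂ → ℂ) : Prop where
  dq : ∀ i, Differentiable ℂ (q i)
  q0 : ∀ i, q i ≠ 0
  zero_iff : ∀ i z, q i z = 0 ↔ f i z = 0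
  min_le : ∀ i z (a b : ℕ) (m : ℤ), OrdEq (f i) z a → OrdEq (g i) z b → OrdEq (q i) z m →
    min (a : ℤ) b ≤ m
  syzygy : ∀ i j k, q i * pairMinor f g j k = q j * pairMinor f g i k - q k * pairMinor f g i j
  bdd : ∃ M, Differentiable ℂ M ∧ M ≠ 0 ∧ ∀ i j k, DegBdd Φ 2 (q i * pairMinor f g j k * M)

theorem OrdEq.unique {u : ℂ → ℂ} {z : ℂ} {m k : ℤ} (h : OrdEq u z m) (h' : OrdEq u z k) : m = k :=
  le_antisymm (h'.le_of_ordGe h.ordGe) (h.le_of_ordGe h'.ordGe)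

variable [Fintype ι]

theorem SharedForms.isSide_left (h : SharedForms Φ N f g V) (o : ι) : IsSide Φ f g f where
  dq := h.df
  q0 := h.f0
  zero_iff _ _ := Iff.rfl
  min_le i z a b m ha hb hm := by rw [hm.unique ha]; exact min_le_left _ _
  syzygy i j k := by simp only [pairMinor]; ring
  bdd := ⟨g o, h.dg o, h.g0 o, fun i j k => by
    have := (h.bdd i o).mul (DegBdd.pairMinor h.bdd j k)
    rwa [mul_right_comm] at this⟩

theorem SharedForms.isSide_right (h : SharedForms Φ N f g V) (o : ι) : IsSide Φ f g g where
  dq := h.dg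
  q0 := h.g0
  zero_iff i z := (h.common i z).symm
  min_le i z a b m ha hb hm := by rw [hm.unique hb]; exact min_le_right _ _
  syzygy i j k := by simp only [pairMinor]; ring
  bdd := ⟨f o, h.df o, h.f0 o, fun i j k => by
    have := (h.bdd o i).mul (DegBdd.pairMinor h.bdd j k)
    rwa [mul_comm (f o), mul_right_comm] at this⟩

namespace IsotropicData
variable {o : ι} {s : Fin 5 → ι} {a b ε : Fin 5 → ℂ → ℂ}

/-- The first logarithmic form. -/
def formP (f g q : ι → ℂ → ℂ) (o : ι) (s : Fin 5 → ι) (b ε : Fin 5 → ℂ → ℂ) : ℂ → ℂ :=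
  logForm (fun i => b i ^ 2 * ε i) (fun i => q (s i)) (fun i => pairMinor f g (s i) o)

/-- The mixed logarithmic form. -/
def formQ (f g q : ι → ℂ → ℂ) (o : ι) (s : Fin 5 → ι) (a b ε : Fin 5 → ℂ → ℂ) : ℂ → ℂ :=
  logForm (fun i => a i * b i * ε i) (fun i => q (s i)) (fun i => pairMinor f g (s i) o)

/-- The last logarithmic form. -/
def formR (f g q : ι → ℂ → ℂ) (s : Fin 5 → ι) (a ε : Fin 5 → ℂ → ℂ) : ℂ → ℂ :=
  logForm (fun i => a i ^ 2 * ε i) (fun i => q (s i)) (fun i => pairMinor f g (s i) (s 0))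

theorem smallMer_formP (D : IsotropicData Φ f g o s a b ε) (h : SharedForms Φ N f g V)
    (hq : IsSide Φ f g q) : SmallMer Φ (formP f g q o s b ε) := by
  obtain ⟨M, hM, hM0, hb⟩ := hq.bdd
  exact smallMer_logForm (d := 2) h.cont
    (fun i => mul_mem (pow_mem (D.b_mem i) 2) (D.ε_mem i)) D.sum_bb (fun i => hq.dq _)
    (fun i => hq.q0 _) (fun i => h.dP _ _) (h.dP (s 0) o) (h.minor_ne _ _ (D.ne 0)) (hq.dq o)
    (hq.q0 o) hM hM0 fun i => Or.inr ⟨h.minor_ne _ _ (D.ne i), hb _ _ _, hb _ _ _⟩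

theorem smallMer_formQ (D : IsotropicData Φ f g o s a b ε) (h : SharedForms Φ N f g V)
    (hq : IsSide Φ f g q) : SmallMer Φ (formQ f g q o s a b ε) := by
  obtain ⟨M, hM, hM0, hb⟩ := hq.bdd
  exact smallMer_logForm (d := 2) h.cont
    (fun i => mul_mem (mul_mem (D.a_mem i) (D.b_mem i)) (D.ε_mem i)) D.sum_ab (fun i => hq.dq _)
    (fun i => hq.q0 _) (fun i => h.dP _ _) (h.dP (s 0) o) (h.minor_ne _ _ (D.ne 0)) (hq.dq o)
    (hq.q0 o) hM hM0 fun i => Or.inr ⟨h.minor_ne _ _ (D.ne i), hb _ _ _, hb _ _ _⟩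

theorem smallMer_formR (D : IsotropicData Φ f g o s a b ε) (h : SharedForms Φ N f g V)
    (hq : IsSide Φ f g q) : SmallMer Φ (formR f g q s a ε) := by
  obtain ⟨M, hM, hM0, hb⟩ := hq.bdd
  refine smallMer_logForm (d := 2) h.cont
    (fun i => mul_mem (pow_mem (D.a_mem i) 2) (D.ε_mem i)) D.sum_aa (fun i => hq.dq _)
    (fun i => hq.q0 _) (fun i => h.dP _ _) (h.dP (s 0) o) (h.minor_ne _ _ (D.ne 0)) (hq.dq o)
    (hq.q0 o) hM hM0 fun i => ?_
  by_cases i0 : i = 0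
  · left
    rw [i0, D.a_zero]
    simp
  · exact Or.inr ⟨h.minor_ne _ _ (D.inj.ne i0), hb _ _ _, hb _ _ _⟩

theorem logDeriv_identity (D : IsotropicData Φ f g o s a b ε) (h : SharedForms Φ N f g V)
    (hq : IsSide Φ f g q) (i : Fin 5) : ∀ᶠ z in codiscrete ℂ,
      (pairMinor f g (s 1) o z * q (s 0) z / (pairMinor f g (s 1) (s 0) z * q o z) * b i z - a i z) *
        (logDeriv (q (s i)) z + logDeriv (pairMinor f g (s 0) o) z -
          (logDeriv (q o) z + logDeriv (pairMinor f g (s i) o) z)) =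
      pairMinor f g (s 1) o z * q (s 0) z / (pairMinor f g (s 1) (s 0) z * q o z) * b i z *
        (logDeriv (q (s 0)) z - logDeriv (q o) z) -
      a i z * (logDeriv (pairMinor f g (s i) (s 0)) z - logDeriv (pairMinor f g (s i) o) z) := by
  have hP : ∀ i j, i ≠ j → ∀ᶠ z in codiscrete ℂ, pairMinor f g i j z ≠ 0 := fun i j hij =>
    eventually_ne_zero_codiscrete (h.dP i j) (h.minor_ne i j hij)
  have hqe : ∀ i, ∀ᶠ z in codiscrete ℂ, q i z ≠ 0 := fun i =>
    eventually_ne_zero_codiscrete (hq.dq i) (hq.q0 i)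
  have hx : ∀ᶠ z in codiscrete ℂ,
      pairMinor f g (s i) (s 0) z * logDeriv (pairMinor f g (s i) (s 0)) z =
        deriv (pairMinor f g (s i) (s 0)) z := by
    by_cases i0 : i = 0
    · rw [i0, pairMinor_self]
      refine .of_forall fun z => ?_
      have : deriv (0 : ℂ → ℂ) = 0 := deriv_const' 0
      simp [this]
    · filter_upwards [hP _ _ (D.inj.ne i0)] with z hz
      rw [logDeriv_apply]; field_simp
  filter_upwards [hx, hP _ _ (D.ne i), hP _ _ (D.ne 0), hP _ _ (D.ne 1),
    hP _ _ (D.inj.ne (show (1 : Fin 5) ≠ 0 by decide)), hqe (s i), hqe (s 0), hqe o]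
    with z z1 z2 z3 z4 z5 z6 z7 z8
  have ex := congrFun (D.exch i) z
  have es := congrFun (hq.syzygy (s i) (s 0) o) z
  have ed : deriv (q (s i) * pairMinor f g (s 0) o) z =
      deriv (q (s 0) * pairMinor f g (s i) o - q o * pairMinor f g (s i) (s 0)) z := by
    rw [hq.syzygy]
  have dP := fun i j => (h.dP i j) z
  have dq := fun i => (hq.dq i) z
  rw [deriv_sub ((dq _).mul (dP _ _)) ((dq _).mul (dP _ _)), deriv_mul (dq _) (dP _ _),
    deriv_mul (dq _) (dP _ _), deriv_mul (dq _) (dP _ _), ← z1] at ed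
  simp only [Pi.mul_apply, Pi.sub_apply] at ex es
  set X := logDeriv (pairMinor f g (s i) (s 0)) z
  have l1 : deriv (q (s i)) z = q (s i) z * logDeriv (q (s i)) z := by
    rw [logDeriv_apply]; field_simp
  have l2 : deriv (q (s 0)) z = q (s 0) z * logDeriv (q (s 0)) z := by
    rw [logDeriv_apply]; field_simp
  have l3 : deriv (q o) z = q o z * logDeriv (q o) z := by
    rw [logDeriv_apply]; field_simp
  have l4 : deriv (pairMinor f g (s 0) o) z =
      pairMinor f g (s 0) o z * logDeriv (pairMinor f g (s 0) o) z := by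
    rw [logDeriv_apply]; field_simp
  have l5 : deriv (pairMinor f g (s i) o) z =
      pairMinor f g (s i) o z * logDeriv (pairMinor f g (s i) o) z := by
    rw [logDeriv_apply]; field_simp
  rw [l1, l2, l3, l4, l5] at ed
  generalize logDeriv (q (s i)) z = y1 at *
  generalize logDeriv (q (s 0)) z = y2 at *
  generalize logDeriv (q o) z = y3 at *
  generalize logDeriv (pairMinor f g (s 0) o) z = y4 at *
  generalize logDeriv (pairMinor f g (s i) o) z = y5 at *
  generalize pairMinor f g (s i) o z = p1 at *
  generalize pairMinor f g (s 0) o z = p2 at *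
  generalize pairMinor f g (s 1) o z = p3 at *
  generalize pairMinor f g (s 1) (s 0) z = p4 at *
  generalize pairMinor f g (s i) (s 0) z = p5 at *
  generalize q (s i) z = q1 at *
  generalize q (s 0) z = q2 at *
  generalize q o z = q3 at *
  generalize a i z = A at *
  generalize b i z = B at *
  clear_value X
  rw [← sub_eq_zero]
  have key : ((p3 * q2 * B - A * p4 * q3) * (y1 + y4 - (y3 + y5)) -
      (p3 * q2 * B * (y2 - y3) - A * p4 * q3 * (X - y5))) * p1 = 0 := by
    linear_combination p3 * B * ed - p3 * B * (y1 + y4) * es +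
      (-q3 * (y1 + y4 - (y3 + y5)) + q3 * (X - y5)) * ex
  have key2 := (mul_eq_zero.1 key).resolve_right z2
  have : p3 * q2 / (p4 * q3) * B - A = (p3 * q2 * B - A * p4 * q3) / (p4 * q3) := by field_simp
  rw [this]
  have : (p3 * q2 * B - A * p4 * q3) / (p4 * q3) * (y1 + y4 - (y3 + y5)) -
      (p3 * q2 / (p4 * q3) * B * (y2 - y3) - A * (X - y5)) =
      ((p3 * q2 * B - A * p4 * q3) * (y1 + y4 - (y3 + y5)) -
      (p3 * q2 * B * (y2 - y3) - A * p4 * q3 * (X - y5))) / (p4 * q3) := by field_simp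
  rw [this, key2, zero_div]

theorem wronskian_identity (D : IsotropicData Φ f g o s a b ε) (h : SharedForms Φ N f g V)
    (i : Fin 5) : ∀ᶠ z in codiscrete ℂ,
      deriv (a i) z * b i z - a i z * deriv (b i) z =
        a i z * b i z * (logDeriv (pairMinor f g (s i) (s 0)) z -
          logDeriv (pairMinor f g (s i) o) z +
          (logDeriv (pairMinor f g (s 1) o) z - logDeriv (pairMinor f g (s 1) (s 0)) z)) := by
  by_cases i0 : i = 0
  · have : deriv (0 : ℂ → ℂ) = 0 := deriv_const' 0
    rw [i0, D.a_zero, this]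
    simp
  have n1 := h.minor_ne _ _ (D.inj.ne i0)
  have n2 := h.minor_ne _ _ (D.ne 1)
  have n3 := h.minor_ne _ _ (D.ne i)
  have n4 := h.minor_ne _ _ (D.inj.ne (show (1 : Fin 5) ≠ 0 by decide))
  have h1 := (wronskian_mem_smallRing h.cont (D.a_mem i) (D.b_mem i) (D.a_ne i i0) (D.b_ne i)
      ((h.dP (s i) (s 0)).mul (h.dP (s 1) o)) ((h.dP (s i) o).mul (h.dP (s 1) (s 0)))
      (entire_mul_ne_zero (h.dP _ _) (h.dP _ _) n1 n2)
      (entire_mul_ne_zero (h.dP _ _) (h.dP _ _) n3 n4)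
      ((DegBdd.pairMinor h.bdd _ _).mul (DegBdd.pairMinor h.bdd _ _))
      ((DegBdd.pairMinor h.bdd _ _).mul (DegBdd.pairMinor h.bdd _ _)) (D.exch i)).1
  filter_upwards [h1, eventually_ne_zero_codiscrete (h.dP _ _) n1,
    eventually_ne_zero_codiscrete (h.dP _ _) n2, eventually_ne_zero_codiscrete (h.dP _ _) n3,
    eventually_ne_zero_codiscrete (h.dP _ _) n4] with z h1 h2 h3 h4 h5
  have e1 : logDeriv (pairMinor f g (s i) (s 0) * pairMinor f g (s 1) o) z = _ :=
    logDeriv_mul z h2 h3 (h.dP _ _ z) (h.dP _ _ z)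
  have e2 : logDeriv (pairMinor f g (s i) o * pairMinor f g (s 1) (s 0)) z = _ :=
    logDeriv_mul z h4 h5 (h.dP _ _ z) (h.dP _ _ z)
  rw [h1, e1, e2]
  ring

theorem forms_eq (D : IsotropicData Φ f g o s a b ε) (h : SharedForms Φ N f g V)
    (hq : IsSide Φ f g q) : ∀ᶠ z in codiscrete ℂ,
      pairMinor f g (s 1) o z * q (s 0) z / (pairMinor f g (s 1) (s 0) z * q o z) *
        formP f g q o s b ε z = formQ f g q o s a b ε z ∧
      (pairMinor f g (s 1) o z * q (s 0) z / (pairMinor f g (s 1) (s 0) z * q o z)) ^ 2 *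
        formP f g q o s b ε z = formR f g q s a ε z := by
  filter_upwards [eventually_all.2 (D.logDeriv_identity h hq),
    eventually_all.2 (D.wronskian_identity h)] with z h1 h2
  have s1 : ∑ i, b i z ^ 2 * ε i z = 0 := by simpa using congrFun D.sum_bb z
  have s2 : ∑ i, a i z * b i z * ε i z = 0 := by simpa using congrFun D.sum_ab z
  have s3 : ∑ i, a i z ^ 2 * ε i z = 0 := by simpa using congrFun D.sum_aa z
  have s4 : ∑ i, (deriv (a i) z * b i z - a i z * deriv (b i) z) * ε i z = 0 := by
    simpa using congrFun D.sum_w z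
  have key := moment_identities s1 s2 s4 h1 h2
  set r := logDeriv (pairMinor f g (s 0) o) z - logDeriv (q o) z with hr
  rw [sum_mul_eq_of_sum_eq_zero (y := fun i => logDeriv (q (s i)) z -
      logDeriv (pairMinor f g (s i) o) z) s1 r fun i => by rw [hr]; ring,
    sum_mul_eq_of_sum_eq_zero (y := fun i => logDeriv (q (s i)) z -
      logDeriv (pairMinor f g (s i) o) z) s2 r fun i => by rw [hr]; ring,
    sum_mul_eq_of_sum_eq_zero (y := fun i => logDeriv (q (s i)) z -
      logDeriv (pairMinor f g (s i) (s 0)) z) s3 r fun i => by rw [hr]; ring] at key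
  simpa [formP, formQ, formR, logForm_apply] using key

end IsotropicData
end

section
variable {ι : Type*} {Φ : ℂ → ℝ} {N : ℕ} {f g q : ι → ℂ → ℂ} {V E : ℂ → ℂ}

/-- Some nonzero element of the small ring vanishes on the zero set of `u`. -/
def HasSmallMultiple (Φ : ℂ → ℝ) (u : ℂ → ℂ) : Prop :=
  ∃ v ∈ smallRing Φ, v ≠ 0 ∧ ∀ z, u z = 0 → v z = 0

/-- `E` bounds the zeros of all minors, up to one zero at each common zero. -/
def IsDenominator [DecidableEq ι] (f g : ι → ℂ → ℂ) (E : ℂ → ℂ) : Prop :=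
  ∀ i j, i ≠ j → ∀ z, ((∀ k, f k z ≠ 0) → OrdGe (E * (pairMinor f g i j)⁻¹) z 0) ∧
    ∀ k (a b : ℕ), f k z = 0 → OrdEq (f k) z a → OrdEq (g k) z b →
      OrdGe (E * (pairMinor f g i j)⁻¹) z (if k = i ∨ k = j then -min (a : ℤ) b else -1)

namespace IsotropicData
variable {o : ι} {s : Fin 5 → ι} {a b ε : Fin 5 → ℂ → ℂ}

theorem dbb (D : IsotropicData Φ f g o s a b ε) (i : Fin 5) :
    Differentiable ℂ ((fun i => b i ^ 2 * ε i) i) :=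
  ((D.b_mem i).1.pow 2).mul (D.ε_mem i).1

theorem dab (D : IsotropicData Φ f g o s a b ε) (i : Fin 5) :
    Differentiable ℂ ((fun i => a i * b i * ε i) i) :=
  ((D.a_mem i).1.mul (D.b_mem i).1).mul (D.ε_mem i).1

theorem daa (D : IsotropicData Φ f g o s a b ε) (i : Fin 5) :
    Differentiable ℂ ((fun i => a i ^ 2 * ε i) i) :=
  ((D.a_mem i).1.pow 2).mul (D.ε_mem i).1

end IsotropicData

variable [Fintype ι]

namespace SharedForms

theorem one_le_ord (h : SharedForms Φ N f g V) {k : ι} {z : ℂ} {a b : ℕ} (hz : f k z = 0)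
    (ha : OrdEq (f k) z a) (hb : OrdEq (g k) z b) : (1 : ℤ) ≤ min (a : ℤ) b :=
  le_min (ha.le_of_ordGe (analyticAt_ordGe_one ((h.df k).analyticAt z) hz))
    (hb.le_of_ordGe (analyticAt_ordGe_one ((h.dg k).analyticAt z) ((h.common k z).1 hz)))

variable [DecidableEq ι]

theorem minor_ordGe (h : SharedForms Φ N f g V) {k : ι} {z : ℂ} {a b : ℕ} (hz : f k z = 0)
    (ha : OrdEq (f k) z a) (hb : OrdEq (g k) z b) (i j : ι) :
    OrdGe (pairMinor f g i j) z (if k = i ∨ k = j then min (a : ℤ) b else 1) := by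
  split_ifs with hk
  · have han : ∀ i, OrdGe (f i) z 0 := fun i => ((h.df i).analyticAt z).ordGe
    have hbn : ∀ i, OrdGe (g i) z 0 := fun i => ((h.dg i).analyticAt z).ordGe
    rcases hk with rfl | rfl
    · exact ((ha.ordGe.mul (hbn j)).mono (by simp)).sub (((han j).mul hb.ordGe).mono (by simp))
    · exact (((han i).mul hb.ordGe).mono (by simp)).sub ((ha.ordGe.mul (hbn i)).mono (by simp))
  · exact analyticAt_ordGe_one ((h.dP _ _).analyticAt z) (h.minor_zero k z hz _ _)

theorem minor_ordEq (h : SharedForms Φ N f g V) (hE : IsDenominator f g E)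
    (hEd : Differentiable ℂ E) {k : ι} {z : ℂ} (hEz : E z ≠ 0) {a b : ℕ} (hz : f k z = 0)
    (ha : OrdEq (f k) z a) (hb : OrdEq (g k) z b) {i j : ι} (hij : i ≠ j) :
    OrdEq (pairMinor f g i j) z (if k = i ∨ k = j then min (a : ℤ) b else 1) := by
  obtain ⟨m, hm⟩ := exists_ordEq (h.dP i j) (h.minor_ne i j hij) z
  have h1 := hm.le_of_ordGe (h.minor_ordGe hz ha hb i j)
  have h2 := (((hEd.analyticAt z).ordEq hEz).mul hm.inv).le_of_ordGe ((hE i j hij z).2 k a b hz ha hb)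
  convert hm using 1
  split_ifs at h1 h2 ⊢ <;> omega

end SharedForms

namespace IsotropicData
variable {o : ι} {s : Fin 5 → ι} {a b ε : Fin 5 → ℂ → ℂ}

theorem vanish_of_formP_eq_zero [DecidableEq ι] (D : IsotropicData Φ f g o s a b ε)
    (h : SharedForms Φ N f g V) (hq : IsSide Φ f g q) (hE : IsDenominator f g E)
    (hEd : Differentiable ℂ E) (h0 : ∀ᶠ z in codiscrete ℂ, formP f g q o s b ε z = 0) (i : Fin 5)
    {z : ℂ} (hz : f (s i) z = 0) : (E * (b i ^ 2 * ε i)) z = 0 := by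
  by_cases hEz : E z = 0
  · simp [hEz]
  obtain ⟨x, hx⟩ := exists_ordEq (h.df (s i)) (h.f0 _) z
  obtain ⟨y, hy⟩ := exists_ordEq (h.dg (s i)) (h.g0 _) z
  obtain ⟨m, hm⟩ := exists_ordEq (hq.dq (s i)) (hq.q0 _) z
  have hle := hq.min_le _ _ _ _ _ hx hy hm
  have h1 := sum_residue_eq_zero (z := z) (m := fun j => if j = i then (m : ℤ) else 0)
    (k := fun j => if j = i then min (x : ℤ) y else 1) D.dbb (fun j => Or.inr ⟨?_, ?_⟩) h0
  · have s1 : ∑ j, b j z ^ 2 * ε j z = 0 := by simpa using congrFun D.sum_bb z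
    have h2 : ∑ j, (b j z ^ 2 * ε j z) * (if j = i then (m : ℂ) - (min (x : ℤ) y : ℤ) + 1 else 0) =
        0 := by
      refine Eq.trans ?_ ((congrArg₂ (· + ·) h1 s1).trans (add_zero 0))
      simp only [← Finset.sum_add_distrib]
      refine Finset.sum_congr rfl fun j _ => ?_
      simp only [Pi.mul_apply, Pi.pow_apply]
      split_ifs <;> push_cast <;> ring
    simp only [mul_ite, mul_zero, Finset.sum_ite_eq', Finset.mem_univ, if_true] at h2
    have h3 : (m : ℂ) - (min (x : ℤ) y : ℤ) + 1 ≠ 0 := by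
      have : (m : ℤ) - min (x : ℤ) y + 1 ≠ 0 := by omega
      exact_mod_cast this
    have h4 := (mul_eq_zero.1 h2).resolve_right h3
    simp [h4]
  · by_cases hj : j = i
    · subst hj; simpa using hm
    · simp only [hj, if_false]
      exact ((hq.dq _).analyticAt z).ordEq fun h2 =>
        hj (D.inj (h.sep _ _ _ ((hq.zero_iff _ _).1 h2) hz))
  · have := h.minor_ordEq hE hEd hEz hz hx hy (D.ne j)
    have hiff : (s i = s j ∨ s i = o) ↔ j = i := by
      constructor
      · rintro (h2 | h2)
        · exact (D.inj h2).symm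
        · exact absurd h2 (D.ne i)
      · rintro rfl; exact Or.inl rfl
    simpa only [hiff] using this

/-- The polarised discriminant of the logarithmic forms of the two sides. -/
def theta (f g : ι → ℂ → ℂ) (o : ι) (s : Fin 5 → ι) (a b ε : Fin 5 → ℂ → ℂ) : ℂ → ℂ :=
  formR f g g s a ε * formP f g f o s b ε - formQ f g g o s a b ε * formQ f g f o s a b ε -
    formQ f g g o s a b ε * formQ f g f o s a b ε + formP f g g o s b ε * formR f g f s a ε

theorem smallMer_theta (D : IsotropicData Φ f g o s a b ε) (h : SharedForms Φ N f g V) :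
    SmallMer Φ (theta f g o s a b ε) := by
  have hf := h.isSide_left o
  have hg := h.isSide_right o
  have hQ := (D.smallMer_formQ h hg).mul (D.smallMer_formQ h hf)
  exact ((((D.smallMer_formR h hg).mul (D.smallMer_formP h hf)).sub hQ).sub hQ).add
    ((D.smallMer_formP h hg).mul (D.smallMer_formR h hf))

theorem theta_eq (D : IsotropicData Φ f g o s a b ε) (h : SharedForms Φ N f g V) :
    ∀ᶠ z in codiscrete ℂ,
      theta f g o s a b ε z = (pairMinor f g (s 1) o z * pairMinor f g (s 0) o z *
        (pairMinor f g (s 1) (s 0) z)⁻¹ * (f o z * g o z)⁻¹) ^ 2 *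
          (formP f g f o s b ε z * formP f g g o s b ε z) ∧
      theta f g o s a b ε z = (pairMinor f g (s 1) (s 0) z * pairMinor f g (s 0) o z *
        (pairMinor f g (s 1) o z)⁻¹ * (f (s 0) z * g (s 0) z)⁻¹) ^ 2 *
          (formR f g f s a ε z * formR f g g s a ε z) := by
  have hP : ∀ i j, i ≠ j → ∀ᶠ z in codiscrete ℂ, pairMinor f g i j z ≠ 0 := fun i j hij =>
    eventually_ne_zero_codiscrete (h.dP i j) (h.minor_ne i j hij)
  have hfe : ∀ i, ∀ᶠ z in codiscrete ℂ, f i z ≠ 0 ∧ g i z ≠ 0 := fun i =>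
    (eventually_ne_zero_codiscrete (h.df i) (h.f0 i)).and
      (eventually_ne_zero_codiscrete (h.dg i) (h.g0 i))
  filter_upwards [D.forms_eq h (h.isSide_left o), D.forms_eq h (h.isSide_right o), hP _ _ (D.ne 0),
    hP _ _ (D.ne 1), hP _ _ (D.inj.ne (show (1 : Fin 5) ≠ 0 by decide)), hfe (s 0), hfe o]
    with z z1 z2 z3 z4 z5 ⟨z6, z7⟩ ⟨z8, z9⟩
  simp only [theta, Pi.add_apply, Pi.sub_apply, Pi.mul_apply]
  rw [← z1.1, ← z1.2, ← z2.1, ← z2.2]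
  have hm : pairMinor f g (s 0) o z = f (s 0) z * g o z - f o z * g (s 0) z := rfl
  rw [hm]
  constructor
  · field_simp
    ring
  · field_simp
    ring

theorem formP_ordGe_neg_one (D : IsotropicData Φ f g o s a b ε) (h : SharedForms Φ N f g V)
    (hq : IsSide Φ f g q) (z : ℂ) : OrdGe (formP f g q o s b ε) z (-1) :=
  logForm_ordGe_neg_one D.dbb (fun _ => hq.dq _) (fun _ => h.dP _ _) z

theorem formR_ordGe_neg_one (D : IsotropicData Φ f g o s a b ε) (h : SharedForms Φ N f g V)
    (hq : IsSide Φ f g q) (z : ℂ) : OrdGe (formR f g q s a ε) z (-1) :=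
  logForm_ordGe_neg_one D.daa (fun _ => hq.dq _) (fun _ => h.dP _ _) z

theorem mul_forms_ordGe [DecidableEq ι] (D : IsotropicData Φ f g o s a b ε)
    (h : SharedForms Φ N f g V) (hq : IsSide Φ f g q) (hE : IsDenominator f g E)
    (hEd : Differentiable ℂ E) {z : ℂ} (hz : ∀ k, f k z ≠ 0) :
    OrdGe (E * formP f g q o s b ε) z 0 ∧ OrdGe (E * formQ f g q o s a b ε) z 0 ∧
      OrdGe (E * formR f g q s a ε) z 0 := by
  have hqz : ∀ k, q k z ≠ 0 := fun k hk => hz k ((hq.zero_iff k z).1 hk)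
  refine ⟨mul_logForm_ordGe hEd D.dbb (fun _ => hq.dq _) (fun _ => h.dP _ _) (fun _ => hqz _)
    fun i => Or.inr ((hE _ _ (D.ne i) z).1 hz), mul_logForm_ordGe hEd D.dab (fun _ => hq.dq _)
    (fun _ => h.dP _ _) (fun _ => hqz _) fun i => Or.inr ((hE _ _ (D.ne i) z).1 hz),
    mul_logForm_ordGe hEd D.daa (fun _ => hq.dq _)
    (fun _ => h.dP _ _) (fun _ => hqz _) fun i => ?_⟩
  by_cases i0 : i = 0
  · left
    simp [i0, D.a_zero]
  · exact Or.inr ((hE _ _ (D.inj.ne i0) z).1 hz)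

theorem formR_ordGe_zero [DecidableEq ι] (D : IsotropicData Φ f g o s a b ε)
    (h : SharedForms Φ N f g V) (hq : IsSide Φ f g q) (hE : IsDenominator f g E)
    (hEd : Differentiable ℂ E) {z : ℂ} (hz : f o z = 0) (hEz : E z ≠ 0) :
    OrdGe (formR f g q s a ε) z 0 := by
  obtain ⟨x, hx⟩ := exists_ordEq (h.df o) (h.f0 _) z
  obtain ⟨y, hy⟩ := exists_ordEq (h.dg o) (h.g0 _) z
  refine (logForm_sub_residue_ordGe (q := fun i => q (s i))
    (P := fun i => pairMinor f g (s i) (s 0)) (z := z) (m := fun _ => 0) (k := fun _ => 1) D.daa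
    fun i => ?_).congr (.of_forall fun w => ?_)
  · by_cases i0 : i = 0
    · left
      simp [i0, D.a_zero]
    refine Or.inr ⟨((hq.dq _).analyticAt z).ordEq fun h2 =>
      D.ne i (h.sep _ _ _ ((hq.zero_iff _ _).1 h2) hz), ?_⟩
    have := h.minor_ordEq hE hEd hEz hz hx hy (D.inj.ne i0)
    rwa [if_neg (by simp [(D.ne _).symm])] at this
  · have s1 : ∑ j, a j w ^ 2 * ε j w = 0 := by simpa using congrFun D.sum_aa w
    simp [s1, formR]

theorem theta_ordGe [DecidableEq ι] (D : IsotropicData Φ f g o s a b ε)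
    (h : SharedForms Φ N f g V) (hE : IsDenominator f g E) (hEd : Differentiable ℂ E) (z : ℂ) :
    OrdGe (E ^ 2 * theta f g o s a b ε) z 0 ∧
      (f o z = 0 → E z ≠ 0 → OrdGe (E ^ 2 * theta f g o s a b ε) z 1) := by
  have hf := h.isSide_left o
  have hg := h.isSide_right o
  by_cases hz : ∀ k, f k z ≠ 0
  · refine ⟨?_, fun h0 => absurd h0 (hz o)⟩
    obtain ⟨f1, f2, f3⟩ := D.mul_forms_ordGe h hf hE hEd hz
    obtain ⟨g1, g2, g3⟩ := D.mul_forms_ordGe h hg hE hEd hz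
    have h1 := (((g3.mul f1).sub (g2.mul f2)).sub (g2.mul f2)).add (g1.mul f3)
    refine (h1.mono (by simp)).congr (.of_forall fun w => ?_)
    simp only [theta, Pi.add_apply, Pi.sub_apply, Pi.mul_apply, Pi.pow_apply]
    ring
  push Not at hz
  obtain ⟨k, hk⟩ := hz
  obtain ⟨x, hx⟩ := exists_ordEq (h.df k) (h.f0 _) z
  obtain ⟨y, hy⟩ := exists_ordEq (h.dg k) (h.g0 _) z
  have hxy := h.one_le_ord hk hx hy
  have hunit : ∀ i, i ≠ k → OrdEq ((f i * g i)⁻¹) z 0 := fun i hi => by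
    have hfi : f i z ≠ 0 := fun h0 => hi (h.sep _ _ _ h0 hk)
    exact ((((h.df i).analyticAt z).ordEq hfi).mul
      (((h.dg i).analyticAt z).ordEq fun h1 => hfi ((h.common i z).2 h1))).inv
  have h10 : s 1 ≠ s 0 := D.inj.ne (by decide)
  by_cases hko : k = o
  · subst hko
    have h1 := (((hE _ _ (D.ne 1) z).2 k x y hk hx hy).mul ((h.minor_ordGe hk hx hy (s 1) (s 0)).mul
      (h.minor_ordGe hk hx hy (s 0) k))).mul (hunit _ (D.ne 0)).ordGe
    rw [if_pos (Or.inr rfl), if_neg (by simp [(D.ne _).symm]), if_pos (Or.inr rfl)] at h1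
    have h2 := h1.mul h1
    have main : ∀ m : ℤ, OrdGe (formR f g f s a ε) z m → OrdGe (formR f g g s a ε) z m →
        OrdGe (E ^ 2 * theta f g k s a b ε) z (2 + 2 * m) := by
      intro m hm1 hm2
      refine ((h2.mul (hm1.mul hm2)).mono (by omega)).congr ?_
      filter_upwards [eventually_codiscrete_iff.1 (D.theta_eq h) z] with w hw
      simp only [Pi.mul_apply, Pi.pow_apply, Pi.inv_apply, hw.2]
      ring
    refine ⟨(main (-1) (D.formR_ordGe_neg_one h hf z) (D.formR_ordGe_neg_one h hg z)).mono
      (by norm_num), fun _ hEz => (main 0 (D.formR_ordGe_zero h hf hE hEd hk hEz)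
        (D.formR_ordGe_zero h hg hE hEd hk hEz)).mono (by norm_num)⟩
  · refine ⟨?_, fun h0 => absurd (h.sep _ _ _ hk h0) hko⟩
    have h1 := (((hE _ _ h10 z).2 k x y hk hx hy).mul ((h.minor_ordGe hk hx hy (s 1) o).mul
      (h.minor_ordGe hk hx hy (s 0) o))).mul (hunit _ (Ne.symm hko)).ordGe
    have h2 := h1.mono (k := 1) (by split_ifs <;> first | omega | (exfalso; tauto))
    refine (((h2.mul h2).mul ((D.formP_ordGe_neg_one h hf z).mul
      (D.formP_ordGe_neg_one h hg z))).mono (by norm_num)).congr ?_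
    filter_upwards [eventually_codiscrete_iff.1 (D.theta_eq h) z] with w hw
    simp only [Pi.mul_apply, Pi.pow_apply, Pi.inv_apply, hw.1]
    ring

end IsotropicData

theorem SharedForms.hasSmallMultiple (h : SharedForms Φ N f g V) (hN : 1 ≤ N)
    (e₀ : Fin (N + 1) × Fin 2 ≃ ι) {o : ι} {s : Fin 5 → ι} (hs : Function.Injective s)
    (ho : ∀ i, s i ≠ o) :
    HasSmallMultiple Φ (f o) ∨ ∃ i₀, ∀ i, i ≠ i₀ → HasSmallMultiple Φ (f (s i)) := by
  classical
  obtain ⟨a, b, ε, D⟩ := h.exists_isotropicData hN e₀ hs ho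
  obtain ⟨E, hEs, hE0, hE⟩ := h.exists_common_denominator hN e₀
  replace hE : IsDenominator f g E := hE
  have hEd := hEs.1
  have hΘ := D.smallMer_theta h
  have hm : SmallMer Φ (E * (E ^ 2 * IsotropicData.theta f g o s a b ε)) :=
    hEs.2.mul ((hEs.2.pow 2).mul hΘ)
  have hord := D.theta_ordGe h hE hEd
  obtain ⟨u, hu, huc, hun, -⟩ := exists_entire_of_order_nonneg hm.mer fun z => by
    simpa using (((hEd.analyticAt z).ordGe.mul (hord z).1)).meromorphicOrderAt_ge.2
  by_cases hu0 : u = 0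
  · right
    have h1 : (∀ᶠ z in codiscrete ℂ, IsotropicData.formP f g f o s b ε z = 0) ∨
        ∀ᶠ z in codiscrete ℂ, IsotropicData.formP f g g o s b ε z = 0 := by
      rcases Meromorphic.eventually_eq_zero_or_ne_zero (D.smallMer_formP h (h.isSide_left o)).mer
        with h1 | h1
      · exact Or.inl h1
      right
      filter_upwards [h1, huc, D.theta_eq h, eventually_ne_zero_codiscrete hEd hE0,
        eventually_ne_zero_codiscrete (h.dP _ _) (h.minor_ne _ _ (D.ne 0)),
        eventually_ne_zero_codiscrete (h.dP _ _) (h.minor_ne _ _ (D.ne 1)),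
        eventually_ne_zero_codiscrete (h.dP _ _)
          (h.minor_ne _ _ (D.inj.ne (show (1 : Fin 5) ≠ 0 by decide))),
        eventually_ne_zero_codiscrete (h.df o) (h.f0 o),
        eventually_ne_zero_codiscrete (h.dg o) (h.g0 o)] with z z1 z2 z3 z4 z5 z6 z7 z8 z9
      simp only [hu0, Pi.mul_apply, Pi.pow_apply, z3.1] at z2
      simpa [z1, z4, z5, z6, z7, z8, z9] using z2
    obtain ⟨i₀, hi₀⟩ := D.ε_ne
    refine ⟨i₀, fun i hi => ⟨E * (b i ^ 2 * ε i),
      mul_mem hEs (mul_mem (pow_mem (D.b_mem i) 2) (D.ε_mem i)), ?_, fun z hz => ?_⟩⟩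
    · rw [pow_two]
      exact entire_mul_ne_zero hEd (((D.b_mem i).1.mul (D.b_mem i).1).mul (D.ε_mem i).1) hE0
        (entire_mul_ne_zero ((D.b_mem i).1.mul (D.b_mem i).1) (D.ε_mem i).1
          (entire_mul_ne_zero (D.b_mem i).1 (D.b_mem i).1 (D.b_ne i) (D.b_ne i)) (hi₀ i hi))
    · rcases h1 with h1 | h1
      · exact D.vanish_of_formP_eq_zero h (h.isSide_left o) hE hEd h1 i hz
      · exact D.vanish_of_formP_eq_zero h (h.isSide_right o) hE hEd h1 i hz
  · refine Or.inl ⟨u, ⟨hu, hm.congr hu.meromorphic' huc⟩, hu0, fun z hz => ?_⟩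
    have h1 : OrdGe (E * (E ^ 2 * IsotropicData.theta f g o s a b ε)) z 1 := by
      by_cases hEz : E z = 0
      · simpa using (analyticAt_ordGe_one (hEd.analyticAt z) hEz).mul (hord z).1
      · simpa using ((hEd.analyticAt z).ordGe).mul ((hord z).2 hz hEz)
    exact (h1.congr (hun z)).eq_zero hu.continuous.continuousAt

end

section
variable {n q : ℕ} {H : Fin q → Fin (n + 1) → ℂ} {f : Fin (n + 1) → ℂ → ℂ} {v : Fin q → ℂ → ℂ}

/-- A Wronskian divided by separated linear forms loses all its poles when it is multiplied by
the `n`-th powers of entire multiples of these forms. -/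
theorem GenPos.wron_mul_prod_ordGe (hH : GenPos n q H) (hf : ∀ i, Differentiable ℂ (f i))
    (hf0 : ∀ k, lform (H k) f ≠ 0)
    (hsep : ∀ i j z, lform (H i) f z = 0 → lform (H j) f z = 0 → i = j)
    (hq : n + 1 ≤ q) {Q : Finset (Fin q)} (hv : ∀ k ∈ Q, Differentiable ℂ (v k))
    (hvf : ∀ k ∈ Q, ∀ z, lform (H k) f z = 0 → v k z = 0) (z : ℂ) :
    OrdGe (wron f * ∏ k ∈ Q, (v k ^ n * (lform (H k) f)⁻¹)) z 0 := by
  classical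
  have hdF := fun k => lform_differentiable (H k) hf
  have hne : ∀ k ∈ Q, lform (H k) f z ≠ 0 → OrdGe (v k ^ n * (lform (H k) f)⁻¹) z 0 := by
    intro k hk h
    exact (((hv k hk).analyticAt z).pow n).ordGe.mul
      (((hdF k).analyticAt z).ordEq h).inv.ordGe
  by_cases hz : ∃ k₀ ∈ Q, lform (H k₀) f z = 0
  · obtain ⟨k₀, hk₀, h0⟩ := hz
    obtain ⟨m, hm⟩ := exists_ordEq (hdF k₀) (hf0 k₀) z
    have hp : OrdGe (∏ k ∈ Q, (v k ^ n * (lform (H k) f)⁻¹)) z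
        (∑ k ∈ Q, if k = k₀ then ((n : ℤ) - m) else 0) := by
      refine OrdGe.prod fun k hk => ?_
      split_ifs with h
      · subst h
        have h1 : OrdGe (v k ^ n) z n := by
          have := OrdGe.prod (s := (Finset.univ : Finset (Fin n))) (u := fun _ => v k)
            (m := fun _ => 1) fun _ _ => analyticAt_ordGe_one ((hv k hk).analyticAt z) (hvf k hk z h0)
          simpa using this
        exact (h1.mul hm.inv.ordGe).mono (by omega)
      · exact hne k hk fun h' => h (hsep _ _ z h' h0)
    refine ((hH.wron_ordGe hf hq k₀ hm.ordGe).mul hp).mono ?_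
    simp [hk₀]
  · push Not at hz
    have hp := OrdGe.prod (s := Q) (m := fun _ => 0) fun k hk => hne k hk (hz k hk)
    exact (((wron_differentiable hf).analyticAt z).ordGe.mul hp).mono (by simp)

theorem ReducedRepr.continuous_log_norm (hf : ReducedRepr n f) :
    Continuous fun z => Real.log ‖fun i => f i z‖ := by
  refine Continuous.log (Continuous.norm (continuous_pi fun i => (hf.1 i).continuous)) fun z => ?_
  obtain ⟨i, hi⟩ := hf.2 z
  exact norm_ne_zero_iff.2 fun h => hi (congrFun h i)

/-- If sufficiently many of the separated linear forms divide small entire functions, the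
characteristic function is negligible. -/
theorem GenPos.negl_circleAverage_log_norm {Φ : ℂ → ℝ} (hH : GenPos n q H) (hf : ReducedRepr n f)
    (hf0 : ∀ k, lform (H k) f ≠ 0)
    (hsep : ∀ i j z, lform (H i) f z = 0 → lform (H j) f z = 0 → i = j)
    (hW : wron f ≠ 0)
    (hsmall : ∀ κ : Fin (n + 1) → Fin q, SmallMer Φ (wronQuot fun j => lform (H (κ j)) f))
    {Q : Finset (Fin q)} (hQ : Q.card = n + 1 + 1)
    (hQs : ∀ k ∈ Q, HasSmallMultiple Φ (lform (H k) f)) :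
    Negl Φ (Real.circleAverage (fun z => Real.log ‖fun i => f i z‖) 0) := by
  classical
  have hdF := fun k => lform_differentiable (H k) hf.1
  have hex : ∀ k, ∃ v : ℂ → ℂ, k ∈ Q → v ∈ smallRing Φ ∧ v ≠ 0 ∧
      ∀ z, lform (H k) f z = 0 → v z = 0 := by
    intro k
    by_cases hk : k ∈ Q
    · obtain ⟨v, h⟩ := hQs k hk
      exact ⟨v, fun _ => h⟩
    · exact ⟨0, fun h => absurd h hk⟩
  choose v hv using hex
  have hq : n + 1 ≤ q := by
    have := Finset.card_le_univ Q
    rw [Fintype.card_fin] at this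
    omega
  set P : ℂ → ℂ := ∏ k ∈ Q, v k ^ n with hP
  set Z : ℂ → ℂ := wron f * ∏ k ∈ Q, (v k ^ n * (lform (H k) f)⁻¹) with hZ
  have hdv : ∀ k ∈ Q, Differentiable ℂ (v k) := fun k hk => (hv k hk).1.1
  have hPs : SmallMer Φ P := SmallMer.prod fun k hk => (hv k hk).1.2.pow n
  have hZord : ∀ z, OrdGe Z z 0 := hH.wron_mul_prod_ordGe hf.1 hf0 hsep hq hdv
    fun k hk => (hv k hk).2.2
  have hZmer : Meromorphic Z := fun z => (hZord z).meromorphicOrderAt_ge.1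
  have hZ0 : ∀ᶠ z in codiscrete ℂ, Z z ≠ 0 := by
    filter_upwards [eventually_ne_zero_codiscrete (wron_differentiable hf.1) hW,
      eventually_all.2 fun k => eventually_ne_zero_codiscrete (hdF k) (hf0 k),
      (eventually_all_finset Q).2 fun k hk =>
        eventually_ne_zero_codiscrete (hdv k hk) (hv k hk).2.1] with z h1 h2 h3
    simp only [hZ, Pi.mul_apply, Finset.prod_apply, Pi.pow_apply, Pi.inv_apply]
    exact mul_ne_zero h1 (Finset.prod_ne_zero_iff.2 fun k hk =>
      mul_ne_zero (pow_ne_zero _ (h3 k hk)) (inv_ne_zero (h2 k)))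
  obtain ⟨C, hC, hCf⟩ := hH.exists_wron_bound hf.1 Q hQ
  set w : (Fin (n + 1) → Fin q) → ℂ → ℂ := fun κ => (wronQuot fun j => lform (H (κ j)) f) * P
  have hw : ∀ κ, SmallMer Φ (w κ) := fun κ => (hsmall κ).mul hPs
  have hle : ∀ᶠ z in codiscrete ℂ, ‖fun i => f i z‖ * ‖Z z‖ ≤ C * ∑ κ, ‖w κ z‖ := by
    filter_upwards [eventually_all.2 fun k => eventually_ne_zero_codiscrete (hdF k) (hf0 k)]
      with z hz
    have h1 := hCf z hz
    have hp : 0 < ∏ k ∈ Q, ‖lform (H k) f z‖ := Finset.prod_pos fun k _ => norm_pos_iff.2 (hz k)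
    have h2 : ‖Z z‖ = ‖wron f z‖ * ‖P z‖ / ∏ k ∈ Q, ‖lform (H k) f z‖ := by
      simp only [hZ, hP, Pi.mul_apply, Finset.prod_apply, Pi.pow_apply, Pi.inv_apply, norm_mul,
        norm_prod, norm_inv, norm_pow, Finset.prod_mul_distrib, Finset.prod_inv_distrib]
      rw [div_eq_mul_inv, mul_assoc]
    have h3 : ∑ κ, ‖w κ z‖ =
        (∑ κ : Fin (n + 1) → Fin q, ‖wronQuot (fun j => lform (H (κ j)) f) z‖) * ‖P z‖ := by
      rw [Finset.sum_mul]
      simp [w]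
    rw [h2, h3, ← mul_div_assoc, div_le_iff₀ hp]
    rw [pow_one] at h1
    calc _ = (‖fun i => f i z‖ * ‖wron f z‖) * ‖P z‖ := by ring
      _ ≤ _ := mul_le_mul_of_nonneg_right h1 (norm_nonneg _)
      _ = _ := by ring
  set c := Real.posLog C + Real.log (Finset.univ : Finset (Fin (n + 1) → Fin q)).card
  set D := Real.log ‖meromorphicTrailingCoeffAt Z 0‖
  have hneg : Negl Φ (fun r => (c - D) + ∑ κ, ValueDistribution.proximity (w κ) ⊤ r) := by
    have hsum : ∀ s : Finset (Fin (n + 1) → Fin q),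
        Negl Φ (fun r => ∑ κ ∈ s, ValueDistribution.proximity (w κ) ⊤ r) := by
      intro s
      induction s using Finset.induction_on with
      | empty => simpa using Negl.const Φ 0
      | insert i s hi ih =>
        simp only [Finset.sum_insert hi]
        exact (hw i).negl.add ih
    exact (Negl.const Φ (c - D)).add (hsum Finset.univ)
  refine hneg.mono ?_
  filter_upwards [eventually_goodRadius Φ] with r hr
  have hr0 : r ≠ 0 := by linarith [hr.one_le] |> fun h : (0:ℝ) < r => h.ne'
  have hZr : D ≤ Real.circleAverage (fun z => Real.log ‖Z z‖) 0 r :=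
    le_circleAverage_log_norm hZmer (fun z => by simpa using (hZord z).meromorphicOrderAt_ge.2)
      hr.one_le
  simp only [ValueDistribution.proximity_top]
  have hi : ∀ i ∈ Finset.univ, CircleIntegrable (fun z => Real.posLog ‖w i z‖) 0 r :=
    fun i _ => circleIntegrable_posLog_norm_of_meromorphic (hw i).mer r
  have hs : CircleIntegrable (fun z => ∑ i, Real.posLog ‖w i z‖) 0 r := CircleIntegrable.fun_sum _ hi
  have hc : CircleIntegrable (fun _ : ℂ => c) 0 r := circleIntegrable_const c 0 r
  have hlf : CircleIntegrable (fun z => Real.log ‖fun i => f i z‖) 0 r :=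
    hf.continuous_log_norm.continuousOn.circleIntegrable'
  have hlZ := circleIntegrable_log_norm_of_meromorphic hZmer r
  have hmono : Real.circleAverage
      ((fun z => Real.log ‖fun i => f i z‖) + fun z => Real.log ‖Z z‖) 0 r ≤
      Real.circleAverage ((fun _ => c) + fun z => ∑ i, Real.posLog ‖w i z‖) 0 r := by
    refine circleAverage_mono_codiscrete hr0 (hlf.add hlZ) (hc.add hs) ?_
    filter_upwards [hle, hZ0] with z hz hz0
    have hfz : 0 < ‖fun i => f i z‖ := by
      obtain ⟨i, hi⟩ := hf.2 z
      exact norm_pos_iff.2 fun h => hi (congrFun h i)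
    simp only [Pi.add_apply]
    rw [← Real.log_mul hfz.ne' (norm_ne_zero_iff.2 hz0)]
    refine (le_max_right 0 (Real.log _)).trans ?_
    refine (Real.posLog_le_posLog (by positivity) hz).trans ?_
    refine Real.posLog_mul.trans ?_
    have := Real.posLog_sum Finset.univ (fun i => ‖w i z‖)
    simp only [c]
    linarith
  rw [Real.circleAverage_add hlf hlZ, Real.circleAverage_add hc hs, Real.circleAverage_const,
    Real.circleAverage_fun_sum hi] at hmono
  linarith

end

section
variable {n q : ℕ} {H : Fin q → Fin (n + 1) → ℂ} {f g : Fin (n + 1) → ℂ → ℂ}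

/-- The linear form with coefficients `a` in the variables `x i`. -/
def linearPoly {σ : Type*} (a : Fin (n + 1) → ℂ) (x : Fin (n + 1) → σ) : MvPolynomial σ ℂ :=
  ∑ i, MvPolynomial.C (a i) * MvPolynomial.X (x i)

theorem eval_linearPoly {σ : Type*} (a : Fin (n + 1) → ℂ) (x : Fin (n + 1) → σ) (v : σ → ℂ) :
    MvPolynomial.eval v (linearPoly a x) = ∑ i, a i * v (x i) := by
  simp [linearPoly]

theorem linearPoly_isWeightedHomogeneous {σ : Type*} (a : Fin (n + 1) → ℂ) (x : Fin (n + 1) → σ)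
    {w : σ → ℕ} {d : ℕ} (h : ∀ i, w (x i) = d) :
    MvPolynomial.IsWeightedHomogeneous w (linearPoly a x) d := by
  refine MvPolynomial.IsWeightedHomogeneous.sum _ _ _ fun i _ => ?_
  have := (MvPolynomial.isWeightedHomogeneous_C w (a i)).mul
    (MvPolynomial.isWeightedHomogeneous_X ℂ w (x i))
  rwa [zero_add, h i] at this

theorem AlgDeg.of_linear_left {a : Fin (n + 1) → ℂ} (ha : a ≠ 0) (h : ∀ z, ∑ i, a i * f i z = 0) :
    AlgDeg f g := by
  obtain ⟨i, hi⟩ := Function.ne_iff.1 ha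
  refine ⟨linearPoly a Sum.inl, fun h0 => hi ?_, ⟨1, linearPoly_isWeightedHomogeneous a _ fun _ => rfl⟩,
    ⟨0, linearPoly_isWeightedHomogeneous a _ fun _ => rfl⟩, fun z => ?_⟩
  · have := congrArg (MvPolynomial.eval (Sum.elim (Pi.single i 1) 0)) h0
    simpa [eval_linearPoly, Pi.single_apply] using this
  · rw [eval_linearPoly]
    exact h z

theorem AlgDeg.of_linear_right {a : Fin (n + 1) → ℂ} (ha : a ≠ 0) (h : ∀ z, ∑ i, a i * g i z = 0) :
    AlgDeg f g := by
  obtain ⟨i, hi⟩ := Function.ne_iff.1 ha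
  refine ⟨linearPoly a Sum.inr, fun h0 => hi ?_, ⟨0, linearPoly_isWeightedHomogeneous a _ fun _ => rfl⟩,
    ⟨1, linearPoly_isWeightedHomogeneous a _ fun _ => rfl⟩, fun z => ?_⟩
  · have := congrArg (MvPolynomial.eval (Sum.elim 0 (Pi.single i 1))) h0
    simpa [eval_linearPoly, Pi.single_apply] using this
  · rw [eval_linearPoly]
    exact h z

theorem AlgDeg.of_bilinear {a b : Fin (n + 1) → ℂ} (hab : LinearIndependent ℂ ![a, b])
    (h : ∀ z, lform a f z * lform b g z - lform b f z * lform a g z = 0) : AlgDeg f g := by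
  obtain ⟨i, j, hij⟩ : ∃ i j, a i * b j - b i * a j ≠ 0 := by
    by_contra! hcon
    rw [LinearIndependent.pair_iff] at hab
    have ha : a ≠ 0 := by
      rintro rfl
      simpa using hab 1 0 (by simp)
    obtain ⟨i, hi⟩ := Function.ne_iff.1 ha
    have := (hab (-b i) (a i) (by ext j; simpa [add_comm, sub_eq_add_neg] using hcon i j)).2
    exact hi this
  have hw (a : Fin (n + 1) → ℂ) (b : Fin (n + 1) → ℂ) :
      MvPolynomial.IsWeightedHomogeneous
        (Sum.elim (fun _ => 1) (fun _ => 0) : Fin (n + 1) ⊕ Fin (n + 1) → ℕ)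
        (linearPoly a Sum.inl * linearPoly b Sum.inr) 1 :=
    (linearPoly_isWeightedHomogeneous a (d := 1) Sum.inl fun _ => rfl).mul
      (linearPoly_isWeightedHomogeneous b (d := 0) Sum.inr fun _ => rfl)
  have hw' (a : Fin (n + 1) → ℂ) (b : Fin (n + 1) → ℂ) :
      MvPolynomial.IsWeightedHomogeneous
        (Sum.elim (fun _ => 0) (fun _ => 1) : Fin (n + 1) ⊕ Fin (n + 1) → ℕ)
        (linearPoly a Sum.inl * linearPoly b Sum.inr) 1 :=
    (linearPoly_isWeightedHomogeneous a (d := 0) Sum.inl fun _ => rfl).mul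
      (linearPoly_isWeightedHomogeneous b (d := 1) Sum.inr fun _ => rfl)
  refine ⟨linearPoly a Sum.inl * linearPoly b Sum.inr - linearPoly b Sum.inl * linearPoly a Sum.inr,
    fun h0 => hij ?_, ⟨1, (hw a b).sub (hw b a)⟩, ⟨1, (hw' a b).sub (hw' b a)⟩, fun z => ?_⟩
  · have := congrArg (MvPolynomial.eval (Sum.elim (Pi.single i 1) (Pi.single j 1))) h0
    simpa [eval_linearPoly, Pi.single_apply] using this
  · simp only [map_sub, map_mul, eval_linearPoly]
    exact h z

theorem GenPos.linearIndependent_pair (hH : GenPos n q H) (hn : 1 ≤ n) (hq : n + 1 ≤ q)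
    {i j : Fin q} (hij : i ≠ j) : LinearIndependent ℂ ![H i, H j] := by
  classical
  obtain ⟨s, hs, -, hc⟩ := Finset.exists_subsuperset_card_eq (s := {i, j}) (t := Finset.univ)
    (n := n + 1) (Finset.subset_univ _) (by rw [Finset.card_pair hij]; omega) (by simpa using hq)
  have hi : i ∈ s := hs (by simp)
  have hj : j ∈ s := hs (by simp)
  have := (hH s hc).comp (![⟨i, hi⟩, ⟨j, hj⟩] : Fin 2 → s) (by
    intro x y hxy
    fin_cases x <;> fin_cases y <;> simp_all)
  convert this using 1
  ext x y
  fin_cases x <;> rfl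

/-- An entire function bounded by `exp Φ` and vanishing at the origin bounds the mean of `Φ` from
below by the logarithm of the radius. -/
theorem log_sub_le_circleAverage {Φ : ℂ → ℝ} (hΦ : Continuous Φ) {A : ℂ → ℂ}
    (hA : Differentiable ℂ A) (hA0 : A ≠ 0) (h0 : A 0 = 0) (hb : DegBdd Φ 1 A) :
    ∃ C, ∀ r, 1 ≤ r → Real.log r - C ≤ Real.circleAverage Φ 0 r := by
  obtain ⟨a, -, ha⟩ := hb
  have hu : Differentiable ℂ (dslope A 0) := by
    rw [← differentiableOn_univ, Complex.differentiableOn_dslope univ_mem]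
    exact hA.differentiableOn
  have huA : ∀ z, A z = z * dslope A 0 z := fun z => by
    have := sub_smul_dslope A 0 z
    simpa [h0] using this.symm
  have hu0 : dslope A 0 ≠ 0 := fun h => hA0 (by ext z; rw [huA z, h]; simp)
  refine ⟨a - Real.log ‖meromorphicTrailingCoeffAt (dslope A 0) 0‖, fun r hr => ?_⟩
  have hr0 : r ≠ 0 := by linarith [hr] |> fun h : (0 : ℝ) < r => h.ne'
  have h1 := le_circleAverage_log_norm hu.meromorphic'
    (fun z => (hu.analyticAt z).meromorphicOrderAt_nonneg) hr
  have h2 := circleAverage_log_norm_le hΦ hA hA0 hr0 ha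
  have i1 := circleIntegrable_log_norm_of_meromorphic hu.meromorphic' r
  have i2 := circleIntegrable_const (Real.log r) (0 : ℂ) r
  have h3 : Real.circleAverage ((fun _ => Real.log r) + fun z => Real.log ‖dslope A 0 z‖) 0 r =
      Real.circleAverage ((fun z => Real.log ‖z‖) + fun z => Real.log ‖dslope A 0 z‖) 0 r := by
    refine Real.circleAverage_congr_sphere fun z hz => ?_
    have : ‖z‖ = r := by
      simpa [abs_of_nonneg (by linarith : 0 ≤ r)] using hz
    simp [this]
  have h4 : Real.circleAverage ((fun z => Real.log ‖z‖) + fun z => Real.log ‖dslope A 0 z‖) 0 r ≤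
      Real.circleAverage (fun z => Real.log ‖A z‖) 0 r := by
    refine circleAverage_mono_codiscrete hr0
      ((circleIntegrable_log_norm_of_meromorphic differentiable_id.meromorphic' r).add i1)
      (circleIntegrable_log_norm_of_meromorphic hA.meromorphic' r) ?_
    filter_upwards [eventually_ne_zero_codiscrete hA hA0] with z hz
    rw [huA] at hz ⊢
    rw [norm_mul, Real.log_mul (norm_ne_zero_iff.2 (left_ne_zero_of_mul hz))
      (norm_ne_zero_iff.2 (right_ne_zero_of_mul hz))]
    exact le_rfl
  rw [← h3, Real.circleAverage_add i2 i1, Real.circleAverage_const] at h4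
  push_cast at h2
  linarith

theorem exists_log_sub_le_circleAverage_logSize (hn : 1 ≤ n) (hf : ReducedRepr n f)
    (hg : ReducedRepr n g) (hli : ∀ c : Fin (n + 1) → ℂ, (∀ z, ∑ j, c j * f j z = 0) → c = 0)
    {b : Fin (n + 1) → ℂ} (hb : lform b g ≠ 0) :
    ∃ C, ∀ r, 1 ≤ r → Real.log r - C ≤ Real.circleAverage (logSize f g) 0 r := by
  obtain ⟨a, ha, ha0⟩ : ∃ a : Fin (n + 1) → ℂ, a ≠ 0 ∧ lform a f 0 = 0 := by
    obtain ⟨i, hi⟩ := hf.2 0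
    obtain ⟨j, hj⟩ : ∃ j : Fin (n + 1), j ≠ i := by
      have : Nontrivial (Fin (n + 1)) := Fin.nontrivial_iff_two_le.2 (by omega)
      exact exists_ne i
    refine ⟨Pi.single j (f i 0) - Pi.single i (f j 0), fun h => hi ?_, ?_⟩
    · simpa [hj] using congrFun h j
    · simp [lform, sub_mul, Finset.sum_sub_distrib, Pi.single_apply, mul_comm (f i 0)]
  have hA0 : lform a f ≠ 0 := fun h => ha (hli a fun z => congrFun h z)
  refine log_sub_le_circleAverage (continuous_logSize hf hg)
    ((lform_differentiable a hf.1).mul (lform_differentiable b hg.1))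
    (entire_mul_ne_zero (lform_differentiable a hf.1) (lform_differentiable b hg.1) hA0 hb)
    (by simp [ha0]) (degBdd_lform_mul hf hg a b)

theorem neBot_goodFilter {Φ : ℂ → ℝ} (hΦ : Continuous Φ) {C : ℝ}
    (hC : ∀ r, 1 ≤ r → Real.log r - C ≤ Real.circleAverage Φ 0 r) : (goodFilter Φ).NeBot :=
  Filter.frequently_iff_neBot.1 (frequently_goodRadius hΦ hC)

theorem not_negl_circleAverage {Φ : ℂ → ℝ} (hΦ : Continuous Φ) {C : ℝ}
    (hC : ∀ r, 1 ≤ r → Real.log r - C ≤ Real.circleAverage Φ 0 r) :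
    ¬ Negl Φ (Real.circleAverage Φ 0) := by
  rintro ⟨D, hD⟩
  have := neBot_goodFilter hΦ hC
  have hlim : Tendsto (Real.circleAverage Φ 0) (goodFilter Φ) atTop := by
    refine Tendsto.mono_left ?_ (inf_le_left : goodFilter Φ ≤ atTop)
    apply tendsto_atTop_mono' _ _ (tendsto_atTop_add_const_right _ (-C) Real.tendsto_log_atTop)
    filter_upwards [eventually_ge_atTop 1] with r hr
    linarith [hC r hr]
  have hlog := hlim.eventually (Real.isLittleO_log_id_atTop.bound
    (show (0 : ℝ) < 1 / (2 * (|D| + 1)) by positivity))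
  obtain ⟨r, h1, h2, h3, h4⟩ := (hD.and (hlog.and ((hlim.eventually_ge_atTop (2 * |D| + 1)).and
    (eventually_goodRadius Φ)))).exists
  set T := Real.circleAverage Φ 0 r
  have hT : 1 ≤ T := h4.one_le_avg
  have hl : 0 ≤ Real.log T := Real.log_nonneg hT
  rw [Real.norm_of_nonneg hl, id, Real.norm_of_nonneg (by linarith), div_mul_eq_mul_div, one_mul,
    le_div_iff₀ (by positivity)] at h2
  have h5 : D * (1 + Real.log T) ≤ |D| * (1 + Real.log T) :=
    mul_le_mul_of_nonneg_right (le_abs_self D) (by linarith)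
  linarith

end

section
variable {n q : ℕ} {H : Fin q → Fin (n + 1) → ℂ} {f g : Fin (n + 1) → ℂ → ℂ}

theorem vord_eq_zero_iff {u : ℂ → ℂ} (hu : Differentiable ℂ u) (h0 : u ≠ 0) (z : ℂ) :
    vord u z = 0 ↔ u z ≠ 0 := by
  rw [vord, Nat.sInf_eq_zero]
  refine ⟨fun h => h.elim (fun h => by simpa using h) fun h => absurd ?_ h0,
    fun h => Or.inl (by simpa using h)⟩
  ext w
  rw [← Complex.taylorSeries_eq_of_entire' (c := z) w hu]
  have hz : ∀ k, iteratedDeriv k u z = 0 := fun k => by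
    by_contra hk
    exact (Set.eq_empty_iff_forall_notMem.1 h k) hk
  simp [hz]

theorem lform_eq_mul_of_eq_mul (a : Fin (n + 1) → ℂ) {z c : ℂ} (h : ∀ i, g i z = c * f i z) :
    lform a g z = c * lform a f z := by
  simp only [lform, h, Finset.mul_sum]
  exact Finset.sum_congr rfl fun i _ => by ring

theorem SharesTrunc.lform_eq_zero_iff {a : Fin (n + 1) → ℂ} {d : ℕ} (h : SharesTrunc f g a d)
    (hd : 1 ≤ d) (hf : ReducedRepr n f) (hg : ReducedRepr n g) (z : ℂ) :
    lform a f z = 0 ↔ lform a g z = 0 := by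
  obtain ⟨⟨z₁, h1⟩, ⟨z₂, h2⟩, h3, -⟩ := h
  have hf0 : lform a f ≠ 0 := fun h => h1 (congrFun h _)
  have hg0 : lform a g ≠ 0 := fun h => h2 (congrFun h _)
  rw [← not_iff_not, ← ne_eq, ← ne_eq, ← vord_eq_zero_iff (lform_differentiable a hf.1) hf0,
    ← vord_eq_zero_iff (lform_differentiable a hg.1) hg0]
  have := h3 z
  omega

theorem GenPos.wron_ordGe_max (hH : GenPos n q H) (hf : ∀ i, Differentiable ℂ (f i))
    (hq : n + 1 ≤ q) (k : Fin q) {z : ℂ} {m : ℤ} (hm : OrdGe (lform (H k) f) z m) :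
    OrdGe (wron f) z (max 0 (m - n)) := by
  rcases max_cases (0 : ℤ) (m - n) with ⟨h, -⟩ | ⟨h, -⟩ <;> rw [h]
  · exact ((wron_differentiable hf).analyticAt z).ordGe
  · exact hH.wron_ordGe hf hq k hm

/-- The linear forms of two maps that agree on the zeros of all these forms. -/
theorem GenPos.sharedForms (hH : GenPos n q H) (hq : n + 1 ≤ q)
    (hf : ReducedRepr n f) (hg : ReducedRepr n g)
    (hlf : ∀ c : Fin (n + 1) → ℂ, (∀ z, ∑ j, c j * f j z = 0) → c = 0)
    (hlg : ∀ c : Fin (n + 1) → ℂ, (∀ z, ∑ j, c j * g j z = 0) → c = 0)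
    (hf0 : ∀ k, lform (H k) f ≠ 0) (hg0 : ∀ k, lform (H k) g ≠ 0)
    (hsep : ∀ i j z, lform (H i) f z = 0 → lform (H j) f z = 0 → i = j)
    (hcommon : ∀ k z, lform (H k) f z = 0 ↔ lform (H k) g z = 0)
    (hagree : ∀ k z, lform (H k) f z = 0 → ∃ c : ℂ, ∀ i, g i z = c * f i z)
    (hmin : ∀ i j, i ≠ j →
      pairMinor (fun k => lform (H k) f) (fun k => lform (H k) g) i j ≠ 0) :
    SharedForms (logSize f g) n (fun k => lform (H k) f) (fun k => lform (H k) g)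
      (wron f * wron g) where
  cont := continuous_logSize hf hg
  df k := lform_differentiable _ hf.1
  dg k := lform_differentiable _ hg.1
  dV := (wron_differentiable hf.1).mul (wron_differentiable hg.1)
  f0 := hf0
  g0 := hg0
  V0 := entire_mul_ne_zero (wron_differentiable hf.1) (wron_differentiable hg.1)
    (wron_ne_zero hf.1 hlf) (wron_ne_zero hg.1 hlg)
  sep := hsep
  common := hcommon
  minor_zero k z hz i j := by
    obtain ⟨c, hc⟩ := hagree k z hz
    rw [pairMinor_apply, lform_eq_mul_of_eq_mul _ hc, lform_eq_mul_of_eq_mul _ hc]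
    ring
  minor_ne := hmin
  bdd i j := degBdd_lform_mul hf hg _ _
  V_ord k z a b ha hb :=
    ((hH.wron_ordGe_max hf.1 hq k ha).mul (hH.wron_ordGe_max hg.1 hq k hb)).mono (by omega)
  small e := by
    convert hH.smallMer_minorWron hf hg hf0 hg0 e using 1
    ext z
    simp [minorWron, div_eq_mul_inv]

/-- If any six indices satisfy the conclusion of `SharedForms.hasSmallMultiple`, then all but at
most two forms have small multiples. -/
theorem SharedForms.card_filter_le {ι : Type*} [Fintype ι] [DecidableEq ι] {Φ : ℂ → ℝ} {N : ℕ}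
    {F G : ι → ℂ → ℂ} {V : ℂ → ℂ} (h : SharedForms Φ N F G V) (hN : 1 ≤ N)
    (e₀ : Fin (N + 1) × Fin 2 ≃ ι) (hι : 6 ≤ Fintype.card ι) {B : Finset ι}
    (hB : ∀ k ∈ B, ¬ HasSmallMultiple Φ (F k)) : B.card ≤ 2 := by
  by_contra! hcard
  obtain ⟨o, x, y, ho, hx, hy, hox, hoy, hxy⟩ := Finset.two_lt_card_iff.1 hcard
  obtain ⟨S, hS, hSo, hSc⟩ := Finset.exists_subsuperset_card_eq (s := {x, y})
    (t := Finset.univ.erase o) (n := 5)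
    (by
      intro i hi
      simp only [Finset.mem_insert, Finset.mem_singleton] at hi
      rcases hi with rfl | rfl <;> simp [Ne.symm hox, Ne.symm hoy])
    (by rw [Finset.card_pair hxy]; omega)
    (by rw [Finset.card_erase_of_mem (Finset.mem_univ _), Finset.card_univ]; omega)
  set s : Fin 5 → ι := fun i => (S.equivFinOfCardEq hSc).symm i
  have hs : Function.Injective s := Subtype.val_injective.comp (Equiv.injective _)
  have hmem : ∀ k ∈ S, ∃ i, s i = k := fun k hk =>
    ⟨S.equivFinOfCardEq hSc ⟨k, hk⟩, by simp [s]⟩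
  obtain ⟨i, hi⟩ := hmem x (hS (by simp))
  obtain ⟨j, hj⟩ := hmem y (hS (by simp))
  have hij : i ≠ j := by
    rintro rfl
    exact hxy (hi.symm.trans hj)
  rcases h.hasSmallMultiple hN e₀ hs (o := o) fun i => Finset.ne_of_mem_erase
    (hSo ((S.equivFinOfCardEq hSc).symm i).2) with h | ⟨i₀, h⟩
  · exact hB o ho h
  · by_cases hi0 : i = i₀
    · exact hB y hy (hj ▸ h j fun h => hij (hi0.trans h.symm))
    · exact hB x hx (hi ▸ h i hi0)

theorem circleAverage_logSize (hf : ReducedRepr n f) (hg : ReducedRepr n g) :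
    Real.circleAverage (logSize f g) 0 =
      Real.circleAverage (fun z => Real.log ‖fun i => f i z‖) 0 +
        Real.circleAverage (fun z => Real.log ‖fun i => g i z‖) 0 := by
  ext r
  exact Real.circleAverage_add hf.continuous_log_norm.continuousOn.circleIntegrable'
    hg.continuous_log_norm.continuousOn.circleIntegrable'

end

/-- **Main Theorem (one-variable case).** If `n ≥ 2` and two meromorphic maps
`f, g : ℂ → ℙⁿ(ℂ)` share `2n + 1` of `2n + 2` hyperplanes in general position
(with `f⁻¹(H_i) ∩ f⁻¹(H_j) = ∅` for `i < j`) ignoring multiplicity and share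
the last hyperplane with multiplicity truncated by `n + 1`, then `f × g` is
algebraically degenerate. -/
theorem main_theorem_one_variable
    (n : ℕ) (hn : 2 ≤ n)
    (f g : Fin (n + 1) → ℂ → ℂ)
    (hf : ReducedRepr n f) (hg : ReducedRepr n g)
    (H : Fin (2 * n + 2) → Fin (n + 1) → ℂ)
    (hGP : GenPos n (2 * n + 2) H)
    (hsep : ∀ i j : Fin (2 * n + 2), i < j →
      ∀ z : ℂ, ¬(lform (H i) f z = 0 ∧ lform (H j) f z = 0))
    (hshare : ∀ i : Fin (2 * n + 2), (i : ℕ) < 2 * n + 1 → SharesTrunc f g (H i) 1)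
    (hlast : SharesTrunc f g (H ⟨2 * n + 1, by omega⟩) (n + 1)) :
    AlgDeg f g := by
  classical
  by_cases hlf : ∀ c : Fin (n + 1) → ℂ, (∀ z, ∑ j, c j * f j z = 0) → c = 0
  swap
  · push Not at hlf
    obtain ⟨c, hc, hc0⟩ := hlf
    exact .of_linear_left hc0 hc
  by_cases hlg : ∀ c : Fin (n + 1) → ℂ, (∀ z, ∑ j, c j * g j z = 0) → c = 0
  swap
  · push Not at hlg
    obtain ⟨c, hc, hc0⟩ := hlg
    exact .of_linear_right hc0 hc
  by_cases hmin : ∀ i j, i ≠ j →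
      pairMinor (fun k => lform (H k) f) (fun k => lform (H k) g) i j ≠ 0
  swap
  · push Not at hmin
    obtain ⟨i, j, hij, h⟩ := hmin
    exact .of_bilinear (hGP.linearIndependent_pair (by omega) (by omega) hij) fun z => by
      have := congrFun h z
      rwa [pairMinor_apply] at this
  exfalso
  have hsh : ∀ k, ∃ d, 1 ≤ d ∧ SharesTrunc f g (H k) d := by
    intro k
    by_cases hk : (k : ℕ) < 2 * n + 1
    · exact ⟨1, le_rfl, hshare k hk⟩
    · have : k = ⟨2 * n + 1, by omega⟩ := Fin.ext (by simp only; omega)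
      exact ⟨n + 1, by omega, this ▸ hlast⟩
  choose d hd hsh using hsh
  have hf0 : ∀ k, lform (H k) f ≠ 0 := fun k h => by
    obtain ⟨z, hz⟩ := (hsh k).1
    exact hz (congrFun h z)
  have hg0 : ∀ k, lform (H k) g ≠ 0 := fun k h => by
    obtain ⟨z, hz⟩ := (hsh k).2.1
    exact hz (congrFun h z)
  have hcommon : ∀ k z, lform (H k) f z = 0 ↔ lform (H k) g z = 0 :=
    fun k => (hsh k).lform_eq_zero_iff (hd k) hf hg
  have hsep' : ∀ i j z, lform (H i) f z = 0 → lform (H j) f z = 0 → i = j := by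
    intro i j z hi hj
    rcases lt_trichotomy i j with h | h | h
    · exact absurd ⟨hi, hj⟩ (hsep i j h z)
    · exact h
    · exact absurd ⟨hj, hi⟩ (hsep j i h z)
  have hS := hGP.sharedForms (by omega) hf hg hlf hlg hf0 hg0 hsep' hcommon
    (fun k z hz => ((hsh k).2.2.2 z hz).imp fun c hc => hc.2) hmin
  have e₀ : Fin (n + 1) × Fin 2 ≃ Fin (2 * n + 2) :=
    Fintype.equivOfCardEq (by simp only [Fintype.card_prod, Fintype.card_fin]; omega)
  set Φ := logSize f g
  have hΦ : Continuous Φ := continuous_logSize hf hg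
  obtain ⟨Q, hQs, hQ⟩ : ∃ Q ⊆ Finset.univ.filter fun k => HasSmallMultiple Φ (lform (H k) f),
      Q.card = n + 1 + 1 := by
    refine Finset.exists_subset_card_eq ?_
    have h1 := hS.card_filter_le (by omega) e₀ (by rw [Fintype.card_fin]; omega)
      (B := Finset.univ.filter fun k => ¬ HasSmallMultiple Φ (lform (H k) f)) (by simp)
    have h2 := Finset.card_filter_add_card_filter_not (s := (Finset.univ : Finset (Fin (2 * n + 2))))
      fun k => HasSmallMultiple Φ (lform (H k) f)
    rw [Finset.card_univ, Fintype.card_fin] at h2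
    omega
  have hQf : ∀ k ∈ Q, HasSmallMultiple Φ (lform (H k) f) := fun k hk => by
    simpa using hQs hk
  have hQg : ∀ k ∈ Q, HasSmallMultiple Φ (lform (H k) g) := fun k hk => by
    obtain ⟨v, hv, hv0, h⟩ := hQf k hk
    exact ⟨v, hv, hv0, fun z hz => h z ((hcommon k z).2 hz)⟩
  have h1 := hGP.negl_circleAverage_log_norm hf hf0 hsep' (wron_ne_zero hf.1 hlf)
    (fun κ => smallMer_wronQuot (M := lform (H 0) g) (d := 1) hΦ
      (fun j => lform_differentiable _ hf.1) (lform_differentiable _ hg.1) (fun j => hf0 _) (hg0 _)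
      fun j => degBdd_lform_mul hf hg _ _) hQ hQf
  have h2 := hGP.negl_circleAverage_log_norm hg hg0
    (fun i j z hi hj => hsep' i j z ((hcommon i z).2 hi) ((hcommon j z).2 hj))
    (wron_ne_zero hg.1 hlg)
    (fun κ => smallMer_wronQuot (M := lform (H 0) f) (d := 1) hΦ
      (fun j => lform_differentiable _ hg.1) (lform_differentiable _ hf.1) (fun j => hg0 _) (hf0 _)
      fun j => by rw [mul_comm]; exact degBdd_lform_mul hf hg _ _) hQ hQg
  obtain ⟨C, hC⟩ := exists_log_sub_le_circleAverage_logSize (by omega) hf hg hlf (hg0 0)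
  refine not_negl_circleAverage hΦ hC ?_
  rw [circleAverage_logSize hf hg]
  exact h1.add h2
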